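/- The restricted size Ramsey number r*(P_3, C_12) equals 22: there exists a simple graph F on 12 vertices with 22 edges such that F → (P_3, C_12), and every simple graph on 12 vertices with fewer than 22 edges fails to arrow (P_3, C_12). -/

import Mathlib

open SimpleGraph

/-- `F` contains a copy of `G` (an injective graph homomorphism from `G` to `F`). -/
def Contains {α β : Type*} (F : SimpleGraph α) (G : SimpleGraph β) : Prop :=
  ∃ f : G →g F, Function.Injective f

/-- `F → (G, H)`: for every red/blue coloring of the edges of `F` (given by the spanning
subgraph `R ≤ F` of red edges, the other edges of `F` being blue), there is a red copy of `G`
or a blue copy of `H`. -/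
def Arrows {α β γ : Type*} (F : SimpleGraph α) (G : SimpleGraph β) (H : SimpleGraph γ) : Prop :=
  ∀ R : SimpleGraph α, R ≤ F → Contains R G ∨ Contains (F \ R) H

namespace RS

/-! ### A small verified bitset propagation engine

Symmetric relations on `{0, …, 11}` are stored as 144-bit numbers: bit `12 * i + j` stands for the
pair `(i, j)`. A state `(E, U)` describes the relations that contain `E` and are contained in `U`. -/

/-- Clear the lowest set bit. -/
def clr (x : ℕ) : ℕ := Nat.land x (Nat.sub x 1)

def clrN : ℕ → ℕ → ℕ
  | 0, x => x
  | n + 1, x => clrN n (clr x)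

/-- Row `v` of a bit matrix, intersected with `T`. -/
def row (A v T : ℕ) : ℕ := Nat.land (Nat.shiftRight A (Nat.mul 12 v)) T

def bit (A n : ℕ) : Bool := Nat.beq (Nat.land (Nat.shiftRight A n) 1) 1

/-- The symmetric mask of the pair `(v, c)`. -/
def pr (v c : ℕ) : ℕ :=
  Nat.lor (Nat.shiftLeft 1 (Nat.add (Nat.mul 12 v) c)) (Nat.shiftLeft 1 (Nat.add (Nat.mul 12 c) v))

def diff (A B : ℕ) : ℕ := Nat.xor (Nat.lor A B) B

/-- Evaluate a number before passing it on. -/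
def force (x : ℕ) (k : ℕ → Bool) : Bool :=
  match x with
  | 0 => k 0
  | n + 1 => k (n + 1)

/-- Cardinality constraint: vertex `v` has between `lo` and `hi + 1` neighbours in `T`;
`f` is the symmetric mask of the pairs concerned. -/
inductive CCon where
  | mk (v T f lo hi : ℕ) : CCon

def lowCon (v T f lo E U : ℕ) (conf : Bool) (k : ℕ → ℕ → Bool) : Bool :=
  match lo with
  | 0 => k E U
  | lo + 1 =>
    match clrN lo (row U v T) with
    | 0 => conf
    | y + 1 =>
      match clr (y + 1) with
      | 0 => force (Nat.lor E (Nat.land U f)) fun E' => k E' U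
      | _ + 1 => k E U

def applyCon (c : CCon) (E U : ℕ) (conf : Bool) (k : ℕ → ℕ → Bool) : Bool :=
  match c with
  | .mk v T f lo hi =>
    match clrN hi (row E v T) with
    | 0 => lowCon v T f lo E U conf k
    | z + 1 =>
      match clr (z + 1) with
      | 0 => force (diff U (diff f E)) fun U' => lowCon v T f lo E U' conf k
      | _ + 1 => conf

def sweep : List CCon → ℕ → ℕ → Bool → (ℕ → ℕ → Bool) → Bool
  | [], E, U, _, k => k E U
  | c :: cs, E, U, conf, k => applyCon c E U conf fun E' U' => sweep cs E' U' conf k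

/-- Repeat `sweep` until nothing changes. -/
def fix (cons : List CCon) : ℕ → ℕ → ℕ → Bool → (ℕ → ℕ → Bool) → Bool
  | 0, E, U, _, k => k E U
  | n + 1, E, U, conf, k => sweep cons E U conf fun E' U' =>
      match Nat.beq E E', Nat.beq U U' with
      | true, true => k E' U'
      | _, _ => fix cons n E' U' conf k

/-- `j` can be exchanged with `c` in the matrix `A`. -/
def twin (A c j : ℕ) : Bool :=
  Nat.beq (Nat.lor (Nat.xor (row A c 4095) (row A j 4095))
    (Nat.lor (Nat.shiftLeft 1 c) (Nat.shiftLeft 1 j)))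
    (Nat.lor (Nat.shiftLeft 1 c) (Nat.shiftLeft 1 j))

/-- Remove the pairs `(v, j)` for all `j` marked in `m`, after checking that `j` is a twin of `c`. -/
def remTw (D : List ℕ) (v c m E U : ℕ) : List ℕ → ℕ → (ℕ → Bool) → Bool
  | [], W, k => k W
  | j :: js, W, k =>
    match bit m j with
    | false => remTw D v c m E U js W k
    | true =>
      match Nat.beq v j, Nat.beq (D.getD c 0) (D.getD j 0), twin E c j, twin U c j with
      | false, true, true, true => force (diff W (pr v j)) fun W' => remTw D v c m E U js W' k
      | _, _, _, _ => false

def nib (t i : ℕ) : ℕ := Nat.land (Nat.shiftRight t i) 15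

def verts : List ℕ := [0, 1, 2, 3, 4, 5, 6, 7, 8, 9, 10, 11]

/-- The main refutation checker: explores the case tree described by the token list. -/
def check (D : List ℕ) (cons : List CCon) (leaf : ℕ → ℕ → ℕ → Bool) :
    ℕ → List ℕ → ℕ → ℕ → (List ℕ → Bool) → Bool
  | 0, _, _, _, _ => false
  | n + 1, toks, E, U, k =>
    fix cons 30 E U (k toks) fun E U =>
      match toks with
      | [] => false
      | t :: ts =>
        match Nat.beq (nib t 0) 1 with
        | false =>
          match leaf t E U with
          | true => k ts
          | false => false
        | true =>
          force (nib t 4) fun v => force (nib t 8) fun c =>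
          match Nat.ble 12 v, Nat.ble 12 c, Nat.beq v c with
          | false, false, false =>
            force (Nat.lor E (pr v c)) fun E' =>
            check D cons leaf n ts E' U fun ts' =>
              remTw D v c (Nat.shiftRight t 12) E U verts (diff U (pr v c)) fun U' =>
                check D cons leaf n ts' E U' k
          | _, _, _ => false

/-- Subtour test: if `(a, b)` were used, the set `X` would be closed. -/
def subOK (E X : ℕ) : List ℕ → Bool
  | [] => true
  | w :: ws =>
    match bit X w with
    | false => subOK E X ws
    | true =>
      match Nat.beq (clr (row E w 4095)) 0,
          Nat.beq (Nat.land (row E w 4095) X) (row E w 4095) with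
      | false, true => subOK E X ws
      | _, _ => false

def items (consH : List CCon) : ℕ → ℕ → ℕ → ℕ → Bool
  | 0, _, E, U => fix consH 30 E U true fun _ _ => false
  | n + 1, s, E, U => fix consH 30 E U true fun E U =>
      force (nib s 0) fun a => force (nib s 4) fun b =>
      force (Nat.land (Nat.shiftRight s 8) 4095) fun X =>
      match bit X a, Nat.beq X 4095, Nat.ble 12 a, Nat.ble 12 b, subOK (Nat.lor E (pr a b)) X verts with
      | true, false, false, false, true =>
        force (diff U (pr a b)) fun U' => items consH n (Nat.shiftRight s 20) E U'
      | _, _, _, _, _ => false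

/-- Remove a matching from `U`, then continue. -/
def killM (E : ℕ) : ℕ → ℕ → ℕ → ℕ → (ℕ → ℕ → Bool) → Bool
  | 0, s, _, U, k => k s U
  | n + 1, s, used, U, k =>
      force (nib s 0) fun a => force (nib s 4) fun b =>
      match Nat.ble 12 a, Nat.ble 12 b, Nat.beq a b, bit used a, bit used b,
          bit E (Nat.add (Nat.mul 12 a) b) with
      | false, false, false, false, false, true =>
        killM E n (Nat.shiftRight s 8) (Nat.lor used (Nat.lor (Nat.shiftLeft 1 a) (Nat.shiftLeft 1 b)))
          (diff U (pr a b)) k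
      | _, _, _, _, _, _ => false

def leafKill (consH : List CCon) (t E U : ℕ) : Bool :=
  killM E (nib t 4) (Nat.shiftRight t 8) 0 U fun s U' =>
    force U' fun Unew => items consH (nib s 0) (Nat.shiftRight s 4) 0 Unew

/-! ### Soundness of the engine -/

/-- Entry `(i, j)` of the bit matrix `X`. -/
def T (X i j : ℕ) : Prop := X.testBit (12 * i + j) = true

theorem tb_lor (x y i : ℕ) : (Nat.lor x y).testBit i = (x.testBit i || y.testBit i) :=
  Nat.testBit_or x y i

theorem tb_land (x y i : ℕ) : (Nat.land x y).testBit i = (x.testBit i && y.testBit i) :=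
  Nat.testBit_and x y i

theorem tb_xor (x y i : ℕ) : (Nat.xor x y).testBit i = (x.testBit i ^^ y.testBit i) :=
  Nat.testBit_xor x y i

theorem tb_diff (x y i : ℕ) : (diff x y).testBit i = (x.testBit i && !y.testBit i) := by
  unfold diff
  rw [tb_xor, tb_lor]
  cases x.testBit i <;> cases y.testBit i <;> rfl

theorem tb_shr (x n i : ℕ) : (Nat.shiftRight x n).testBit i = x.testBit (n + i) :=
  Nat.testBit_shiftRight x

theorem tb_one (n i : ℕ) : (Nat.shiftLeft 1 n).testBit i = decide (i = n) := by
  have : Nat.shiftLeft 1 n = 2 ^ n := by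
    have := Nat.one_shiftLeft n
    exact this
  rw [this, Nat.testBit_two_pow]
  simp [eq_comm]

theorem bit_eq (x n : ℕ) : bit x n = x.testBit n := by
  have h : Nat.land (Nat.shiftRight x n) 1 = (x.testBit n).toNat := by
    have h1 : Nat.land (Nat.shiftRight x n) 1 = (x >>> n) &&& 1 := rfl
    rw [h1, Nat.and_one_is_mod, Nat.testBit, Nat.and_comm, Nat.and_one_is_mod]
    have := Nat.mod_two_eq_zero_or_one (x >>> n)
    rcases this with h | h <;> simp [h]
  unfold bit
  rw [h]
  cases x.testBit n <;> rfl

theorem force_eq (x : ℕ) (k : ℕ → Bool) : force x k = k x := by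
  cases x <;> rfl

theorem T_lor (X Y i j : ℕ) : T (Nat.lor X Y) i j ↔ T X i j ∨ T Y i j := by
  simp [T]

theorem T_land (X Y i j : ℕ) : T (Nat.land X Y) i j ↔ T X i j ∧ T Y i j := by
  simp [T]

theorem T_diff (X Y i j : ℕ) : T (diff X Y) i j ↔ T X i j ∧ ¬ T Y i j := by
  simp [T, tb_diff]

theorem T_pr {v c i j : ℕ} (hv : v < 12) (hc : c < 12) (_hi : i < 12) (hj : j < 12) :
    T (pr v c) i j ↔ (i = v ∧ j = c) ∨ (i = c ∧ j = v) := by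
  unfold T pr
  rw [tb_lor, tb_one, tb_one]
  simp only [Bool.or_eq_true, decide_eq_true_eq, Nat.mul_eq, Nat.add_eq]
  omega

theorem tb_row (X v S j : ℕ) : (row X v S).testBit j = true ↔ T X v j ∧ S.testBit j = true := by
  unfold row T
  rw [tb_land, tb_shr]
  simp

theorem tb_4095 {j : ℕ} : Nat.testBit 4095 j = true ↔ j < 12 := by
  have : (4095 : ℕ) = 2 ^ 12 - 1 := by norm_num
  rw [this, Nat.testBit_two_pow_sub_one]
  simp

theorem clr_zero : clr 0 = 0 := rfl

theorem clr_spec (x : ℕ) : x ≠ 0 →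
    ∃ b, x.testBit b = true ∧ ∀ i, (clr x).testBit i = true ↔ x.testBit i = true ∧ i ≠ b := by
  induction x using Nat.strong_induction_on with
  | _ x ih =>
    intro hx
    have hc : clr x = x &&& (x - 1) := rfl
    rcases Nat.even_or_odd' x with ⟨y, rfl | rfl⟩
    · have hy : y ≠ 0 := by omega
      obtain ⟨b, hb, h⟩ := ih y (by omega) hy
      have hcy : clr y = y &&& (y - 1) := rfl
      refine ⟨b + 1, ?_, ?_⟩
      · rw [Nat.testBit_succ]; rwa [Nat.mul_div_cancel_left _ (by norm_num)]
      · intro i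
        cases i with
        | zero => rw [hc]; simp
        | succ i =>
          have h1 : (2 * y - 1) / 2 = y - 1 := by omega
          have h2 : 2 * y / 2 = y := by omega
          have := h i
          rw [hcy] at this
          rw [hc, Nat.testBit_and, Nat.testBit_succ, Nat.testBit_succ, h1, h2, ← Nat.testBit_and, this]
          simp
    · refine ⟨0, by simp, ?_⟩
      intro i
      cases i with
      | zero => rw [hc]; simp
      | succ i =>
        have h1 : (2 * y + 1 - 1) / 2 = y := by omega
        have h2 : (2 * y + 1) / 2 = y := by omega
        rw [hc, Nat.testBit_and, Nat.testBit_succ, Nat.testBit_succ, h1, h2]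
        simp

theorem clrN_zero (n : ℕ) : clrN n 0 = 0 := by
  induction n with
  | zero => rfl
  | succ n ih => exact ih

theorem clrN_succ (n x : ℕ) : clrN (n + 1) x = clr (clrN n x) := by
  induction n generalizing x with
  | zero => rfl
  | succ n ih => exact ih (clr x)

theorem le_card_of_clrN (n : ℕ) : ∀ (x : ℕ) (s : Finset ℕ), clrN n x ≠ 0 →
    (∀ b, x.testBit b = true → b ∈ s) → n + 1 ≤ s.card := by
  induction n with
  | zero =>
    intro x s hx hs
    obtain ⟨b, hb, -⟩ := clr_spec x hx
    exact Finset.card_pos.2 ⟨b, hs b hb⟩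
  | succ n ih =>
    intro x s hx hs
    have hx0 : x ≠ 0 := by
      rintro rfl
      exact hx (clrN_zero _)
    obtain ⟨b, hb, h⟩ := clr_spec x hx0
    have := ih (clr x) (s.erase b) hx (by
      intro i hi
      have := (h i).1 hi
      exact Finset.mem_erase.2 ⟨this.2, hs i this.1⟩)
    rw [Finset.card_erase_of_mem (hs b hb)] at this
    omega

theorem card_le_of_clrN (n : ℕ) : ∀ (x : ℕ) (s : Finset ℕ), clrN n x = 0 →
    (∀ b ∈ s, x.testBit b = true) → s.card ≤ n := by
  induction n with
  | zero =>
    intro x s hx hs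
    have hx : x = 0 := hx
    subst hx
    rw [Finset.card_eq_zero.2]
    rw [Finset.eq_empty_iff_forall_notMem]
    intro b hb
    simpa using hs b hb
  | succ n ih =>
    intro x s hx hs
    by_cases hx0 : x = 0
    · subst hx0
      rw [Finset.card_eq_zero.2]
      · omega
      rw [Finset.eq_empty_iff_forall_notMem]
      intro b hb
      simpa using hs b hb
    · obtain ⟨b, hb, h⟩ := clr_spec x hx0
      have := ih (clr x) (s.erase b) hx (by
        intro i hi
        rw [Finset.mem_erase] at hi
        exact (h i).2 ⟨hs i hi.2, hi.1⟩)
      have := Finset.pred_card_le_card_erase (s := s) (a := b)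
      omega

/-- Symmetric bit matrices. -/
def Sym (X : ℕ) : Prop := ∀ i < 12, ∀ j < 12, T X i j → T X j i

theorem Sym.lor {X Y : ℕ} (hX : Sym X) (hY : Sym Y) : Sym (Nat.lor X Y) := by
  intro i hi j hj h
  rw [T_lor] at h ⊢
  exact h.imp (hX i hi j hj) (hY i hi j hj)

theorem Sym.land {X Y : ℕ} (hX : Sym X) (hY : Sym Y) : Sym (Nat.land X Y) := by
  intro i hi j hj h
  rw [T_land] at h ⊢
  exact h.imp (hX i hi j hj) (hY i hi j hj)

theorem Sym.diff {X Y : ℕ} (hX : Sym X) (hY : Sym Y) : Sym (diff X Y) := by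
  intro i hi j hj h
  rw [T_diff] at h ⊢
  exact ⟨hX i hi j hj h.1, fun h' => h.2 (hY j hj i hi h')⟩

theorem Sym.pr {v c : ℕ} (hv : v < 12) (hc : c < 12) : Sym (pr v c) := by
  intro i hi j hj h
  rw [T_pr hv hc hi hj] at h
  rw [T_pr hv hc hj hi]
  tauto

/-- The relation `A` is described by the state `(E, U)`. -/
def St (A : ℕ → ℕ → Prop) (E U : ℕ) : Prop :=
  Sym E ∧ Sym U ∧ ∀ i < 12, ∀ j < 12, (T E i j → A i j) ∧ (A i j → T U i j)

open Classical in
/-- Neighbours of `v` in `S`. -/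
noncomputable def nb (A : ℕ → ℕ → Prop) (v S : ℕ) : Finset ℕ :=
  (Finset.range 12).filter fun j => A v j ∧ S.testBit j = true

theorem mem_nb {A : ℕ → ℕ → Prop} {v S j : ℕ} :
    j ∈ nb A v S ↔ j < 12 ∧ A v j ∧ S.testBit j = true := by
  simp [nb]

/-- Masks of a constraint. -/
def Mask (v S f : ℕ) : Prop := Sym f ∧ ∀ i < 12, ∀ j < 12, T f i j →
    (i = v ∧ S.testBit j = true) ∨ (j = v ∧ S.testBit i = true)

/-- Validity of a constraint for `A`. -/
def Good (A : ℕ → ℕ → Prop) : CCon → Prop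
  | .mk v S f lo hi => v < 12 ∧ (∀ j, S.testBit j = true → j < 12) ∧ Mask v S f ∧
      lo ≤ (nb A v S).card ∧ (nb A v S).card ≤ hi + 1

/-- The outcome of a propagation step on the state `(E, U)`. -/
def Outcome (P : (ℕ → ℕ → Prop) → Prop) (E U : ℕ) (conf : Bool) (k : ℕ → ℕ → Bool) (r : Bool) :
    Prop :=
  (r = conf ∧ ∀ A, P A → ¬ St A E U) ∨
    ∃ E' U', r = k E' U' ∧ ∀ A, P A → St A E U → St A E' U'

theorem lowCon_sound {P : (ℕ → ℕ → Prop) → Prop} (hsym : ∀ A, P A → ∀ i j, A i j → A j i)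
    {v S f lo hi : ℕ} (hg : ∀ A, P A → Good A (.mk v S f lo hi)) (E U : ℕ) (conf : Bool)
    (k : ℕ → ℕ → Bool) :
    Outcome P E U conf k (lowCon v S f lo E U conf k) := by
  unfold lowCon
  split
  · exact Or.inr ⟨E, U, rfl, fun A _ h => h⟩
  · rename_i lo
    have key : ∀ A, P A → St A E U → ∀ j ∈ nb A v S, (row U v S).testBit j = true := by
      intro A hA hS j hj
      obtain ⟨hv, -⟩ := hg A hA
      rw [mem_nb] at hj
      exact (tb_row _ _ _ _).2 ⟨(hS.2.2 v hv j hj.1).2 hj.2.1, hj.2.2⟩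
    split
    · rename_i h0
      refine Or.inl ⟨rfl, fun A hA hS => ?_⟩
      have h1 := card_le_of_clrN lo _ (nb A v S) h0 (key A hA hS)
      have := (hg A hA).2.2.2.1
      omega
    · rename_i y hy
      split
      · rename_i h0
        replace hy : clrN lo (row U v S) = y + 1 := hy
        rw [← hy, ← clrN_succ] at h0
        rw [force_eq]
        refine Or.inr ⟨_, _, rfl, fun A hA hS => ?_⟩
        obtain ⟨hv, hS12, ⟨hf1, hf2⟩, hlo, -⟩ := hg A hA
        refine ⟨hS.1.lor (hS.2.1.land hf1), hS.2.1, fun i hi j hj => ⟨?_, (hS.2.2 i hi j hj).2⟩⟩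
        have heq : nb A v S = nb (T U) v S := by
          apply Finset.eq_of_subset_of_card_le
          · intro x hx
            rw [mem_nb] at hx ⊢
            exact ⟨hx.1, (hS.2.2 v hv x hx.1).2 hx.2.1, hx.2.2⟩
          · refine le_trans (card_le_of_clrN (lo + 1) _ _ h0 ?_) hlo
            intro b hb
            rw [mem_nb] at hb
            exact (tb_row _ _ _ _).2 hb.2
        have hU : ∀ x < 12, T U v x → S.testBit x = true → A v x := by
          intro x hx h1 h2
          have : x ∈ nb A v S := by
            rw [heq, mem_nb]
            exact ⟨hx, h1, h2⟩
          exact (mem_nb.1 this).2.1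
        rw [T_lor, T_land]
        rintro (h | ⟨h1, h2⟩)
        · exact (hS.2.2 i hi j hj).1 h
        · rcases hf2 i hi j hj h2 with ⟨rfl, h3⟩ | ⟨rfl, h3⟩
          · exact hU j hj h1 h3
          · exact hsym A hA _ _ (hU i hi (hS.2.1 i hi j hj h1) h3)
      · exact Or.inr ⟨E, U, rfl, fun A _ h => h⟩

theorem Outcome.trans {P : (ℕ → ℕ → Prop) → Prop} {E U E' U' : ℕ} {conf : Bool}
    {k : ℕ → ℕ → Bool} {r : Bool} (h : ∀ A, P A → St A E U → St A E' U')
    (h' : Outcome P E' U' conf k r) : Outcome P E U conf k r := by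
  rcases h' with ⟨h1, h2⟩ | ⟨E2, U2, h1, h2⟩
  · exact Or.inl ⟨h1, fun A hA hS => h2 A hA (h A hA hS)⟩
  · exact Or.inr ⟨E2, U2, h1, fun A hA hS => h2 A hA (h A hA hS)⟩

theorem applyCon_sound {P : (ℕ → ℕ → Prop) → Prop} (hsym : ∀ A, P A → ∀ i j, A i j → A j i)
    (c : CCon) (hg : ∀ A, P A → Good A c) (E U : ℕ) (conf : Bool)
    (k : ℕ → ℕ → Bool) :
    Outcome P E U conf k (applyCon c E U conf k) := by
  obtain ⟨v, S, f, lo, hi⟩ := c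
  have hlow := fun E U => lowCon_sound hsym hg E U conf k
  unfold applyCon
  have key : ∀ A, P A → St A E U → ∀ j, (row E v S).testBit j = true → j ∈ nb A v S := by
    intro A hA hS j hj
    obtain ⟨hv, hS12, -⟩ := hg A hA
    rw [tb_row] at hj
    rw [mem_nb]
    exact ⟨hS12 j hj.2, (hS.2.2 v hv j (hS12 j hj.2)).1 hj.1, hj.2⟩
  dsimp only
  split
  · exact hlow E U
  · rename_i z hz
    split
    · rw [force_eq]
      refine Outcome.trans ?_ (hlow _ _)
      intro A hA hS
      obtain ⟨hv, hS12, ⟨hf1, hf2⟩, -, hhi⟩ := hg A hA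
      refine ⟨hS.1, hS.2.1.diff (hf1.diff hS.1), fun i hi j hj => ⟨(hS.2.2 i hi j hj).1, ?_⟩⟩
      have heq : nb (T E) v S = nb A v S := by
        apply Finset.eq_of_subset_of_card_le
        · intro x hx
          rw [mem_nb] at hx ⊢
          exact ⟨hx.1, (hS.2.2 v hv x hx.1).1 hx.2.1, hx.2.2⟩
        · refine le_trans hhi (le_card_of_clrN _ (row E v S) _ (by rw [hz]; exact Nat.succ_ne_zero _) ?_)
          intro b hb
          rw [tb_row] at hb
          exact mem_nb.2 ⟨hS12 b hb.2, hb⟩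
      have hE : ∀ x < 12, A v x → S.testBit x = true → T E v x := by
        intro x hx h1 h2
        have : x ∈ nb (T E) v S := by
          rw [heq, mem_nb]
          exact ⟨hx, h1, h2⟩
        exact (mem_nb.1 this).2.1
      intro hA'
      rw [T_diff, T_diff]
      refine ⟨(hS.2.2 i hi j hj).2 hA', ?_⟩
      rintro ⟨h1, h2⟩
      apply h2
      rcases hf2 i hi j hj h1 with ⟨rfl, h3⟩ | ⟨rfl, h3⟩
      · exact hE j hj hA' h3
      · exact hS.1 _ hj _ hi (hE i hi (hsym A hA _ _ hA') h3)
    · rename_i y hy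
      refine Or.inl ⟨rfl, fun A hA hS => ?_⟩
      have hne : clrN (hi + 1) (row E v S) ≠ 0 := by
        rw [clrN_succ, hz, hy]
        exact Nat.succ_ne_zero _
      have h1 := le_card_of_clrN _ _ _ hne (key A hA hS)
      have := (hg A hA).2.2.2.2
      omega

theorem sweep_sound {P : (ℕ → ℕ → Prop) → Prop} (hsym : ∀ A, P A → ∀ i j, A i j → A j i)
    (cs : List CCon) : (∀ A, P A → ∀ c ∈ cs, Good A c) → ∀ (E U : ℕ) (conf : Bool)
    (k : ℕ → ℕ → Bool), Outcome P E U conf k (sweep cs E U conf k) := by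
  induction cs with
  | nil => exact fun _ E U conf k => Or.inr ⟨E, U, rfl, fun A _ h => h⟩
  | cons c cs ih =>
    intro hg E U conf k
    rcases applyCon_sound hsym c (fun A hA => hg A hA c (by simp)) E U conf
      (fun E' U' => sweep cs E' U' conf k) with ⟨h1, h2⟩ | ⟨E', U', h1, h2⟩
    · exact Or.inl ⟨h1, h2⟩
    · have h3 := ih (fun A hA c hc => hg A hA c (by simp [hc])) E' U' conf k
      have h4 : sweep (c :: cs) E U conf k = sweep cs E' U' conf k := h1
      rw [h4]
      exact Outcome.trans h2 h3

theorem fix_sound {P : (ℕ → ℕ → Prop) → Prop} (hsym : ∀ A, P A → ∀ i j, A i j → A j i)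
    (cs : List CCon) (hg : ∀ A, P A → ∀ c ∈ cs, Good A c) (n : ℕ) : ∀ (E U : ℕ) (conf : Bool)
    (k : ℕ → ℕ → Bool), Outcome P E U conf k (fix cs n E U conf k) := by
  induction n with
  | zero => exact fun E U conf k => Or.inr ⟨E, U, rfl, fun A _ h => h⟩
  | succ n ih =>
    intro E U conf k
    unfold fix
    rcases sweep_sound hsym cs hg E U conf (fun E' U' =>
      match Nat.beq E E', Nat.beq U U' with
      | true, true => k E' U'
      | _, _ => fix cs n E' U' conf k) with ⟨h1, h2⟩ | ⟨E', U', h1, h2⟩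
    · exact Or.inl ⟨h1, h2⟩
    · rw [h1]
      refine Outcome.trans h2 ?_
      dsimp only
      split
      · exact Or.inr ⟨E', U', rfl, fun A _ h => h⟩
      · exact ih E' U' conf k

theorem twin_spec {X c j : ℕ} (h : twin X c j = true) {i : ℕ} (hi : i < 12) (hc : i ≠ c)
    (hj : i ≠ j) : T X c i ↔ T X j i := by
  unfold twin at h
  have h1 := Nat.eq_of_beq_eq_true h
  have h2 := congrArg (fun x => x.testBit i) h1
  simp only [tb_lor, tb_xor, tb_one, hc, hj, decide_false, Bool.or_false] at h2
  have h3 : (row X c 4095).testBit i = (row X j 4095).testBit i := by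
    revert h2
    cases (row X c 4095).testBit i <;> cases (row X j 4095).testBit i <;> simp
  have h4 := tb_row X c 4095 i
  have h5 := tb_row X j 4095 i
  rw [h3] at h4
  simp only [tb_4095, hi, and_true] at h4 h5
  exact h4.symm.trans h5

/-- Exchange the labels `c` and `j`. -/
def swp (c j : ℕ) (A : ℕ → ℕ → Prop) : ℕ → ℕ → Prop :=
  fun x y => A (Equiv.swap c j x) (Equiv.swap c j y)

theorem swap_lt {c j x : ℕ} (hc : c < 12) (hj : j < 12) (hx : x < 12) : Equiv.swap c j x < 12 := by
  rw [Equiv.swap_apply_def]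
  split_ifs <;> assumption

theorem twin_swap {X c j : ℕ} (hX : Sym X) (hc : c < 12) (hj : j < 12) (h : twin X c j = true)
    {x y : ℕ} (hx : x < 12) (hy : y < 12) (hxy : x ≠ y) (hT : T X x y) :
    T X (Equiv.swap c j x) (Equiv.swap c j y) := by
  have hs := fun {i : ℕ} => @twin_spec X c j h i
  rw [Equiv.swap_apply_def, Equiv.swap_apply_def]
  by_cases h1 : x = c
  · subst h1
    by_cases h2 : y = j
    · subst h2
      simp only [if_true, Ne.symm hxy, if_false]
      exact hX _ hx _ hy hT
    · simp only [if_true, Ne.symm hxy, h2, if_false]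
      exact (hs hy (Ne.symm hxy) h2).1 hT
  · by_cases h2 : x = j
    · subst h2
      by_cases h3 : y = c
      · subst h3
        simp only [if_true, h1, if_false]
        exact hX _ hx _ hy hT
      · simp only [if_true, h1, h3, Ne.symm hxy, if_false]
        exact (hs hy h3 (Ne.symm hxy)).2 hT
    · simp only [h1, h2, if_false]
      by_cases h3 : y = c
      · subst h3
        simp only [if_true]
        exact hX _ hj _ hx ((hs hx h1 h2).1 (hX _ hx _ hy hT))
      · by_cases h4 : y = j
        · subst h4
          simp only [h3, if_true, if_false]
          exact hX _ hc _ hx ((hs hx h1 h2).2 (hX _ hx _ hy hT))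
        · simp only [h3, h4, if_false]
          exact hT

theorem St.swp {A : ℕ → ℕ → Prop} (hirr : ∀ i, ¬ A i i) {E U c j : ℕ} (hS : St A E U)
    (hc : c < 12) (hj : j < 12) (hE : twin E c j = true) (hU : twin U c j = true) :
    St (swp c j A) E U := by
  refine ⟨hS.1, hS.2.1, fun x hx y hy => ⟨fun h => ?_, fun h => ?_⟩⟩
  · have hxy : x ≠ y := by
      rintro rfl
      exact hirr _ ((hS.2.2 x hx x hx).1 h)
    exact (hS.2.2 _ (swap_lt hc hj hx) _ (swap_lt hc hj hy)).1 (twin_swap hS.1 hc hj hE hx hy hxy h)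
  · have hxy : x ≠ y := by
      rintro rfl
      exact hirr _ h
    have h1 := (hS.2.2 _ (swap_lt hc hj hx) _ (swap_lt hc hj hy)).2 h
    have h2 := twin_swap hS.2.1 hc hj hU (swap_lt hc hj hx) (swap_lt hc hj hy)
      (fun h => hxy ((Equiv.swap c j).injective h)) h1
    simpa using h2

theorem remTw_sound {D : List ℕ} {v c m E U : ℕ} (hv : v < 12) (js : List ℕ) :
    (∀ j ∈ js, j < 12) → ∀ (W : ℕ) (k : ℕ → Bool), remTw D v c m E U js W k = true →
    ∃ W', k W' = true ∧ (Sym W → Sym W') ∧ ∀ x < 12, ∀ y < 12, T W x y → T W' x y ∨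
      ∃ j < 12, v ≠ j ∧ D.getD c 0 = D.getD j 0 ∧ twin E c j = true ∧ twin U c j = true ∧
        ((x = v ∧ y = j) ∨ (x = j ∧ y = v)) := by
  induction js with
  | nil => exact fun _ W k h => ⟨W, h, id, fun x _ y _ h => Or.inl h⟩
  | cons j js ih =>
    intro hjs W k h
    have ih' := ih (fun j hj => hjs j (by simp [hj]))
    have hj : j < 12 := hjs j (by simp)
    unfold remTw at h
    split at h
    · exact ih' W k h
    · split at h
      · rename_i h1 h2 h3 h4
        rw [force_eq] at h
        obtain ⟨W', hk, hsy, hW⟩ := ih' _ _ h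
        refine ⟨W', hk, fun h => hsy (h.diff (Sym.pr hv hj)), fun x hx y hy hT => ?_⟩
        by_cases hp : T (pr v j) x y
        · refine Or.inr ⟨j, hj, Nat.ne_of_beq_eq_false h1, Nat.eq_of_beq_eq_true h2, h3, h4, ?_⟩
          exact (T_pr hv hj hx hy).1 hp
        · exact hW x hx y hy ((T_diff _ _ _ _).2 ⟨hT, hp⟩)
      · exact absurd h (by simp)

theorem verts_lt : ∀ j ∈ verts, j < 12 := by decide

theorem mem_verts {j : ℕ} (h : j < 12) : j ∈ verts := by
  unfold verts
  interval_cases j <;> simp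

theorem lt_of_ble {v : ℕ} (h : Nat.ble 12 v = false) : v < 12 := by
  by_contra h'
  rw [Nat.ble_eq_true_of_le (by omega)] at h
  exact absurd h (by simp)

theorem check_sound {Q : (ℕ → ℕ → Prop) → Prop} {D : List ℕ} {cons : List CCon}
    {leaf : ℕ → ℕ → ℕ → Bool} (hsym : ∀ A, Q A → ∀ i j, A i j → A j i)
    (hirr : ∀ A, Q A → ∀ i, ¬ A i i) (hg : ∀ A, Q A → ∀ c ∈ cons, Good A c)
    (hsw : ∀ A, Q A → ∀ c < 12, ∀ j < 12, D.getD c 0 = D.getD j 0 → Q (swp c j A))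
    (hleaf : ∀ t E U, leaf t E U = true → ∀ A, Q A → ¬ St A E U) (n : ℕ) :
    ∀ (toks : List ℕ) (E U : ℕ) (k : List ℕ → Bool), check D cons leaf n toks E U k = true →
      (∀ A, Q A → ¬ St A E U) ∧ ∃ r, k r = true := by
  induction n with
  | zero => intro toks E U k h; exact absurd h (by simp [check])
  | succ n ih =>
    intro toks E U k h
    unfold check at h
    rcases fix_sound hsym cons hg 30 E U (k toks) _ with ⟨h1, h2⟩ | ⟨E1, U1, h1, h2⟩
    · rw [h1] at h
      exact ⟨h2, _, h⟩
    rw [h1] at h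
    clear h1
    suffices hs : (∀ A, Q A → ¬ St A E1 U1) ∧ ∃ r, k r = true from
      ⟨fun A hA hS => hs.1 A hA (h2 A hA hS), hs.2⟩
    clear h2
    split at h
    · exact absurd h (by simp)
    rename_i t ts
    split at h
    · split at h
      · rename_i hl
        exact ⟨hleaf _ _ _ hl, _, h⟩
      · exact absurd h (by simp)
    · rw [force_eq, force_eq] at h
      generalize nib t 4 = v at h
      generalize nib t 8 = c at h
      split at h
      · rename_i hv hc hvc
        replace hv := lt_of_ble hv
        replace hc := lt_of_ble hc
        replace hvc := Nat.ne_of_beq_eq_false hvc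
        rw [force_eq] at h
        obtain ⟨hn, r, hr⟩ := ih _ _ _ _ h
        obtain ⟨W', hk, hsy, hW⟩ := remTw_sound hv verts verts_lt _ _ hr
        obtain ⟨hn', hr'⟩ := ih _ _ _ _ hk
        refine ⟨fun A hA hS => ?_, hr'⟩
        have hno : ∀ A, Q A → St A E1 U1 → ¬ A v c := by
          intro A hA hS hvc
          refine hn A hA ⟨hS.1.lor (Sym.pr hv hc), hS.2.1, fun x hx y hy =>
            ⟨fun h => ?_, (hS.2.2 x hx y hy).2⟩⟩
          rw [T_lor, T_pr hv hc hx hy] at h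
          rcases h with h | ⟨rfl, rfl⟩ | ⟨rfl, rfl⟩
          · exact (hS.2.2 x hx y hy).1 h
          · exact hvc
          · exact hsym A hA _ _ hvc
        refine hn' A hA ⟨hS.1, hsy (hS.2.1.diff (Sym.pr hv hc)), fun x hx y hy =>
          ⟨(hS.2.2 x hx y hy).1, fun hxy => ?_⟩⟩
        have hd : T (diff U1 (pr v c)) x y := by
          rw [T_diff, T_pr hv hc hx hy]
          refine ⟨(hS.2.2 x hx y hy).2 hxy, ?_⟩
          rintro (⟨rfl, rfl⟩ | ⟨rfl, rfl⟩)
          · exact hno A hA hS hxy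
          · exact hno A hA hS (hsym A hA _ _ hxy)
        rcases hW x hx y hy hd with h | ⟨j, hj, hvj, hD, hE, hU, hh⟩
        · exact h
        · exfalso
          refine hno _ (hsw A hA c hc j hj hD) (hS.swp (hirr A hA) hc hj hE hU) ?_
          show A (Equiv.swap c j v) (Equiv.swap c j c)
          rw [Equiv.swap_apply_left, Equiv.swap_apply_of_ne_of_ne hvc hvj]
          rcases hh with ⟨rfl, rfl⟩ | ⟨rfl, rfl⟩
          · exact hxy
          · exact hsym A hA _ _ hxy
      · exact absurd h (by simp)

theorem subOK_spec {E X : ℕ} (l : List ℕ) : subOK E X l = true → ∀ w ∈ l, X.testBit w = true →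
    clr (row E w 4095) ≠ 0 ∧ ∀ j < 12, T E w j → X.testBit j = true := by
  induction l with
  | nil => intro _ w hw; simp at hw
  | cons a l ih =>
    intro h w hw hX
    unfold subOK at h
    rw [bit_eq] at h
    split at h
    · rename_i ha
      rcases List.mem_cons.1 hw with rfl | hw
      · rw [hX] at ha
        exact absurd ha (by simp)
      · exact ih h w hw hX
    · split at h
      · rename_i h1 h2
        rcases List.mem_cons.1 hw with rfl | hw
        · refine ⟨Nat.ne_of_beq_eq_false h1, fun j hj hT => ?_⟩
          have h3 := congrArg (fun x => x.testBit j) (Nat.eq_of_beq_eq_true h2)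
          have h4 := (tb_row E w 4095 j).2 ⟨hT, tb_4095.2 hj⟩
          simp only [tb_land, h4, Bool.true_and] at h3
          exact h3
        · exact ih h w hw hX
      · exact absurd h (by simp)

/-- The properties of the relation given by a Hamiltonian cycle. -/
structure HamRel (consH : List CCon) (H : ℕ → ℕ → Prop) : Prop where
  symm : ∀ i j, H i j → H j i
  good : ∀ c ∈ consH, Good H c
  two : ∀ v < 12, (nb H v 4095).card = 2
  conn : ∀ (X : ℕ → Prop) (a : ℕ), a < 12 → X a →
    (∀ i < 12, ∀ j < 12, X i → H i j → X j) → ∀ j < 12, X j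

theorem items_sound {consH : List CCon} (n : ℕ) : ∀ s E U, items consH n s E U = true →
    ∀ H, HamRel consH H → ¬ St H E U := by
  induction n with
  | zero =>
    intro s E U h H hH hS
    unfold items at h
    rcases fix_sound (P := HamRel consH) (fun A h => h.symm) consH (fun A h => h.good) 30 E U true
      (fun _ _ => false) with ⟨h1, h2⟩ | ⟨E1, U1, h1, h2⟩
    · exact h2 H hH hS
    · rw [h1] at h
      exact absurd h (by simp)
  | succ n ih =>
    intro s E U h H hH hS
    unfold items at h
    rcases fix_sound (P := HamRel consH) (fun A h => h.symm) consH (fun A h => h.good) 30 E U true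
      _ with ⟨h1, h2⟩ | ⟨E1, U1, h1, h2⟩
    · exact h2 H hH hS
    rw [h1] at h
    clear h1
    replace hS := h2 H hH hS
    clear h2
    simp only [force_eq] at h
    generalize nib s 0 = a at h
    generalize nib s 4 = b at h
    generalize hXd : (s.shiftRight 8).land 4095 = X at h
    split at h
    · rename_i h1 h2 h3 h4 h5
      rw [bit_eq] at h1
      replace h3 := lt_of_ble h3
      replace h4 := lt_of_ble h4
      have hno : ¬ H a b := by
        intro hab
        have hsub : ∀ x < 12, ∀ y < 12, T (Nat.lor E1 (pr a b)) x y → H x y := by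
          intro x hx y hy h
          rw [T_lor, T_pr h3 h4 hx hy] at h
          rcases h with h | ⟨rfl, rfl⟩ | ⟨rfl, rfl⟩
          · exact (hS.2.2 x hx y hy).1 h
          · exact hab
          · exact hH.symm _ _ hab
        have hsp := subOK_spec verts h5
        have hall := hH.conn (fun x => X.testBit x = true) a h3 h1 (by
          intro i hi j hj hXi hij
          obtain ⟨g1, g2⟩ := hsp i (mem_verts hi) hXi
          apply g2 j hj
          have heq : nb (T (Nat.lor E1 (pr a b))) i 4095 = nb H i 4095 := by
            apply Finset.eq_of_subset_of_card_le
            · intro x hx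
              rw [mem_nb] at hx ⊢
              exact ⟨hx.1, hsub i hi x hx.1 hx.2.1, hx.2.2⟩
            · rw [hH.two i hi]
              refine le_card_of_clrN 1 _ _ g1 ?_
              intro y hy
              rw [tb_row] at hy
              exact mem_nb.2 ⟨tb_4095.1 hy.2, hy⟩
          have : j ∈ nb H i 4095 := mem_nb.2 ⟨hj, hij, tb_4095.2 hj⟩
          rw [← heq] at this
          exact (mem_nb.1 this).2.1)
        apply Nat.ne_of_beq_eq_false h2
        apply Nat.eq_of_testBit_eq
        intro i
        rw [Bool.eq_iff_iff, tb_4095]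
        refine ⟨fun h => ?_, hall i⟩
        rw [← hXd, tb_land, Bool.and_eq_true, tb_4095] at h
        exact h.2
      refine ih _ _ _ h H hH ⟨hS.1, hS.2.1.diff (Sym.pr h3 h4), fun x hx y hy =>
        ⟨(hS.2.2 x hx y hy).1, fun hxy => ?_⟩⟩
      rw [T_diff, T_pr h3 h4 hx hy]
      refine ⟨(hS.2.2 x hx y hy).2 hxy, ?_⟩
      rintro (⟨rfl, rfl⟩ | ⟨rfl, rfl⟩)
      · exact hno hxy
      · exact hno (hH.symm _ _ hxy)
    · exact absurd h (by simp)

theorem killM_sound {E : ℕ} (hE : Sym E) (n : ℕ) : ∀ (s used U : ℕ) (k : ℕ → ℕ → Bool),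
    killM E n s used U k = true → ∃ (R : ℕ → ℕ → Prop) (s' U' : ℕ), k s' U' = true ∧
      (Sym U → Sym U') ∧ (∀ a b, R a b → R b a) ∧ (∀ a b c, R a b → R a c → b = c) ∧
      (∀ a b, R a b → a < 12 ∧ b < 12 ∧ a ≠ b ∧ T E a b ∧ used.testBit a = false) ∧
      ∀ x < 12, ∀ y < 12, T U x y → ¬ R x y → T U' x y := by
  induction n with
  | zero =>
    intro s used U k h
    exact ⟨fun _ _ => False, s, U, h, id, fun _ _ h => h, fun _ _ _ h => h.elim,
      fun _ _ h => h.elim, fun _ _ _ _ h _ => h⟩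
  | succ n ih =>
    intro s used U k h
    unfold killM at h
    simp only [force_eq] at h
    generalize nib s 0 = a at h
    generalize nib s 4 = b at h
    split at h
    · rename_i ha hb hab hua hub hEab
      replace ha := lt_of_ble ha
      replace hb := lt_of_ble hb
      replace hab := Nat.ne_of_beq_eq_false hab
      rw [bit_eq] at hua hub hEab
      obtain ⟨R, s', U', hk, hsy, hRs, hRm, hR, hU⟩ := ih _ _ _ _ h
      have hR' : ∀ x y, R x y → used.testBit x = false ∧ x ≠ a ∧ x ≠ b := by
        intro x y hxy
        have := (hR x y hxy).2.2.2.2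
        simp only [tb_lor, tb_one, Bool.or_eq_false_iff, decide_eq_false_iff_not] at this
        exact this
      have hEab' : T E a b := hEab
      refine ⟨fun x y => R x y ∨ (x = a ∧ y = b) ∨ (x = b ∧ y = a), s', U', hk,
        fun h => hsy (h.diff (Sym.pr ha hb)), ?_, ?_, ?_, ?_⟩
      · rintro x y (h | h | h)
        · exact Or.inl (hRs _ _ h)
        · exact Or.inr (Or.inr ⟨h.2, h.1⟩)
        · exact Or.inr (Or.inl ⟨h.2, h.1⟩)
      · intro x y z h1 h2
        rcases h1 with h1 | h1
        · have := hR' _ _ h1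
          rcases h2 with h2 | h2
          · exact hRm _ _ _ h1 h2
          · omega
        · rcases h2 with h2 | h2
          · have := hR' _ _ h2
            omega
          · omega
      · rintro x y (h | ⟨rfl, rfl⟩ | ⟨rfl, rfl⟩)
        · obtain ⟨g1, g2, g3, g4, -⟩ := hR _ _ h
          exact ⟨g1, g2, g3, g4, (hR' _ _ h).1⟩
        · exact ⟨ha, hb, hab, hEab', hua⟩
        · exact ⟨hb, ha, Ne.symm hab, hE _ ha _ hb hEab', hub⟩
      · intro x hx y hy hT hn
        rw [not_or] at hn
        refine hU x hx y hy ?_ hn.1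
        rw [T_diff, T_pr ha hb hx hy]
        exact ⟨hT, hn.2⟩
    · exact absurd h (by simp)

/-! ### The graph side -/

section Graph

variable {V : Type}

/-- Degrees, without instances. -/
noncomputable def dg (F : SimpleGraph V) (x : V) : ℕ := (F.neighborSet x).ncard

/-- Labellings: the first twelve values are distinct. -/
def Lab (e : ℕ → V) : Prop := ∀ i < 12, ∀ j < 12, e i = e j → i = j

/-- The relation of a labelled graph. -/
def rel (F : SimpleGraph V) (e : ℕ → V) : ℕ → ℕ → Prop := fun i j => F.Adj (e i) (e j)

theorem Lab.surj [Fintype V] (hV : Fintype.card V = 12) {e : ℕ → V} (he : Lab e) (x : V) :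
    ∃ i < 12, e i = x := by
  have hb : Function.Bijective (fun i : Fin 12 => e i) := by
    rw [Fintype.bijective_iff_injective_and_card]
    refine ⟨fun i j h => Fin.ext (he i i.2 j j.2 h), by simp [hV]⟩
  obtain ⟨i, hi⟩ := hb.2 x
  exact ⟨i, i.2, hi⟩

theorem dg_eq [Fintype V] (hV : Fintype.card V = 12) {e : ℕ → V} (he : Lab e)
    (F : SimpleGraph V) (v : ℕ) : (nb (rel F e) v 4095).card = dg F (e v) := by
  have h : F.neighborSet (e v) = e '' (nb (rel F e) v 4095 : Set ℕ) := by
    ext x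
    simp only [SimpleGraph.mem_neighborSet, Set.mem_image, Finset.mem_coe, mem_nb]
    constructor
    · intro hx
      obtain ⟨i, hi, rfl⟩ := he.surj hV x
      exact ⟨i, ⟨hi, hx, tb_4095.2 hi⟩, rfl⟩
    · rintro ⟨i, ⟨_, h, _⟩, rfl⟩
      exact h
  unfold dg
  rw [h, Set.InjOn.ncard_image, Set.ncard_coe_finset]
  intro i hi j hj hij
  exact he i (mem_nb.1 hi).1 j (mem_nb.1 hj).1 hij

/-- A red matching forces a blue Hamiltonian cycle. -/
theorem arrow_ham [Fintype V] (hV : Fintype.card V = 12) {F : SimpleGraph V}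
    (hF : Arrows F (pathGraph 3) (cycleGraph 12)) (R : SimpleGraph V) (hR : R ≤ F)
    (hm : ∀ x y z, R.Adj x y → R.Adj x z → y = z) :
    ∃ f : Fin 12 → V, Function.Bijective f ∧
      ∀ a b, (cycleGraph 12).Adj a b → F.Adj (f a) (f b) ∧ ¬ R.Adj (f a) (f b) := by
  rcases hF R hR with ⟨f, hf⟩ | ⟨f, hf⟩
  · exfalso
    have h1 : R.Adj (f 1) (f 0) := f.map_adj (by simp [pathGraph_adj])
    have h2 : R.Adj (f 1) (f 2) := f.map_adj (by simp [pathGraph_adj])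
    have := hf (hm _ _ _ h1 h2)
    exact absurd this (by decide)
  · refine ⟨f, ?_, fun a b hab => ?_⟩
    · rw [Fintype.bijective_iff_injective_and_card]
      exact ⟨hf, by simp [hV]⟩
    · have := f.map_adj hab
      rwa [SimpleGraph.sdiff_adj] at this

theorem cyc_adj : ∀ a : Fin 12, (cycleGraph 12).Adj a (a + 1) ∧ (cycleGraph 12).Adj a (a - 1) ∧
    a + 1 ≠ a - 1 := by
  decide

theorem three_le_dg [Fintype V] (hV : Fintype.card V = 12) {F : SimpleGraph V}
    (hF : Arrows F (pathGraph 3) (cycleGraph 12)) (v : V) : 3 ≤ dg F v := by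
  have hex : ∃ w, (∃ w', F.Adj v w') → F.Adj v w := by
    by_cases h : ∃ w', F.Adj v w'
    · exact ⟨h.choose, fun _ => h.choose_spec⟩
    · exact ⟨v, fun h' => absurd h' h⟩
  obtain ⟨w, hw⟩ := hex
  let R : SimpleGraph V := F ⊓ SimpleGraph.fromEdgeSet {s(v, w)}
  have hRadj : ∀ x y, R.Adj x y ↔ F.Adj x y ∧ ((x = v ∧ y = w) ∨ (x = w ∧ y = v)) := by
    intro x y
    simp only [R, SimpleGraph.inf_adj, SimpleGraph.fromEdgeSet_adj, Set.mem_singleton_iff,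
      Sym2.eq_iff]
    constructor
    · rintro ⟨h1, h2, h3⟩
      exact ⟨h1, h2⟩
    · rintro ⟨h1, h2⟩
      exact ⟨h1, h2, h1.ne⟩
  obtain ⟨f, hf, hadj⟩ := arrow_ham hV hF R inf_le_left (by
    intro x y z h1 h2
    rw [hRadj] at h1 h2
    rcases h1 with ⟨g1, h1⟩
    rcases h2 with ⟨g2, h2⟩
    have := g1.ne
    have := g2.ne
    aesop)
  obtain ⟨a, rfl⟩ := hf.2 v
  have c1 := (cyc_adj a).1
  have c2 := (cyc_adj a).2.1
  have c3 := (cyc_adj a).2.2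
  have h1 := hadj _ _ c1
  have h2 := hadj _ _ c2
  have hw' := hw ⟨_, h1.1⟩
  have n1 : w ≠ f (a + 1) := by
    rintro rfl
    exact h1.2 ((hRadj _ _).2 ⟨h1.1, Or.inl ⟨rfl, rfl⟩⟩)
  have n2 : w ≠ f (a - 1) := by
    rintro rfl
    exact h2.2 ((hRadj _ _).2 ⟨h2.1, Or.inl ⟨rfl, rfl⟩⟩)
  have n3 : f (a + 1) ≠ f (a - 1) := fun h => c3 (hf.1 h)
  unfold dg
  have hs : ({w, f (a + 1), f (a - 1)} : Set V) ⊆ F.neighborSet (f a) := by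
    rintro x (rfl | rfl | rfl)
    · exact hw'
    · exact h1.1
    · exact h2.1
  have hc : ({w, f (a + 1), f (a - 1)} : Set V).ncard = 3 := by
    rw [Set.ncard_eq_three]
    exact ⟨_, _, _, n1, n2, n3, rfl⟩
  rw [← hc]
  exact Set.ncard_le_ncard hs (Set.toFinite _)

/-- The mask of all pairs `(v, j)` with `j` in the list and in `S`. -/
def mkMask (v S : ℕ) : List ℕ → ℕ
  | [] => 0
  | j :: js =>
    match bit S j with
    | true => Nat.lor (pr v j) (mkMask v S js)
    | false => mkMask v S js

theorem mkMask_spec {v S : ℕ} (hv : v < 12) (l : List ℕ) : (∀ j ∈ l, j < 12) →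
    Mask v S (mkMask v S l) := by
  induction l with
  | nil =>
    intro _
    have h0 : ∀ i j, ¬ T 0 i j := by intro i j; simp [T]
    exact ⟨fun i _ j _ h => absurd h (h0 i j), fun i _ j _ h => absurd h (h0 i j)⟩
  | cons a l ih =>
    intro hl
    have ih' := ih (fun j hj => hl j (by simp [hj]))
    have ha : a < 12 := hl a (by simp)
    unfold mkMask
    split
    · rename_i hb
      rw [bit_eq] at hb
      refine ⟨(Sym.pr hv ha).lor ih'.1, fun i hi j hj h => ?_⟩
      rw [T_lor, T_pr hv ha hi hj] at h
      rcases h with (⟨rfl, rfl⟩ | ⟨rfl, rfl⟩) | h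
      · exact Or.inl ⟨rfl, hb⟩
      · exact Or.inr ⟨rfl, hb⟩
      · exact ih'.2 i hi j hj h
    · exact ih'

/-- Structural validity of a constraint. -/
def wf : CCon → Bool
  | .mk v S f _ _ => !Nat.ble 12 v && Nat.beq (Nat.land S 4095) S && Nat.beq f (mkMask v S verts)

theorem wf_spec {v S f lo hi : ℕ} (h : wf (.mk v S f lo hi) = true) :
    v < 12 ∧ (∀ j, S.testBit j = true → j < 12) ∧ Mask v S f := by
  unfold wf at h
  rw [Bool.and_eq_true, Bool.and_eq_true, Bool.not_eq_true'] at h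
  obtain ⟨⟨h1, h2⟩, h3⟩ := h
  have hv := lt_of_ble h1
  refine ⟨hv, fun j hj => ?_, ?_⟩
  · rw [← Nat.eq_of_beq_eq_true h2, tb_land, Bool.and_eq_true, tb_4095] at hj
    exact hj.2
  · rw [Nat.eq_of_beq_eq_true h3]
    exact mkMask_spec hv verts verts_lt

/-- Validity of a constraint for graphs with degree sequence `D`. -/
def conDeg (D : List ℕ) (o1 : Bool) : CCon → Bool
  | .mk v S _ lo hi =>
    (Nat.beq S 4095 && Nat.beq lo (D.getD v 0) && Nat.beq (hi + 1) (D.getD v 0)) ||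
    (o1 && Nat.beq lo 0 && Nat.beq hi 1 && verts.all fun j => !bit S j || Nat.beq (D.getD j 0) 3)

def consOK (D : List ℕ) (o1 : Bool) (cons : List CCon) : Bool :=
  cons.all fun c => wf c && conDeg D o1 c

theorem good_of_ok [Fintype V] (hV : Fintype.card V = 12) {F : SimpleGraph V} {e : ℕ → V}
    (he : Lab e) {D : List ℕ} {o1 : Bool} {cons : List CCon} (h : consOK D o1 cons = true)
    (hD : ∀ i < 12, D.getD i 0 ≠ 0 → dg F (e i) = D.getD i 0)
    (ho : o1 = true → ∀ x, {w | F.Adj x w ∧ dg F w = 3}.ncard ≤ 2) :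
    ∀ c ∈ cons, Good (rel F e) c := by
  intro c hc
  have h1 := List.all_eq_true.1 h c hc
  obtain ⟨v, S, f, lo, hi⟩ := c
  rw [Bool.and_eq_true] at h1
  obtain ⟨hw, h2⟩ := h1
  obtain ⟨hv, hS, hf⟩ := wf_spec hw
  refine ⟨hv, hS, hf, ?_⟩
  unfold conDeg at h2
  simp only [Bool.or_eq_true, Bool.and_eq_true] at h2
  rcases h2 with ⟨⟨g1, g2⟩, g3⟩ | ⟨⟨⟨g1, g2⟩, g3⟩, g4⟩
  · replace g1 := Nat.eq_of_beq_eq_true g1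
    replace g2 := Nat.eq_of_beq_eq_true g2
    replace g3 := Nat.eq_of_beq_eq_true g3
    subst g1
    have := dg_eq hV he F v
    have := hD v hv (by omega)
    omega
  · replace g2 := Nat.eq_of_beq_eq_true g2
    replace g3 := Nat.eq_of_beq_eq_true g3
    refine ⟨by omega, ?_⟩
    rw [g3]
    refine le_trans ?_ (ho g1 (e v))
    have hinj : Set.InjOn e (nb (rel F e) v S : Set ℕ) := by
      intro i hi j hj hij
      exact he i (mem_nb.1 hi).1 j (mem_nb.1 hj).1 hij
    rw [← Set.ncard_coe_finset, ← hinj.ncard_image]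
    refine Set.ncard_le_ncard ?_ (Set.toFinite _)
    rintro _ ⟨j, hj, rfl⟩
    obtain ⟨hj12, hj1, hj2⟩ := mem_nb.1 hj
    refine ⟨hj1, ?_⟩
    have h3 := List.all_eq_true.1 g4 j (mem_verts hj12)
    rw [bit_eq, hj2] at h3
    have h4 : D.getD j 0 = 3 := Nat.eq_of_beq_eq_true (by simpa using h3)
    rw [hD j hj12 (by omega), h4]

theorem cyc_dg (x : Fin 12) : dg (cycleGraph 12) x = 2 := by
  unfold dg
  rw [cycleGraph_neighborSet, Set.ncard_pair]
  revert x
  decide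

theorem cyc_ham {consH : List CCon} {D : List ℕ} (hc : consOK D false consH = true)
    (hD : ∀ i < 12, D.getD i 0 = 2) {g : ℕ → Fin 12} (hg : Lab g) :
    HamRel consH (rel (cycleGraph 12) g) where
  symm i j h := SimpleGraph.Adj.symm h
  good := good_of_ok (by simp) hg hc (fun i hi _ => by rw [cyc_dg, hD i hi]) (by simp)
  two v hv := by rw [dg_eq (by simp) hg, cyc_dg]
  conn X a ha hXa hcl := by
    have hs : ∀ n : ℕ, ∃ i < 12, X i ∧ (g i).val = ((g a).val + n) % 12 := by
      intro n
      induction n with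
      | zero => exact ⟨a, ha, hXa, by omega⟩
      | succ n ih =>
        obtain ⟨i, hi, hX, h⟩ := ih
        obtain ⟨j, hj, hgj⟩ := hg.surj (by simp) (g i + 1)
        refine ⟨j, hj, hcl i hi j hj hX ?_, ?_⟩
        · show (cycleGraph 12).Adj (g i) (g j)
          rw [hgj]
          exact (cyc_adj _).1
        · rw [hgj, Fin.val_add, h]
          simp
          omega
    intro j hj
    obtain ⟨i, hi, hX, h⟩ := hs ((g j).val + 12 - (g a).val)
    have : g i = g j := by
      ext
      omega
    rw [← hg i hi j hj this]
    exact hX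

theorem leafKill_sound [Fintype V] (hV : Fintype.card V = 12) {F : SimpleGraph V}
    (hF : Arrows F (pathGraph 3) (cycleGraph 12)) {consH : List CCon} {D : List ℕ}
    (hc : consOK D false consH = true) (hD : ∀ i < 12, D.getD i 0 = 2) {e : ℕ → V} (he : Lab e)
    {t E U : ℕ} (h : leafKill consH t E U = true) : ¬ St (rel F e) E U := by
  intro hS
  unfold leafKill at h
  obtain ⟨R, s', U', hk, hsy, hRs, hRm, hR, hU⟩ := killM_sound hS.1 _ _ _ _ _ h
  rw [force_eq] at hk
  let RV : SimpleGraph V :=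
    { Adj := fun x y => ∃ i j, R i j ∧ e i = x ∧ e j = y
      symm := ⟨by
        rintro x y ⟨i, j, h, h1, h2⟩
        exact ⟨j, i, hRs _ _ h, h2, h1⟩⟩
      loopless := ⟨by
        rintro x ⟨i, j, h, h1, h2⟩
        obtain ⟨g1, g2, g3, -⟩ := hR i j h
        exact g3 (he i g1 j g2 (h1.trans h2.symm))⟩ }
  obtain ⟨f, hf, hadj⟩ := arrow_ham hV hF RV (by
      rintro x y ⟨i, j, h, rfl, rfl⟩
      obtain ⟨g1, g2, g3, g4, -⟩ := hR i j h
      exact (hS.2.2 i g1 j g2).1 g4) (by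
      rintro x y z ⟨i, j, h, rfl, rfl⟩ ⟨i', j', h', h1, rfl⟩
      have : i' = i := he _ (hR _ _ h').1 _ (hR _ _ h).1 h1
      subst this
      rw [hRm _ _ _ h h'])
  choose g hg using fun i => hf.2 (e i)
  have hgL : Lab g := by
    intro i hi j hj hij
    apply he i hi j hj
    rw [← hg i, ← hg j, hij]
  refine items_sound _ _ _ _ hk _ (cyc_ham hc hD hgL) ⟨?_, hsy hS.2.1, fun x hx y hy => ⟨?_, ?_⟩⟩
  · intro i _ j _ h
    simp [T] at h
  · intro h
    simp [T] at h
  · intro hxy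
    have h1 := hadj _ _ hxy
    rw [hg, hg] at h1
    exact hU x hx y hy ((hS.2.2 x hx y hy).2 h1.1) fun h => h1.2 ⟨x, y, h, rfl, rfl⟩

theorem run_sound [Fintype V] (hV : Fintype.card V = 12) {F : SimpleGraph V}
    {D : List ℕ} {o1 : Bool} {cons : List CCon} (hok : consOK D o1 cons = true)
    (ho : o1 = true → ∀ x, {w | F.Adj x w ∧ dg F w = 3}.ncard ≤ 2)
    {leaf : ℕ → ℕ → ℕ → Bool}
    (hleaf : ∀ t E U, leaf t E U = true → ∀ e : ℕ → V, Lab e →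
      (∀ i < 12, D.getD i 0 ≠ 0 → dg F (e i) = D.getD i 0) → ¬ St (rel F e) E U)
    {n : ℕ} {toks : List ℕ} {E U : ℕ} {k : List ℕ → Bool}
    (h : check D cons leaf n toks E U k = true) {e : ℕ → V} (he : Lab e)
    (hD : ∀ i < 12, D.getD i 0 ≠ 0 → dg F (e i) = D.getD i 0) : ¬ St (rel F e) E U := by
  have := check_sound (Q := fun A => ∃ e : ℕ → V, Lab e ∧ A = rel F e ∧
      ∀ i < 12, D.getD i 0 ≠ 0 → dg F (e i) = D.getD i 0) (D := D) (cons := cons)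
      (leaf := leaf) ?_ ?_ ?_ ?_ ?_ n toks E U k h
  · exact this.1 _ ⟨e, he, rfl, hD⟩
  · rintro _ ⟨e, he, rfl, hD⟩ i j h
    exact SimpleGraph.Adj.symm h
  · rintro _ ⟨e, he, rfl, hD⟩ i h
    exact SimpleGraph.irrefl _ h
  · rintro _ ⟨e, he, rfl, hD⟩
    exact good_of_ok hV he hok hD ho
  · rintro _ ⟨e, he, rfl, hD⟩ c hc j hj hcj
    refine ⟨fun i => e (Equiv.swap c j i), ?_, rfl, ?_⟩
    · intro x hx y hy h
      exact (Equiv.swap c j).injective (he _ (swap_lt hc hj hx) _ (swap_lt hc hj hy) h)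
    · intro i hi hne
      dsimp only
      have heq : D.getD (Equiv.swap c j i) 0 = D.getD i 0 := by
        rw [Equiv.swap_apply_def]
        split_ifs with h1 h2
        · rw [h1, hcj]
        · rw [h2, hcj]
        · rfl
      rw [← heq]
      exact hD _ (swap_lt hc hj hi) (by rw [heq]; exact hne)
  · rintro t E U h _ ⟨e, he, rfl, hD⟩
    exact hleaf t E U h e he hD

end Graph

/-! ### Data for the upper bound -/

/-- The bit matrix of a graph with 22 edges that arrows. -/
def fb : ℕ := 8627360394733362902820919691444395665264690

def consP : List CCon := [
  .mk 0 4095 5445847423328601499764522166702896586751 0 0,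
  .mk 1 4095 10891694846657202999529044333405809930242 0 0,
  .mk 2 4095 21783389693314405999058088666880221921284 0 0,
  .mk 3 4095 43566779386628811998116177614479674081288 0 0,
  .mk 4 4095 87133558773257623996233502803676348088336 0 0,
  .mk 5 4095 174267117546515247997149029407710309908512 0 0,
  .mk 6 4095 348534235093030515020788711116525237698624 0 0,
  .mk 7 4095 697068470186137724909481417080947712983168 0 0,
  .mk 8 4095 1394136940676278899831978466697556750500096 0 0,
  .mk 9 4095 2788275043494221726022397413399904775045632 0 0,
  .mk 10 4095 5580629820663543412404558290185887038833664 0 0,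
  .mk 11 4095 22298023604371552426870186540012804662888448 0 0]

def certP : List ℕ := [
  16779073, 16778785, 16780177, 16777473, 6115970769912834, 5772682565677314, 16779825,
  16777473, 6018154231923714, 5833126256664834, 16779649, 16777473, 6018153309647874,
  5833126256664834, 16777473, 6018151972713474, 5833468511871234, 16779569, 16780113, 16777473,
  6035641216893954, 5780932336644354, 16777473, 16779297, 6035641213760514, 6114802824020994,
  16778769, 5780911664296194, 5780912066420994, 16779649, 16778833, 16779825, 6115970769912834,
  6114635172447234, 16777473, 16778017, 6035642550694914, 6018153309647874, 16779825,
  5782027553304834, 5833160481140994, 16780193, 16778769, 16778017, 5833160481140994,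
  5833502736347394, 16777473, 16779297, 6114600545846274, 6114635172447234, 16778017,
  5829036089696514, 5829037426630914, 16778497, 16778017, 5834255697801474, 5780349082300674,
  16778769, 16778017, 5834255697801474, 6018973690392834, 16778017, 6035642533983234, 16777473,
  16780113, 16779297, 6035641200182274, 6018154231923714, 6115970652931074, 6045890325405954,
  16780113, 16779649, 16777473, 16778017, 6035642550694914, 6035671144379394, 16778769,
  16778017, 6019320324059394, 6018974592823554, 16778017, 6039313410318594, 6039318908461314,
  16778769, 16779825, 6018973790662914, 16779329, 16779569, 6018978068852994, 6019320324059394,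
  16778017, 6019316045869314, 6018978871013634, 16778017, 16777473, 6035642533983234,
  6039317688508674, 16779905, 16777473, 6018151972713474, 16778785, 6039317571526914,
  6039109394129154, 16777473, 16778785, 16779825, 6018153309647874, 6035672481313794, 16779825,
  6035641197048834, 6035641213760514, 16778785, 16779569, 6039317571526914, 6039318908461314,
  16779569, 6039314747252994, 6039319025443074, 16779649, 16777473, 16779825, 6116042982126594,
  16778785, 16780193, 6114802824020994, 6116042982126594, 6114635457590274, 16779889, 16778785,
  16778241, 6039318908461314, 5758943443378434, 16778497, 5772888002359554, 6115730139672834,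
  16778497, 16778769, 16779825, 5782027553304834, 5772872945135874, 16778017, 5758937945235714,
  5764199266738434, 16778769, 16779825, 6018974592823554, 16780193, 6019320324059394,
  6115730139672834, 16778785, 16778241, 6109412774732034, 5764199266738434, 16779825,
  6115984074694914, 6114635224867074, 16778769, 16779825, 16780097, 5780349082300674, 16778497,
  5834597953007874, 6018973790662914, 16779329, 16779889, 16779569, 5833502736347394,
  5834255697801474, 16778017, 5828934347944194, 5828964295274754, 16780193, 16778497, 16778017,
  5833160481140994, 5833502736347394, 16778017, 6019320324059394, 6114806050615554, 16778497,
  16778017, 5772888002359554, 5780554518982914, 16778017, 6115730139672834, 6115700192342274,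
  16779889, 16778241, 16778785, 6039317571526914, 16779569, 6039314747252994, 16778017,
  6039317688508674, 6039319025443074, 16778785, 16777473, 6115700726920194, 5758942106444034,
  16779569, 16777473, 6114977712796674, 5758939282170114, 16777473, 16778017, 6115730674250754,
  6116072929457154, 16778017, 5758942223425794, 5758943560360194, 16778497, 16778017, 16780097,
  5758942223425794, 5829036089696514, 16780177, 16779905, 5829035972714754, 16778785,
  5829037309649154, 5829037426630914, 16779297, 16779569, 5780912066420994, 5781737757106434,
  16779825, 5764199266738434, 5763857011532034, 16778017, 16780097, 16777473, 6115730674250754,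
  6114635224867074, 16777473, 16780193, 6114635457590274, 6115730674250754, 6109411554779394,
  16779329, 16779569, 16777473, 16778785, 6018151972713474, 6114977712796674, 6109411437797634,
  16778785, 16777473, 16780193, 6018153309647874, 6116042982126594, 6109412774732034, 16777473,
  16780193, 6114977712796674, 6116072929457154, 6109412891713794, 16780193, 16778785, 16777473,
  6114802824020994, 6109411437797634, 16777473, 6114977712796674, 6114953147867394, 16778785,
  16777473, 16779825, 6116042982126594, 6115700726920194, 16779569, 16778241, 6109411437797634,
  5763857011532034, 6115984074694914, 16779569, 16777473, 16779905, 6115700726920194,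
  6114977712796674, 6114953147867394, 16777473, 6115970652931074, 6115984191676674]

/-! ### The upper bound -/

def pv (t i : ℕ) : ℕ := nib t (Nat.add 4 (Nat.mul 4 i))

def orAll (t : ℕ) : List ℕ → ℕ
  | [] => 0
  | i :: is => Nat.lor (Nat.shiftLeft 1 (pv t i)) (orAll t is)

/-- The token describes a Hamiltonian cycle of `fb` that avoids `U`. -/
def leafCyc (t _E U : ℕ) : Bool :=
  Nat.beq (orAll t verts) 4095 && verts.all fun i =>
    force (pv t i) fun p => force (Nat.add (Nat.mul 12 p) (pv t (Nat.mod (Nat.add i 1) 12))) fun q =>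
      !Nat.ble 12 p && bit fb q && !bit U q

theorem tP : check verts consP leafCyc 60 certP 0 fb (fun l => l.isEmpty) = true := by
  decide +kernel

theorem orAll_spec {t b : ℕ} (l : List ℕ) : (orAll t l).testBit b = true → ∃ i ∈ l, pv t i = b := by
  induction l with
  | nil => intro h; simp [orAll] at h
  | cons a l ih =>
    intro h
    unfold orAll at h
    rw [tb_lor, Bool.or_eq_true, tb_one, decide_eq_true_eq] at h
    rcases h with h | h
    · exact ⟨a, by simp, h.symm⟩
    · obtain ⟨i, hi, h⟩ := ih h
      exact ⟨i, by simp [hi], h⟩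

/-- The extremal graph. -/
def FU : SimpleGraph (Fin 12) where
  Adj i j := bit fb (12 * i.val + j.val) = true
  symm := ⟨by decide +kernel⟩
  loopless := ⟨by decide +kernel⟩

instance : DecidableRel FU.Adj := fun i j =>
  inferInstanceAs (Decidable (bit fb (12 * i.val + j.val) = true))

theorem FU_adj (i j : Fin 12) : FU.Adj i j ↔ T fb i j := by
  show bit fb (12 * i.val + j.val) = true ↔ _
  rw [bit_eq]
  rfl

theorem FU_sum : ∑ v, FU.degree v = 44 := by
  decide +kernel

theorem FU_card : FU.edgeSet.ncard = 22 := by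
  have h := FU.sum_degrees_eq_twice_card_edges
  rw [FU_sum] at h
  rw [← SimpleGraph.coe_edgeFinset, Set.ncard_coe_finset]
  omega

theorem leafCyc_sound {R : SimpleGraph (Fin 12)} (hn : ¬ Contains (FU \ R) (cycleGraph 12))
    {t E U : ℕ} (h : leafCyc t E U = true)
    (hU : ∀ i j : Fin 12, R.Adj i j → T U i j) : False := by
  unfold leafCyc at h
  rw [Bool.and_eq_true] at h
  obtain ⟨h1, h2⟩ := h
  replace h1 := Nat.eq_of_beq_eq_true h1
  have h3 : ∀ i < 12, pv t i < 12 ∧ T fb (pv t i) (pv t ((i + 1) % 12)) ∧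
      ¬ T U (pv t i) (pv t ((i + 1) % 12)) := by
    intro i hi
    have := List.all_eq_true.1 h2 i (mem_verts hi)
    simp only [force_eq, bit_eq, Bool.and_eq_true, Bool.not_eq_true'] at this
    refine ⟨lt_of_ble this.1.1, this.1.2, ?_⟩
    intro h
    have h4 := this.2
    exact absurd (show _ = true from h) (by
      intro h5
      exact absurd (h4.symm.trans h5) (by simp))
  let f : Fin 12 → Fin 12 := fun i => ⟨pv t i, (h3 i i.2).1⟩
  have hsurj : Function.Surjective f := by
    intro b
    obtain ⟨i, hi, hb⟩ := orAll_spec (t := t) (b := b) verts (by rw [h1]; exact tb_4095.2 b.2)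
    exact ⟨⟨i, verts_lt i hi⟩, Fin.ext hb⟩
  have hstep : ∀ a : Fin 12, (FU \ R).Adj (f a) (f (a + 1)) := by
    intro a
    have h4 := h3 a a.2
    have h5 : ((a + 1 : Fin 12) : ℕ) = (a.val + 1) % 12 := by
      rw [Fin.val_add]
      rfl
    rw [← h5] at h4
    rw [SimpleGraph.sdiff_adj, FU_adj]
    exact ⟨h4.2.1, fun h => h4.2.2 (hU _ _ h)⟩
  refine hn ⟨⟨f, ?_⟩, Finite.injective_iff_surjective.2 hsurj⟩
  intro a b hab
  rw [cycleGraph_adj] at hab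
  rcases hab with h | h
  · have : a = b + 1 := by rw [← h]; abel
    rw [this]
    exact (hstep b).symm
  · have : b = a + 1 := by rw [← h]; abel
    rw [this]
    exact hstep a

theorem consP_ok : (consP.all fun c => wf c &&
    match c with | .mk _ _ _ lo _ => Nat.beq lo 0) = true := by
  decide +kernel

theorem FU_arrows : Arrows FU (pathGraph 3) (cycleGraph 12) := by
  intro R hR
  by_contra hcon
  rw [not_or] at hcon
  obtain ⟨hP, hC⟩ := hcon
  have hm : ∀ x y z, R.Adj x y → R.Adj x z → y = z := by
    intro x y z h1 h2
    by_contra hyz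
    apply hP
    refine ⟨⟨![y, x, z], ?_⟩, ?_⟩
    · intro a b hab
      rw [pathGraph_adj] at hab
      fin_cases a <;> fin_cases b <;> simp at hab ⊢ <;>
        first | exact h1 | exact h1.symm | exact h2 | exact h2.symm
    · have n1 := h1.ne
      have n2 := h2.ne
      intro a b hab
      fin_cases a <;> fin_cases b <;> simp_all
  let e : ℕ → Fin 12 := fun i => Fin.ofNat 12 i
  have hval : ∀ i < 12, (e i).val = i := fun i hi => Nat.mod_eq_of_lt hi
  have he : Lab e := by
    intro i hi j hj h
    rw [← hval i hi, ← hval j hj, h]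
  have hv : ∀ c < 12, verts.getD c 0 = c := by
    intro c hc
    unfold verts
    interval_cases c <;> rfl
  have := check_sound (Q := fun A => A = rel R e) (D := verts) (cons := consP)
      (leaf := leafCyc) ?_ ?_ ?_ ?_ ?_ 60 certP 0 fb _ tP
  · apply this.1 _ rfl
    refine ⟨?_, ?_, ?_⟩
    · intro i _ j _ h
      simp [T] at h
    · intro i hi j hj h
      have h1 := (FU_adj (e i) (e j)).2 (by rw [hval i hi, hval j hj]; exact h)
      have h2 := (FU_adj (e j) (e i)).1 h1.symm
      rwa [hval i hi, hval j hj] at h2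
    · intro i hi j hj
      refine ⟨?_, ?_⟩
      · intro h
        simp [T] at h
      · intro h
        have h2 := (FU_adj (e i) (e j)).1 (hR h)
        rwa [hval i hi, hval j hj] at h2
  · rintro _ rfl i j h
    exact SimpleGraph.Adj.symm h
  · rintro _ rfl i h
    exact SimpleGraph.irrefl _ h
  · rintro _ rfl ⟨v, S, f, lo, hi⟩ hc
    have h := List.all_eq_true.1 consP_ok _ hc
    rw [Bool.and_eq_true] at h
    obtain ⟨h1, h2⟩ := h
    obtain ⟨g1, g2, g3⟩ := wf_spec h1
    have h3 : lo = 0 := Nat.eq_of_beq_eq_true h2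
    refine ⟨g1, g2, g3, by omega, ?_⟩
    have : (nb (rel R e) v S).card ≤ 1 := by
      rw [Finset.card_le_one]
      intro a ha b hb
      rw [mem_nb] at ha hb
      exact he a ha.1 b hb.1 (hm _ _ _ ha.2.1 hb.2.1)
    omega
  · rintro _ rfl c hc j hj h
    rw [hv c hc, hv j hj] at h
    subst h
    show swp c c (rel R e) = rel R e
    funext x y
    simp [swp]
  · rintro t E U h _ rfl hS
    refine leafCyc_sound hC h ?_
    intro i j hij
    refine (hS.2.2 i i.2 j j.2).2 ?_
    have : ∀ i : Fin 12, e i = i := fun i => Fin.ext (hval i i.2)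
    show R.Adj (e i) (e j)
    rw [this, this]
    exact hij

/-! ### Certificates for the lower bound -/

def consH : List CCon := [
  .mk 0 4095 5445847423328601499764522166702896586751 2 1,
  .mk 1 4095 10891694846657202999529044333405809930242 2 1,
  .mk 2 4095 21783389693314405999058088666880221921284 2 1,
  .mk 3 4095 43566779386628811998116177614479674081288 2 1,
  .mk 4 4095 87133558773257623996233502803676348088336 2 1,
  .mk 5 4095 174267117546515247997149029407710309908512 2 1,
  .mk 6 4095 348534235093030515020788711116525237698624 2 1,
  .mk 7 4095 697068470186137724909481417080947712983168 2 1,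
  .mk 8 4095 1394136940676278899831978466697556750500096 2 1,
  .mk 9 4095 2788275043494221726022397413399904775045632 2 1,
  .mk 10 4095 5580629820663543412404558290185887038833664 2 1,
  .mk 11 4095 22298023604371552426870186540012804662888448 2 1]

/-- All off-diagonal pairs. -/
def fullU : ℕ := 11149011303623843458013522930838119932485630

/-- The three edges from `3` to `0`, `1`, `2`. -/
def edges3 : ℕ := 481170587656

def dseq0 : List ℕ := [
  3, 3, 3, 0, 0, 0, 0, 0, 0, 0, 0, 0]

def cons0 : List CCon := [
  .mk 0 4095 5445847423328601499764522166702896586751 3 2,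
  .mk 1 4095 10891694846657202999529044333405809930242 3 2,
  .mk 2 4095 21783389693314405999058088666880221921284 3 2]

def cert0 : List ℕ := [
  16647169, 16516353, 16254481, 15730449, 14682145, 12585249, 70906888242, 132129, 70906888242,
  525857, 286848274559266, 132129, 1313, 70101581874, 525857, 286848270364962, 70638452786, 132113,
  283343310639138, 15730465, 282445932028194, 132129, 282445928882466, 1120501047570, 132113, 1297,
  16254497, 15730465, 70368968754, 73170305748643890, 285821505782050, 283343306444834, 16641,
  16516369, 282235208024098, 1041, 1106809786386, 282235204878370, 16647185, 282235206967330,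
  1157178815525564946]

def dseq1 : List ℕ := [
  3, 3, 3, 3, 3, 3, 3, 3, 3, 3, 3, 9]

def cons1 : List CCon := [
  .mk 0 4095 5445847423328601499764522166702896586751 3 2,
  .mk 0 2047 1329552593586084350528447794605201407 0 1,
  .mk 1 4095 10891694846657202999529044333405809930242 3 2,
  .mk 1 2047 2659105187172168701056895589218775042 0 1,
  .mk 2 4095 21783389693314405999058088666880221921284 3 2,
  .mk 2 2047 5318210374344337402113791212696649732 0 1,
  .mk 3 4095 43566779386628811998116177614479674081288 3 2,
  .mk 3 2047 10636420748688674804227722475854659592 0 1,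
  .mk 4 4095 87133558773257623996233502803676348088336 3 2,
  .mk 4 2047 21272841497377349609026840391382532112 0 1,
  .mk 5 4095 174267117546515247997149029407710309908512 3 2,
  .mk 5 2047 42545682994754701540047161210163036192 0 1,
  .mk 6 4095 348534235093030515020788711116525237698624 3 2,
  .mk 6 2047 85091365989518762886556189361191518272 0 1,
  .mk 7 4095 697068470186137724909481417080947712983168 3 2,
  .mk 7 2047 170182732016137655233088891889643946112 0 1,
  .mk 8 4095 1394136940676278899831978466697556750500096 3 2,
  .mk 8 2047 340365605855676656782711265456146088192 0 1,
  .mk 9 4095 2788275043494221726022397413399904775045632 3 2,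
  .mk 9 2047 681229063895940872496177415329446625792 0 1,
  .mk 10 4095 5580629820663543412404558290185887038833664 3 2,
  .mk 10 2047 2721262095520119312921725164342516646912 0 1,
  .mk 11 4095 22298023604371552426870186540012804662888448 9 8,
  .mk 11 2047 11147651005106240856102327403688623909898240 0 1]

def cert1 : List ℕ := [
  8380593, 8372657]

def dseq2 : List ℕ := [
  3, 3, 3, 3, 3, 3, 3, 3, 3, 3, 4, 8]

def cons2 : List CCon := [
  .mk 0 4095 5445847423328601499764522166702896586751 3 2,
  .mk 0 1023 324597801168477624640734324855807 0 1,
  .mk 1 4095 10891694846657202999529044333405809930242 3 2,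
  .mk 1 1023 649195602336955249281468653891586 0 1,
  .mk 2 4095 21783389693314405999058088666880221921284 3 2,
  .mk 2 1023 1298391204673910498562954395402244 0 1,
  .mk 3 4095 43566779386628811998116177614479674081288 3 2,
  .mk 3 1023 2596782409347820997195624867725320 0 1,
  .mk 4 4095 87133558773257623996233502803676348088336 3 2,
  .mk 4 1023 5193564818695642277697050745307152 0 1,
  .mk 5 4095 174267117546515247997149029407710309908512 3 2,
  .mk 5 1023 10387129637392426533714563780706336 0 1,
  .mk 6 4095 348534235093030515020788711116525237698624 3 2,
  .mk 6 1023 20774259279311317434078986550640704 0 1,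
  .mk 7 4095 697068470186137724909481417080947712983168 3 2,
  .mk 7 1023 41548535861382872835503775373852800 0 1,
  .mk 8 4095 1394136940676278899831978466697556750500096 3 2,
  .mk 8 1023 83157805099778712654962235372732672 0 1,
  .mk 9 4095 2788275043494221726022397413399904775045632 3 2,
  .mk 9 1023 332023055117716601202248700840116736 0 1,
  .mk 10 4095 5580629820663543412404558290185887038833664 4 3,
  .mk 10 1023 1360132627836365459068226734615443801088 0 1,
  .mk 11 4095 22298023604371552426870186540012804662888448 8 7,
  .mk 11 1023 5569742446538217563010690838667079387711488 0 1]

def cert2 : List ℕ := [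
  4186289, 4178353]

def dseq3 : List ℕ := [
  3, 3, 3, 3, 3, 3, 3, 3, 3, 3, 5, 7]

def cons3 : List CCon := [
  .mk 0 4095 5445847423328601499764522166702896586751 3 2,
  .mk 0 1023 324597801168477624640734324855807 0 1,
  .mk 1 4095 10891694846657202999529044333405809930242 3 2,
  .mk 1 1023 649195602336955249281468653891586 0 1,
  .mk 2 4095 21783389693314405999058088666880221921284 3 2,
  .mk 2 1023 1298391204673910498562954395402244 0 1,
  .mk 3 4095 43566779386628811998116177614479674081288 3 2,
  .mk 3 1023 2596782409347820997195624867725320 0 1,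
  .mk 4 4095 87133558773257623996233502803676348088336 3 2,
  .mk 4 1023 5193564818695642277697050745307152 0 1,
  .mk 5 4095 174267117546515247997149029407710309908512 3 2,
  .mk 5 1023 10387129637392426533714563780706336 0 1,
  .mk 6 4095 348534235093030515020788711116525237698624 3 2,
  .mk 6 1023 20774259279311317434078986550640704 0 1,
  .mk 7 4095 697068470186137724909481417080947712983168 3 2,
  .mk 7 1023 41548535861382872835503775373852800 0 1,
  .mk 8 4095 1394136940676278899831978466697556750500096 3 2,
  .mk 8 1023 83157805099778712654962235372732672 0 1,
  .mk 9 4095 2788275043494221726022397413399904775045632 3 2,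
  .mk 9 1023 332023055117716601202248700840116736 0 1,
  .mk 10 4095 5580629820663543412404558290185887038833664 5 4,
  .mk 10 1023 1360132627836365459068226734615443801088 0 1,
  .mk 11 4095 22298023604371552426870186540012804662888448 7 6,
  .mk 11 1023 5569742446538217563010690838667079387711488 0 1]

def cert3 : List ℕ := [
  4186289, 4178353]

def dseq4 : List ℕ := [
  3, 3, 3, 3, 3, 3, 3, 3, 3, 4, 4, 7]

def cons4 : List CCon := [
  .mk 0 4095 5445847423328601499764522166702896586751 3 2,
  .mk 0 511 79247510050897857578304279039 0 1,
  .mk 1 4095 10891694846657202999529044333405809930242 3 2,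
  .mk 1 511 158495020101795715156610641922 0 1,
  .mk 2 4095 21783389693314405999058088666880221921284 3 2,
  .mk 2 511 316990040203591430321723162628 0 1,
  .mk 3 4095 43566779386628811998116177614479674081288 3 2,
  .mk 3 511 633980080407182895192331026440 0 1,
  .mk 4 4095 87133558773257623996233502803676348088336 3 2,
  .mk 4 511 1267960160814505051366340231184 0 1,
  .mk 5 4095 174267117546515247997149029407710309908512 3 2,
  .mk 5 511 2535920322180980843212416614432 0 1,
  .mk 6 4095 348534235093030515020788711116525237698624 3 2,
  .mk 6 511 5071842754155280727742884347968 0 1,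
  .mk 7 4095 697068470186137724909481417080947712983168 3 2,
  .mk 7 511 10151089583937524217605547098240 0 1,
  .mk 8 4095 1394136940676278899831978466697556750500096 3 2,
  .mk 8 511 40490544014167257626399602639104 0 1,
  .mk 9 4095 2788275043494221726022397413399904775045632 4 3,
  .mk 9 511 165869555644602117089272818305073664 0 1,
  .mk 10 4095 5580629820663543412404558290185887038833664 4 3,
  .mk 10 511 679235586995542303173251567986837292032 0 1,
  .mk 11 4095 22298023604371552426870186540012804662888448 7 6,
  .mk 11 511 2782148632107891777860789602682504059291648 0 1]

def cert4 : List ℕ := [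
  2817, 2081025, 2064897, 2833, 2032401, 4196625, 2849, 1967137, 2593, 2865, 1836337, 2353,
  317359719125026, 90336980541542706, 2353, 2609, 528804989846050, 582636318643330498997850146,
  142245203539333176496178, 317144701219106, 2593, 801, 282510091260194, 317144707510562, 2865,
  282510091333666, 4196625, 2577, 2849, 2032417, 4196641, 317144700199202, 553915838304773345314,
  281960334340130, 4196609, 2833, 2064913, 2577, 2849, 2032417, 2593, 352264916176930,
  317144700203042, 580818132053057095278957090, 479836057727419359522, 316869829570594, 2833,
  2064913, 2032401, 4196625, 2849, 1967137, 148700322137968155802990686514,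
  580558401608303800282128674, 2081025, 2064897, 4196609, 2833, 2032401, 2849, 1967137, 2593, 2865,
  1836337, 2353, 317419580235810, 90336980541550898, 1073, 2353, 142245176516566912733234,
  142245176516567181168690, 528804989846050, 317011557224482, 2593, 2337, 406197700358261248034,
  282510091268386, 480705252593477685282, 2577, 2849, 2032417, 2337, 317011556175906,
  352329072292130, 2163733469281259538, 529, 281960336429090, 479836057727687794722, 2032401, 2577,
  2849, 1967137, 2865, 1836337, 2609, 132504133804355952525874, 317419580235810, 2609, 2353,
  554487760820683096610, 142245167596916640452658, 142245194532064933842994, 2337,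
  479984676653098405922, 801, 282510092312866, 352329080647970, 1967137, 2337, 317011557224482,
  352329073307938, 2337, 406918276298640527394, 2865, 282510092374050, 316869822193698, 2577, 529,
  281960335380514, 406049081432850636834, 1238863253522, 2833, 2064913, 2849, 2032417, 4196641,
  317144700198946, 553947363433445462050, 4196625, 316869830615074, 2064913, 4196625,
  406049081432582201634, 1512784859154]

def dseq5 : List ℕ := [
  3, 3, 3, 3, 3, 3, 3, 3, 3, 3, 6, 6]

def cons5 : List CCon := [
  .mk 0 4095 5445847423328601499764522166702896586751 3 2,
  .mk 0 1023 324597801168477624640734324855807 0 1,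
  .mk 1 4095 10891694846657202999529044333405809930242 3 2,
  .mk 1 1023 649195602336955249281468653891586 0 1,
  .mk 2 4095 21783389693314405999058088666880221921284 3 2,
  .mk 2 1023 1298391204673910498562954395402244 0 1,
  .mk 3 4095 43566779386628811998116177614479674081288 3 2,
  .mk 3 1023 2596782409347820997195624867725320 0 1,
  .mk 4 4095 87133558773257623996233502803676348088336 3 2,
  .mk 4 1023 5193564818695642277697050745307152 0 1,
  .mk 5 4095 174267117546515247997149029407710309908512 3 2,
  .mk 5 1023 10387129637392426533714563780706336 0 1,
  .mk 6 4095 348534235093030515020788711116525237698624 3 2,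
  .mk 6 1023 20774259279311317434078986550640704 0 1,
  .mk 7 4095 697068470186137724909481417080947712983168 3 2,
  .mk 7 1023 41548535861382872835503775373852800 0 1,
  .mk 8 4095 1394136940676278899831978466697556750500096 3 2,
  .mk 8 1023 83157805099778712654962235372732672 0 1,
  .mk 9 4095 2788275043494221726022397413399904775045632 3 2,
  .mk 9 1023 332023055117716601202248700840116736 0 1,
  .mk 10 4095 5580629820663543412404558290185887038833664 6 5,
  .mk 10 1023 1360132627836365459068226734615443801088 0 1,
  .mk 11 4095 22298023604371552426870186540012804662888448 6 5,
  .mk 11 1023 5569742446538217563010690838667079387711488 0 1]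

def cert5 : List ℕ := [
  4186273, 4178337]

def dseq6 : List ℕ := [
  3, 3, 3, 3, 3, 3, 3, 3, 3, 4, 5, 6]

def cons6 : List CCon := [
  .mk 0 4095 5445847423328601499764522166702896586751 3 2,
  .mk 0 511 79247510050897857578304279039 0 1,
  .mk 1 4095 10891694846657202999529044333405809930242 3 2,
  .mk 1 511 158495020101795715156610641922 0 1,
  .mk 2 4095 21783389693314405999058088666880221921284 3 2,
  .mk 2 511 316990040203591430321723162628 0 1,
  .mk 3 4095 43566779386628811998116177614479674081288 3 2,
  .mk 3 511 633980080407182895192331026440 0 1,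
  .mk 4 4095 87133558773257623996233502803676348088336 3 2,
  .mk 4 511 1267960160814505051366340231184 0 1,
  .mk 5 4095 174267117546515247997149029407710309908512 3 2,
  .mk 5 511 2535920322180980843212416614432 0 1,
  .mk 6 4095 348534235093030515020788711116525237698624 3 2,
  .mk 6 511 5071842754155280727742884347968 0 1,
  .mk 7 4095 697068470186137724909481417080947712983168 3 2,
  .mk 7 511 10151089583937524217605547098240 0 1,
  .mk 8 4095 1394136940676278899831978466697556750500096 3 2,
  .mk 8 511 40490544014167257626399602639104 0 1,
  .mk 9 4095 2788275043494221726022397413399904775045632 4 3,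
  .mk 9 511 165869555644602117089272818305073664 0 1,
  .mk 10 4095 5580629820663543412404558290185887038833664 5 4,
  .mk 10 511 679235586995542303173251567986837292032 0 1,
  .mk 11 4095 22298023604371552426870186540012804662888448 6 5,
  .mk 11 511 2782148632107891777860789602682504059291648 0 1]

def cert6 : List ℕ := [
  2817, 2561, 2081025, 2833, 2577, 2064913, 2849, 2593, 2032417, 317080544088098, 2833, 2577,
  2064913, 2032401, 2849, 2593, 1967137, 2081025, 2064897, 2833, 2577, 2032401, 2849, 2593, 1967137,
  2865, 2609, 1836337, 81329781286805810, 142245194532064933842994, 282510090215714, 2321, 2849,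
  2593, 2032417, 317144700199202, 281960335388706, 2032401, 2849, 2593, 1967137, 2865, 2609,
  1836337, 317359719125026, 582636318643330498997850146, 801, 282510091260194, 317144707510562,
  1967137, 317144701219106, 2865, 282510091333666, 281960334340130, 2833, 2577, 2064913, 2849, 2593,
  2032417, 317144700203042, 316869829570594, 2064913, 479836057727419359522, 2561, 2081025, 2064897,
  2833, 2577, 2032401, 2849, 2593, 1967137, 2865, 2609, 1836337, 81329781286809906,
  142245176516566912733234, 282510090219810, 2321, 2849, 2593, 2032417, 317144700203298,
  281960336433186, 2577, 2032401, 2849, 2593, 1967137, 2865, 2609, 1836337,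
  123059391830317895729714, 142245158588617874083890, 801, 282510092308770, 317144708559138, 2593,
  1967137, 317144701219106, 2865, 282510092378146, 281960334336034, 2833, 2577, 2064913, 2849, 2593,
  2032417, 317144700198946, 316869830615074, 2577, 2064913, 406049081432582201634, 2081025, 2064897,
  2833, 2577, 2849, 2593, 2032417, 317011556175906, 2032401, 2849, 2593, 1967137, 2865, 2609,
  1836337, 317419580235810, 142245176516566912733234, 801, 282510091268386, 406197700358261248034,
  1967137, 317011557224482, 480705252593477685282, 529, 281960336429090, 479836057727687794722,
  2577, 2032401, 2849, 2593, 1967137, 2865, 2609, 1836337, 317419580235810,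
  142245194532064933842994, 801, 282510092312866, 479984676653098405922, 2593, 1967137,
  317011557224482, 317011556175906, 529, 281960335380514, 406049081432850636834, 2032401,
  316869822193698, 1238863253522]

def dseq7 : List ℕ := [
  3, 3, 3, 3, 3, 3, 3, 3, 4, 4, 4, 6]

def cons7 : List CCon := [
  .mk 0 4095 5445847423328601499764522166702896586751 3 2, .mk 0 255 19347536633519984760328447 0 1,
  .mk 1 4095 10891694846657202999529044333405809930242 3 2,
  .mk 1 255 38695073267039969521692674 0 1,
  .mk 2 4095 21783389693314405999058088666880221921284 3 2,
  .mk 2 255 77390146534079943252393988 0 1,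
  .mk 3 4095 43566779386628811998116177614479674081288 3 2,
  .mk 3 255 154780293068176851793379336 0 1,
  .mk 4 4095 87133558773257623996233502803676348088336 3 2,
  .mk 4 255 309560586203592275599097872 0 1,
  .mk 5 4095 174267117546515247997149029407710309908512 3 2,
  .mk 5 255 619121429374135039657377824 0 1,
  .mk 6 4095 348534235093030515020788711116525237698624 3 2,
  .mk 6 255 1239144316543507126896820288 0 1,
  .mk 7 4095 697068470186137724909481417080947712983168 3 2,
  .mk 7 255 4933021954547484532324958336 0 1,
  .mk 8 4095 1394136940676278899831978466697556750500096 4 3,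
  .mk 8 255 20208134410515587202452351353088 0 1,
  .mk 9 4095 2788275043494221726022397413399904775045632 4 3,
  .mk 9 255 82752241088837571691936982534980096 0 1,
  .mk 10 4095 5580629820663543412404558290185887038833664 4 3,
  .mk 10 255 338953138944965425103195264766063936512 0 1,
  .mk 11 4095 22298023604371552426870186540012804662888448 6 5,
  .mk 11 255 1388352057037468554685593847250403454879744 0 1]

def st7_0 : ℕ × ℕ := (0,
  11143566785753108442598108937119211641100286)

def cert7_0 : List ℕ := [
  1032449, 1016321, 6293505, 2833, 983825, 2849, 918561, 4196641, 2865, 787761, 2609, 2881, 525889,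
  2113, 300518885036066, 2625, 23198324685972615490, 318051478413346, 1345, 2113, 300518883987490,
  2625, 355714312843554, 318051477364770, 2113, 2625, 300518889230370, 335703254896674,
  140159152022556722, 2097, 299827394191394, 81329781286809906, 2609, 1073, 72604058356199730, 2097,
  299827399434274, 81329782628987186, 1073, 2097, 299827393142818, 318601230884898, 299827398385698,
  299419371180066, 4196641, 2593, 2865, 918577, 2097, 299827393142818, 4196657, 81329781024665906,
  2097, 4196657, 299827398385698, 387891938271266, 801, 282510090219810, 299419376422946,
  299419370131490, 4196625, 2849, 983841, 2593, 2865, 918577, 2097, 299969127059490, 2353,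
  81329781024665906, 352681797558306, 2097, 2353, 299969132302370, 370337870123042, 546397176926242,
  2337, 317144700203298, 299419370131490, 2593, 2337, 317144707543330, 299419377471522,
  299419376422946, 529, 281960336424994, 299277644537890, 983825, 4196625, 2849, 918561, 2865,
  787761, 2609, 2881, 525889, 2113, 300518885036066, 2369, 81470519067685170, 23198324685974704450,
  1345, 2113, 300518883987490, 2369, 82088514371588146, 355714312843554, 2113, 2369,
  300518888181794, 300518889230370, 99539961585471538, 2097, 299827394191394, 317359719125026, 2609,
  1073, 72604058358288690, 2097, 299827399434274, 317359724367906, 1073, 2097, 299827393142818,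
  317359718076450, 317359722270754, 2593, 2865, 918577, 2097, 299827393142818, 2609,
  90336980280447282, 317359718076450, 2097, 2609, 299827399434274, 317359722270754, 317359724367906,
  801, 282510092308770, 2337, 317144708559138, 299419378520098, 918561, 2593, 2865, 787761, 2881,
  525889, 2113, 300518885036066, 2369, 81470519066636594, 353235850502178, 1345, 2113,
  300518883987490, 2369, 82088514640023602, 353235849453602, 2113, 2369, 300518888181794,
  370887626985506, 140159152290992178, 1073, 72604058625675570, 2097, 299827400482850, 2609,
  90336982152155442, 317359725416482, 787761, 2097, 299827394191394, 2609, 90336980541542706,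
  317359719125026, 1073, 2097, 299827393142818, 2609, 353785602973730, 317359718076450, 2097, 2609,
  299827399434274, 317359722270754, 317359724367906, 2337, 317144701219106, 299419371180066, 2593,
  801, 282510091260194, 2337, 317144707510562, 299419377471522, 801, 2337, 2865, 282510092369954,
  2609, 282510091321378, 335290936987682, 299419370131490, 299419376422946, 299277636149282,
  4196625, 2577, 2849, 983841, 2865, 918577, 2097, 299969127059490, 4196657, 81329781025710386,
  2097, 4196657, 299969132302370, 387754230943778, 4196641, 317144708587810, 299419378520098,
  983841, 4196641, 317144700199202, 299419370131490, 4196641, 2593, 2865, 918577, 787761, 525889,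
  37623692169485193963507778, 103716387520909362, 139877675691020338, 918577, 787761,
  146524825679283033870386, 299419376422946, 529, 281960334327842, 299277642440738, 1170143776786,
  6293505, 4196609, 2833, 1016337, 2849, 983841, 2593, 2865, 918577, 2099249, 76826181397286962,
  352681797558562, 2099249, 2353, 334904389931042, 546422946730018, 2099233, 299552514150434, 2593,
  2099233, 299552521490466, 2865, 918577, 787761, 2881, 525889, 2577, 2849, 983841, 918561, 2099233,
  2865, 787761, 2353, 85805893123444786, 24279188523243900994, 1073, 2353, 336278779465762,
  602007281272623647028351010, 572966011878706974754, 2865, 787761, 2099249, 24279188523243900994,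
  1073, 2099249, 602007281272465239505571874, 334904389931042, 2099233, 2337, 334629512024098,
  94699842134183986, 545873188753442, 2099217, 299277644566562, 1016337, 2577, 2849, 983841, 2865,
  918577, 2099249, 76826181398335538, 352814673104930, 2099249, 2353, 334904389931042,
  369953029351075418146, 2099233, 299552522539042, 352264924565538, 983841, 2099233,
  299552514150434, 352264916176930, 2099233, 2337, 2865, 918577, 787761, 525889,
  37625463057197745056124994, 103717487031488562, 139884272759738418, 918577, 787761,
  146531743209410722402354, 369376568598771929122, 2099217, 299277635129378, 2577, 2099217,
  299277643517986, 1306609651730, 2833, 1016337, 983825, 2849, 918561, 6293537, 2865, 787761,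
  4196657, 85841077495570482, 1073, 4196657, 146975613801467569340466, 387685242994722, 6293537,
  801, 282445933097250, 4196641, 334629510946850, 6293521, 2849, 983841, 4196641, 85700339460841522,
  387410364039202, 6293521, 4196625, 334492081430562, 1016337, 983825, 6293521, 2849, 918561, 2865,
  787761, 4196657, 139885372535636018, 1073, 4196657, 146975618059051485724722, 103786757599887410,
  801, 282445936230690, 4196641, 85700341599936562, 918561, 4196641, 85700339720888370, 801,
  4196641, 335316705714210, 387410364039202, 6293521, 4196625, 334492071993378,
  572105894856062238754]

def cert7 : List ℕ := [
  2817, 1032449, 1016321, 2833, 983825, 6293521, 2849, 918561, 4196641, 2865, 787761, 2609, 2881,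
  525889, 2113, 76966919438217522, 2625, 23198324685972603202, 318051478413346, 1345, 2113,
  77584914744217650, 2625, 355714312843554, 318051477364770, 2113, 146966372325972872732722,
  140159152022556722, 2353, 81329781286797618, 299767533080610, 2609, 1073, 72604058356187442, 2353,
  81329782628974898, 299767538323490, 1073, 2353, 318601230884898, 299767532032034, 299767537274914,
  299552515174690, 4196641, 2593, 2865, 918577, 4196657, 81329781024653618, 299767532032034,
  4196657, 2609, 387891938271266, 299767537274914, 801, 282510090207522, 299552520417570, 2865,
  4196657, 282510090285090, 6293521, 4196625, 2849, 983841, 2593, 2865, 918577, 2099249,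
  76826181397287218, 352681797558306, 2099249, 2353, 334973377843234, 546397176926242, 2099233,
  299552514150690, 2593, 2099233, 299552521490722, 2865, 918577, 787761, 2881, 525889,
  281960333291554, 6293505, 2833, 1016337, 4196625, 2849, 983841, 2593, 2865, 918577, 2097,
  76826181397295154, 2353, 317630301016098, 352681797558562, 2097, 2353, 333059646765362516002,
  546422946730018, 387999044079650, 2081, 299552514158626, 317080544088098, 2593, 2081,
  299552521498658, 317080551428130, 332483186013059026978, 299277635137570, 4196625, 2577, 2849,
  983841, 918561, 2081, 2865, 787761, 4196657, 21973345514029166658, 1073, 4196657,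
  602007281272518089347633186, 387754230943778, 4196641, 2865, 787761, 2097, 21973345514029166658,
  99335452422705202, 1073, 2097, 602007281272570801211772962, 389128620478498,
  572966065551565787170, 2081, 4196641, 85692642878402610, 387479353036834, 439907755626530,
  299277642477602, 6293505, 4196609, 2833, 1016337, 983825, 2577, 2849, 918561, 2099233, 2865,
  787761, 2353, 85841077495574578, 352544091218210, 1073, 2353, 146975631816965590450226,
  352544090169634, 352544095412514, 352264917233954, 2099233, 801, 282445933093154, 2337,
  334629510950946, 352264921428258, 1378199085330, 2099217, 2849, 918561, 2593, 2865, 787761, 2353,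
  139885372535636018, 352814674166306, 1073, 2353, 146975636074549506834482, 2881,
  139885372249309234, 85700339720892466, 2593, 801, 282445935182114, 85700341331505202,
  335316705718306, 2577, 2099217, 2849, 983841, 2337, 85700339459797042, 352264916205858,
  545877477392418, 334492071997474, 334492080386082, 3]

def dseq8 : List ℕ := [
  3, 3, 3, 3, 3, 3, 3, 3, 3, 5, 5, 5]

def cons8 : List CCon := [
  .mk 0 4095 5445847423328601499764522166702896586751 3 2,
  .mk 0 511 79247510050897857578304279039 0 1,
  .mk 1 4095 10891694846657202999529044333405809930242 3 2,
  .mk 1 511 158495020101795715156610641922 0 1,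
  .mk 2 4095 21783389693314405999058088666880221921284 3 2,
  .mk 2 511 316990040203591430321723162628 0 1,
  .mk 3 4095 43566779386628811998116177614479674081288 3 2,
  .mk 3 511 633980080407182895192331026440 0 1,
  .mk 4 4095 87133558773257623996233502803676348088336 3 2,
  .mk 4 511 1267960160814505051366340231184 0 1,
  .mk 5 4095 174267117546515247997149029407710309908512 3 2,
  .mk 5 511 2535920322180980843212416614432 0 1,
  .mk 6 4095 348534235093030515020788711116525237698624 3 2,
  .mk 6 511 5071842754155280727742884347968 0 1,
  .mk 7 4095 697068470186137724909481417080947712983168 3 2,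
  .mk 7 511 10151089583937524217605547098240 0 1,
  .mk 8 4095 1394136940676278899831978466697556750500096 3 2,
  .mk 8 511 40490544014167257626399602639104 0 1,
  .mk 9 4095 2788275043494221726022397413399904775045632 5 4,
  .mk 9 511 165869555644602117089272818305073664 0 1,
  .mk 10 4095 5580629820663543412404558290185887038833664 5 4,
  .mk 10 511 679235586995542303173251567986837292032 0 1,
  .mk 11 4095 22298023604371552426870186540012804662888448 5 4,
  .mk 11 511 2782148632107891777860789602682504059291648 0 1]

def cert8 : List ℕ := [
  2089105, 2081169]

def dseq9 : List ℕ := [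
  3, 3, 3, 3, 3, 3, 3, 3, 4, 4, 5, 5]

def cons9 : List CCon := [
  .mk 0 4095 5445847423328601499764522166702896586751 3 2, .mk 0 255 19347536633519984760328447 0 1,
  .mk 1 4095 10891694846657202999529044333405809930242 3 2,
  .mk 1 255 38695073267039969521692674 0 1,
  .mk 2 4095 21783389693314405999058088666880221921284 3 2,
  .mk 2 255 77390146534079943252393988 0 1,
  .mk 3 4095 43566779386628811998116177614479674081288 3 2,
  .mk 3 255 154780293068176851793379336 0 1,
  .mk 4 4095 87133558773257623996233502803676348088336 3 2,
  .mk 4 255 309560586203592275599097872 0 1,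
  .mk 5 4095 174267117546515247997149029407710309908512 3 2,
  .mk 5 255 619121429374135039657377824 0 1,
  .mk 6 4095 348534235093030515020788711116525237698624 3 2,
  .mk 6 255 1239144316543507126896820288 0 1,
  .mk 7 4095 697068470186137724909481417080947712983168 3 2,
  .mk 7 255 4933021954547484532324958336 0 1,
  .mk 8 4095 1394136940676278899831978466697556750500096 4 3,
  .mk 8 255 20208134410515587202452351353088 0 1,
  .mk 9 4095 2788275043494221726022397413399904775045632 4 3,
  .mk 9 255 82752241088837571691936982534980096 0 1,
  .mk 10 4095 5580629820663543412404558290185887038833664 5 4,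
  .mk 10 255 338953138944965425103195264766063936512 0 1,
  .mk 11 4095 22298023604371552426870186540012804662888448 5 4,
  .mk 11 255 1388352057037468554685593847250403454879744 0 1]

def st9_0 : ℕ × ℕ := (16781318,
  11149011303623843438665986297318135188938502)

def cert9_0 : List ℕ := [
  2099201, 983825, 2321, 918561, 8391201, 787761, 2865, 525889, 2113, 300518885036066, 2369,
  81470519066636594, 2881, 27810010704401043778, 353235850502178, 1345, 2113, 300518883987490, 2369,
  82088514640023602, 2881, 426083057021218, 353235849453602, 2113, 2369, 300518888181794, 2881,
  300518890278946, 370887626985506, 2369, 146966381334271907536946, 140159152290992178, 2097,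
  299827394191394, 2609, 90336980541542706, 317359719125026, 2865, 1073, 72604058625675570, 2097,
  299827400482850, 2609, 90336982152155442, 317359725416482, 1073, 2097, 299827393142818, 2609,
  353785602973730, 317359718076450, 2097, 2609, 299827399434274, 317359722270754, 317359724367906,
  2337, 317144701219106, 299419371180066, 8391201, 2849, 918577, 2097, 299827393142818, 8391217,
  90336980280447282, 317359718076450, 2097, 8391217, 299827399434274, 317359722270754, 8391217,
  2353, 317359724367906, 493449349505058, 801, 282510091260194, 2337, 317144707510562,
  299419377471522, 801, 2337, 8391217, 282510091321378, 335290936987682, 299419370131490,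
  299419376422946, 8391185, 918561, 2337, 787761, 2865, 525889, 2113, 300518885036066, 2625,
  90477718320329010, 2881, 27810010704399999298, 318051478413346, 1345, 2113, 300518883987490, 2625,
  91095713894764594, 2881, 426083057021218, 318051477364770, 2113, 2625, 300518889230370, 2881,
  300518890278946, 335703254896674, 2625, 146966372325973409603634, 140159152022556722, 2097,
  299827394191394, 2353, 81329781286805810, 352544091213858, 2865, 1073, 72604058624631090, 2097,
  299827400482850, 2353, 81329782897418546, 352544097505314, 1073, 2097, 299827393142818, 2353,
  318601230884898, 352544090165282, 2097, 2353, 299827398385698, 352544094359586, 352544095408162,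
  2849, 787761, 2353, 525889, 2113, 300518885036066, 2369, 20892481676761014594, 2625,
  90477718322426162, 423604594679842, 1345, 2113, 300518883987490, 2369, 320529940754722, 2625,
  91095713357893682, 423604593631266, 2113, 2369, 300518888181794, 2625, 300518889230370,
  441256371163170, 2369, 2625, 142244023963948810453554, 140159152559427634, 140159152559427634,
  2097, 299827394191394, 2865, 108351379051028786, 352544091213858, 2353, 1073, 72604058089857330,
  2097, 299827398385698, 2865, 108351380124770610, 352544095408162, 1073, 2097, 299827393142818,
  2865, 424154347151394, 352544090165282, 2097, 2865, 299827400482850, 352544094359586,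
  352544097505314, 2593, 352329073307938, 299419371180066, 2337, 2849, 918577, 2097,
  299827393142818, 2353, 81329781025710386, 2865, 108351378787836210, 352544090165282, 2097, 2353,
  299827398385698, 2865, 299827400482850, 352544094359586, 2353, 2865, 458260682448930,
  153797153450596167232504598578, 352544097505314, 801, 282510090215714, 2593, 352329078550818,
  299419376422946, 2849, 801, 282510092312866, 2593, 352329080647970, 299419378520098, 801, 2593,
  2353, 282510090272802, 2865, 282510092369954, 370475309076514, 299419370131490, 299419377471522,
  299277636149282, 2321, 8391185, 983841, 2849, 918577, 2097, 299969127059490, 2353,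
  81329781025710386, 2609, 90336980280447282, 423050541735970, 2097, 2353, 299969132302370, 2609,
  299969133350946, 440706614300706, 2353, 2609, 387754230943778, 546397177974818, 546397177974818,
  2337, 317144700199202, 2593, 352329072283938, 299419370131490, 2849, 2337, 317144708587810, 2593,
  352329080672546, 299419378520098, 2337, 2593, 2961, 104022351893542073368626, 405109931642914,
  299419376422946, 299419377471522, 529, 281960334327842, 299277642440738, 8391185, 2833, 983841,
  2337, 918577, 2097, 299969127059490, 8391217, 90336980278358322, 317497425469474, 2097, 8391217,
  299969133350946, 335153498034210, 8391217, 2353, 546397175877666, 493311642177570, 8391201,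
  352329072292130, 299419370131490, 2337, 8391201, 352329078583586, 299419376422946, 8391201, 2081,
  299419377471522, 983937, 130729740022714418, 572362705867112583202, 529, 281960335376418,
  299277643489314, 1170143776786, 8391169, 983825, 2099217, 918561, 2337, 787761, 2865, 525889,
  2113, 76966919438217522, 2625, 353295443169314, 2881, 27810010704399991106, 318051478413346, 1345,
  2113, 77584915012653106, 2625, 353295442120738, 2881, 426083057021218, 318051477364770, 2113,
  2625, 353295445266466, 146966372325972872732722, 2625, 2369, 142244023875919160754738,
  353295448412194, 140159152022556722, 2353, 81329781286797618, 2609, 352603952324642,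
  299767533080610, 2865, 1073, 72604058624622898, 2353, 81329782897410354, 2609, 352603958616098,
  299767539372066, 1073, 2353, 318601230884898, 2609, 352603951276066, 299767532032034, 2353, 2609,
  352603956518946, 299767537274914, 299767538323490, 2849, 787761, 2353, 525889, 2113,
  76966919440314674, 2369, 20892481676761006402, 2625, 353295443169314, 423604594679842, 1345, 2113,
  77584914475782194, 2369, 320529940754722, 2625, 353295442120738, 423604593631266, 2113, 2369,
  86029162703360050, 146966399349769660211250, 2369, 2625, 353295446315042, 140159152559427634,
  142244050897516924977714, 2609, 352603952324642, 2865, 108351379051020594, 299767533080610, 2353,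
  1073, 72604058089849138, 2609, 352603956518946, 2865, 108351380124762418, 299767537274914, 1073,
  2609, 352603951276066, 2865, 424154347151394, 299767532032034, 2609, 2097, 299767538323490,
  352603958616098, 299767539372066, 2081, 299552515174690, 352195929313314, 2337, 2849, 918577,
  2353, 81329781025702194, 2609, 352603951276066, 2865, 108351378787828018, 299767532032034, 2353,
  2609, 352603956518946, 2865, 458260682448930, 299767537274914, 2609, 2097, 299767538323490,
  352603958616098, 299767539372066, 801, 282510090207522, 2081, 299552520417570, 352195934556194,
  2849, 801, 282510092304674, 2081, 299552522514722, 352195936653346, 801, 2081, 2353,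
  282510090280994, 2865, 282510092378146, 370475309076514, 352195928264738, 352195933507618, 2833,
  918561, 2099233, 787761, 2353, 525889, 2369, 20892481676757872962, 2625, 353295443169314, 2881,
  108492116828762418, 300459292368930, 1345, 2369, 320529940754722, 2625, 353295442120738, 2881,
  109110111867375666, 300459291320354, 2369, 2625, 353295446315042, 2881, 117554360094953522,
  140159151754121266, 2625, 2113, 370887626985506, 353295448412194, 140159151754121266, 2097,
  76826181659439410, 2609, 352603952324642, 422912835391522, 2353, 1073, 72604058086715698, 2097,
  76826182733181234, 2609, 352603956518946, 422912839585826, 1073, 2097, 301009044840482, 2609,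
  352603951276066, 422912834342946, 2097, 2609, 352603955470370, 422912838537250, 422912840634402,
  2849, 422697817485602, 352195929313314, 2099233, 2337, 918577, 2099249, 76826181396246834, 2609,
  352603951276066, 422912834342946, 2099249, 2353, 335111085170722, 2609, 352603955470370,
  629953276299704487858838491959330, 422912840634402, 801, 282510089171234, 2849, 422697821679906,
  352195933507618, 801, 2849, 2099249, 282510089232418, 493620611387426, 352195928264738,
  352195936653346, 352054194282530, 2099217, 2321, 983841, 2849, 918577, 2099249, 76826181398335794,
  2609, 352745685192738, 423050541735970, 2099249, 2353, 334973377843234, 2609, 352745689387042,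
  546397177974818, 493483172433954, 2099233, 299552514150690, 352195928264738, 2849, 2099233,
  299552522539298, 352195936653346, 2099233, 2337, 2945, 2689, 983969, 146524825680383081320498,
  89855247940233980911666, 405109930594338, 352195933507618, 2833, 983841, 2337, 918577, 2097,
  76826181396246834, 2609, 352745685192738, 2865, 108351378787828018, 317497425469474, 2097, 2609,
  352745689387042, 2865, 440526494109730, 546397175877666, 2609, 2353, 387930056167458,
  352745692532770, 546397175877666, 2081, 299552514158882, 2849, 422697816457506, 352195928264738,
  2337, 2081, 299552520450338, 2849, 422697822748962, 352195934556194, 2081, 2849, 2433,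
  118189446837451317420082, 510663046860834, 535469059250969972770, 352195936653346, 529,
  281960333287458, 352054199525410, 2833, 529, 281960336433186, 352054202671138, 1376302206994]

def cert9 : List ℕ := [
  1032449, 1016321, 3, 2099201, 2305, 1016337, 8391185, 983841, 2849, 918577, 2099249,
  76826181398335538, 2609, 352814673104930, 423050541736226, 2099249, 2353, 334904389931042, 2609,
  369953029351075418146, 546422947778594, 493552160346146, 2099233, 299552514150434,
  352264916176930, 2849, 2099233, 299552522539042, 352264924565538, 2099233, 2337, 2945, 2689,
  983969, 146531743209410722402354, 89855247940233981956146, 405135700398114, 369376568598771929122,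
  2099217, 299277635129378, 8391185, 2833, 983841, 918561, 2099233, 8391297, 2945, 787761, 2353,
  85805893123444786, 8391217, 37547836874810490888486978, 1073, 2353, 336278779465762, 8391217,
  602007281272623647028351010, 2353, 146679299251712261492786, 493311642177570, 787873, 525905,
  1873, 85594787197095986, 66385, 85594786895106098, 147048233922422412283954, 66385,
  126148762827624498, 66465, 787761, 85594786895106098, 1073, 602007281272623647028351010,
  146679299251711892394034, 8391201, 787889, 525905, 1873, 525873, 2099249, 1073, 2099249, 66385,
  126921099953967154, 2099281, 70954127410, 66385, 2099249, 66481, 787761, 126358149698555954, 1073,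
  494686031712290, 146679339803900117127218, 2099233, 2337, 334629512024098, 8391201,
  94699842134183986, 493036764270626, 2099233, 2337, 8391201, 545873188753442, 276959266, 2099217,
  299277643517986, 1306609651730, 8391169, 1016337, 2321, 983841, 2849, 918577, 2097,
  76826181398339634, 2353, 317630301016098, 2609, 90336980280442930, 423050541736226, 2097, 2353,
  333059576392323371042, 2609, 370088762019874, 546422947778594, 2353, 2609, 333059576392325468194,
  458367788257314, 546422947778594, 2081, 299552514154530, 2593, 352329072279586, 317080544088098,
  2849, 2081, 299552522543138, 2593, 352329080668194, 317080552476706, 2081, 2593, 2945,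
  99299980905973271339058, 405135700398114, 332483115640019882018, 332483115640021979170, 2833,
  983841, 2337, 918577, 2097, 76826181396242482, 2609, 90336980278345778, 2865, 423183417282594,
  317497425469730, 2097, 2609, 370088762019874, 2865, 443740040834580680738, 546422945681442, 2609,
  2353, 546422945681442, 443740040834582777890, 458367788257314, 2081, 299552514154530, 2593,
  352329072279586, 422633660354594, 2337, 2081, 299552520445986, 2593, 352329078571042,
  422633666646050, 2081, 2593, 2433, 99299980905972736565298, 510688816664610,
  535496151290493866018, 443163580082279288866, 2065, 299277635133474, 352054193258530, 2321, 2833,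
  1016481, 983841, 918561, 787889, 525905, 1873, 66433, 94601986451902514, 525953,
  94601987004633138, 572101355938919223330, 66385, 32493754320874995778, 2129, 369539011645474,
  459772245905442, 66385, 117141495121842226, 66481, 787761, 32349639055489728578, 1073,
  602007281272588462388875298, 146679308257811903942706, 2081, 369813884112930, 2337,
  99203441761550386, 126225039523676210, 2081, 2337, 545873188753442, 276959266, 278007842, 2065,
  299277642473506, 352054200598562, 2833, 2065, 299277644570658, 352054202695714, 1444048605202,
  1016337, 2099217, 983841, 2337, 918577, 2097, 300038114971682, 8391217, 90336980278358066,
  317497425469730, 2097, 8391217, 314612955468750065698, 335222485946402, 8391217, 2353,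
  546431535616034, 493242654265378, 8391201, 352329072291874, 299488358043682, 2337, 8391201,
  352329078583330, 299488364335138, 8391201, 2081, 314036494716446576674, 983937,
  130738536115736626, 572398734664131547170, 8391185, 352054193270818, 2099217, 2321, 983841,
  918561, 2099233, 8391297, 2945, 787761, 2353, 85823554028965938, 8391217,
  37547836874810490886398018, 1073, 2353, 336347767377954, 8391217, 602016726005589317599301666,
  2353, 146681605112313661231154, 493242654265378, 787873, 525905, 1873, 85612448102617138, 66385,
  130562613447888946, 147050539783023812022322, 66385, 126131170641580082, 66465, 787761,
  85612447800627250, 1073, 602016726005589317599301666, 146681645418691579482162, 8391201, 787889,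
  525905, 1873, 525873, 2099249, 1073, 2099249, 66385, 126903439048446002, 2099281, 70954127410,
  66385, 2099249, 66481, 787761, 126340488793034802, 1073, 494617043800098,
  146681645629317144776754, 2099233, 2337, 334698499936290, 8391201, 94699842132095026,
  492967776358434, 2099233, 2337, 8391201, 545881778688034, 276959266, 8391185, 352054199562274,
  1925118496786, 2099201, 2305, 8391169, 1032609, 1016337, 983825, 918561, 2849, 787761, 2099249,
  94777908003967026, 423183418343970, 1073, 2099249, 146975618057951974096946, 2099265, 2099249,
  2353, 425110637774723186722, 600798594350410313377132834, 2099233, 94707538975625266, 801, 2849,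
  282445936238882, 2099233, 370501077798946, 2849, 2099233, 94707540854673458,
  600198742547785241815253026, 2833, 983841, 2099233, 94707538715578418, 422633660391714, 2099233,
  2337, 545877477392418, 2344508323688053502845202, 2099217, 369676444078114, 2833, 2099217,
  369676453515298, 572105894856062238754, 1032577, 2433, 8391297, 1016337, 983825, 918689, 787777,
  525889, 33393, 2337, 85676219490795570, 263537, 2385, 158175888210673913490112098354, 33345,
  94989014254334002, 2369, 103890660398051378, 33345, 2337, 833, 140167946753376306,
  146829178924507449098290, 33441, 918561, 94707540419588146, 801, 546431529287714, 2337,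
  94707540317810738, 2833, 2321, 983841, 2849, 108752802233699293835314, 572398558394370326562,
  369676444086306, 2833, 404860822466594, 1016337, 983825, 918561, 2337, 787761, 2353,
  317630302077474, 8391217, 510972281454626, 1073, 2353, 71190085682, 8391217, 510972280406050,
  2353, 39373923376197630429907772350530, 510972286697506, 8391201, 510697402433570, 2337, 801,
  282445934133538, 8391201, 510697407676450, 801, 8391201, 511247156084770, 270630946, 2321, 983841,
  2337, 146534026515249160683570, 8391201, 510697401384994, 2337, 153649645535715311148754640946,
  270630946, 8391185, 510422522363938, 2321, 8391185, 510422529703970, 510422530752546, 1032593,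
  1016337, 983825, 918673, 8391313, 787777, 525889, 130632982202515506, 33345, 70130958386, 2881,
  546568970469410, 33345, 2849, 547531039801378, 33425, 8391313, 918561, 510285083410466, 801,
  1240760131858, 153649645535715311148195749938, 918561, 8391201, 545881774522402, 801, 8391201,
  270630946, 8391185, 545606894452770, 277970978]

def dseq10 : List ℕ := [
  3, 3, 3, 3, 3, 3, 3, 4, 4, 4, 4, 5]

def cons10 : List CCon := [
  .mk 0 4095 5445847423328601499764522166702896586751 3 2, .mk 0 127 4723519685917965029503 0 1,
  .mk 1 4095 10891694846657202999529044333405809930242 3 2, .mk 1 127 9447039371835930570754 0 1,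
  .mk 2 4095 21783389693314405999058088666880221921284 3 2, .mk 2 127 18894078743673923715076 0 1,
  .mk 3 4095 43566779386628811998116177614479674081288 3 2, .mk 3 127 37788157495521337966600 0 1,
  .mk 4 4095 87133558773257623996233502803676348088336 3 2, .mk 4 127 75576346218409855352848 0 1,
  .mk 5 4095 174267117546515247997149029407710309908512 3 2, .mk 5 127 151262157492312531402784 0 1,
  .mk 6 4095 348534235093030515020788711116525237698624 3 2, .mk 6 127 599814348319537410342976 0 1,
  .mk 7 4095 697068470186137724909481417080947712983168 4 3,
  .mk 7 127 2457141875976723982526709888 0 1,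
  .mk 8 4095 1394136940676278899831978466697556750500096 4 3,
  .mk 8 127 10061977848532610469379129213184 0 1,
  .mk 9 4095 2788275043494221726022397413399904775045632 4 3,
  .mk 9 127 41213856317038636380650812708225536 0 1,
  .mk 10 4095 5580629820663543412404558290185887038833664 4 3,
  .mk 10 127 168811955464689152742941876651793843200 0 1,
  .mk 11 4095 22298023604371552426870186540012804662888448 5 4,
  .mk 11 127 691453769583346967431345519061345385842688 0 1]

def st10_0 : ℕ × ℕ := (158475667841642509391340015750,
  11132673761354016129182071006847127553872006)

def cert10_0 : List ℕ := [
  394273, 2081, 299552515174690, 4196641, 1073, 1841, 291031300120610, 2353, 318601230884898, 2609,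
  72604058356187442, 2865, 72604058624622898, 299767532032034, 263473, 1841, 291031301169186, 2353,
  81329781286797618, 2609, 1345, 1857, 291722790965282, 2113, 77584914744217650, 2625,
  355714312843554, 2881, 18730754200560632130, 318051477364770, 1601, 1857, 291722792013858, 2113,
  76966919438217522, 2625, 23198324685972603202, 2881, 1617, 1873, 76369885962375218, 2129,
  301966557515810, 2385, 83110029679599666, 2897, 429935912239650, 354614803509538, 1873, 2129,
  301966558564386, 2385, 83969708705058866, 2897, 111272781732319282, 354614804558114, 2129, 2385,
  301966560661538, 2897, 301966562758690, 372335300513826, 2385, 2897, 118012925449543730,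
  354614806655266, 354614808752418, 318051478413346, 1857, 2113, 291722794111010, 2625,
  291722796208162, 2881, 291722797256738, 326907161874466, 2113, 2625, 95036361958101042, 2881,
  76966920780394802, 318051480510498, 2625, 2881, 23198325029569986882, 318051482607650,
  318051483656226, 2865, 1345, 1857, 291722790965282, 2113, 77584915012653106, 2625,
  18730754132109590850, 2881, 426083057021218, 318051477364770, 1601, 1857, 291722792013858, 2113,
  76966919438217522, 2625, 1617, 1873, 76369885693939762, 2129, 301966557515810, 2385,
  83110029411164210, 2641, 359567168061986, 424983547687202, 1873, 2129, 301966558564386, 2385,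
  83969708705058866, 2641, 93258383222837298, 424983548735778, 2129, 2385, 301966560661538, 2641,
  301966561710114, 442704044691490, 2385, 2641, 99998526940061746, 424983550832930, 424983551881506,
  2881, 27810010704399991106, 318051478413346, 1857, 2113, 291722794111010, 2625, 291722796208162,
  2881, 291722797256738, 326907161874466, 2113, 2625, 76966920511959346, 2881, 113050760467583026,
  318051480510498, 2625, 2881, 27810010979277898050, 318051482607650, 318051483656226,
  299767533080610, 1841, 2353, 291031305363490, 2609, 291031306412066, 2865, 291031307460642,
  299767535177762, 2353, 2609, 81329782628974898, 2865, 81329782897410354, 299767537274914, 2609,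
  2865, 263489, 1857, 291722790965282, 2113, 76966919169782066, 2625, 23198324618863739202, 2881,
  27810010637022691650, 318051477364770, 1857, 2113, 291722794111010, 2625, 291722796208162, 2881,
  291722797256738, 326907161874466, 2113, 2625, 95036363568713778, 2881, 113050761809760306,
  318051480510498, 2625, 2881, 494274252779810, 318051482607650, 318051483656226, 299767538323490,
  299767539372066, 2849, 1073, 1841, 291031300120610, 4196657, 72604058089849138, 2865,
  424154347151394, 299767532032034, 263473, 1841, 291031301169186, 4196657, 1345, 1857,
  291722790965282, 2113, 77584914475782194, 2369, 320529940754722, 2625, 18730754131574817090,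
  423604593631266, 1601, 1857, 291722792013858, 2113, 76966919440314674, 2369, 20892481676761006402,
  2625, 1617, 1873, 76369885693939762, 2129, 301966557515810, 2641, 359567168061986, 2897,
  110131627175387186, 319430431420706, 1873, 2129, 301966558564386, 2641, 93258383222837298, 2897,
  110991306469281842, 319430432469282, 2129, 2641, 301966561710114, 2897, 301966562758690,
  337150928424994, 2641, 2897, 127020124704284722, 319430435615010, 319430436663586,
  423604594679842, 1857, 2113, 291722794111010, 2369, 291722795159586, 2625, 291722796208162,
  432460278140962, 2113, 2369, 86029162703360050, 2625, 76966920514056498, 423604596776994, 2369,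
  2625, 20892481951638913346, 423604597825570, 423604598874146, 2865, 108351379051020594,
  299767533080610, 1841, 4196657, 291031305363490, 2865, 291031307460642, 299767535177762, 4196657,
  2609, 263489, 1857, 291722790965282, 2113, 76966919171879218, 4196673, 20892481609383706946,
  423604593631266, 1857, 2113, 291722794111010, 4196673, 291722795159586, 432460278140962, 2113,
  4196673, 86029164045537330, 423604596776994, 4196673, 2625, 388716841546018, 423604597825570,
  2865, 108351380124762418, 299767537274914, 299767539372066, 290623278157858, 2081, 4196641,
  299552520417570, 2849, 299552522514722, 290623282352162, 4196641, 2593, 394289, 1841,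
  291031300120610, 4196657, 81329781024653618, 2865, 263489, 1857, 74785488102432818, 2113,
  300867044773922, 4196673, 81611256286576946, 423879739978018, 1857, 2113, 300867046871074,
  4196673, 83688233466204210, 423879742075170, 2113, 4196673, 300867048968226, 441604532015138,
  4196673, 2625, 388441695264802, 423879744172322, 299767532032034, 1841, 4196657, 291031305363490,
  2865, 291031307460642, 299767535177762, 4196657, 2609, 387891938271266, 2865, 81329782903701810,
  299767537274914, 299767539372066, 2849, 394289, 1841, 291031300120610, 2353, 81329781025702194,
  2609, 263489, 1857, 74785488101384242, 2113, 300867044773922, 2369, 81611256287625522, 2881,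
  108632854049751346, 353510995800354, 1857, 2113, 300867046871074, 2369, 83688233467252786, 2881,
  110709831229378610, 353510997897506, 2113, 2369, 300867048968226, 2881, 300867051065378,
  371235787837474, 2369, 2881, 458810439442466, 353510999994658, 353511002091810, 2865,
  108351378787828018, 299767532032034, 1841, 2353, 291031305363490, 2609, 291031306412066, 2865,
  291031307460642, 299767535177762, 2353, 2609, 81329782636314930, 2865, 458260682448930,
  299767537274914, 2609, 2865, 108351380398440754, 299767538323490, 299767539372066,
  290623283400738, 290623285497890]

def st10_1 : ℕ × ℕ := (158475667841642509253901029510,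
  11143565456200514875847124483133647950991494)

def cert10_1 : List ℕ := [
  4196625, 459553, 2099233, 299552514150690, 2593, 394289, 1841, 291173034037282, 2099249,
  76826181397287218, 2865, 263489, 1857, 74821771986145330, 2099265, 77107656659210546, 2625,
  353781310300194, 423879739978274, 1857, 2099265, 74821772791451698, 2625, 74821773328322610,
  423879742075426, 2099265, 2369, 335523134771234, 2625, 353781313445922, 423879743124002,
  423879745221154, 352681797558306, 1841, 2099249, 291173038231586, 2865, 291173041377314,
  361541777100834, 2099249, 2353, 334973377843234, 2865, 76826183276335410, 352681801752610,
  352681804898338, 2849, 394289, 1841, 291173034037282, 2099249, 76826181398335794, 2609, 263489,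
  1857, 74821771985096754, 2099265, 77107656660259122, 2881, 424150054477858, 353510995800610, 1857,
  2099265, 74821772790403122, 2881, 74821773595709490, 353510997897762, 2099265, 2369,
  335523134771234, 2881, 424150057623586, 353510998946338, 353511002092066, 423050541735970, 1841,
  2099249, 291173038231586, 2609, 291173040328738, 431910521278498, 2099249, 2353, 334973377843234,
  2609, 76826183008948530, 423050545930274, 423050548027426, 290623277109282, 2099233, 2337, 394289,
  263473, 1841, 1601, 2625, 1617, 2641, 289739327828770, 289739327775778, 1617, 2641,
  289739326731298, 289739326780194, 2609, 1601, 1857, 1617, 2897, 289739327763490, 354614803514146,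
  2881, 1617, 1873, 289739323585570, 2897, 1889, 289739323646754, 500849850008354, 354614803514146,
  1873, 353510996857634, 1857, 2881, 1345, 1601, 1857, 1617, 2641, 289739326714914, 424983547691810,
  2625, 1617, 1873, 289739323581474, 2641, 1889, 289739323650850, 500849850008354, 424983547691810,
  1873, 423879741035298, 1857, 2625, 1345, 1841, 2609, 263489, 263489, 263489, 1857, 2625, 1857,
  2625, 2593, 299552521490722, 2849, 299552522539298, 290623282352162, 2593, 2849, 394289, 263473,
  1841, 1601, 2099265, 20298006525945913410, 2625, 23766059714000064578, 28377745732426403906,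
  2099265, 2369, 2625, 2881, 2625, 2881, 2099249, 1601, 1857, 20298006525945913410, 2369,
  86034660547825714, 2625, 24351246190581551426, 28962932209007890754, 1857, 2369, 2625, 2881, 2369,
  2625, 2881, 2625, 2881, 2609, 1601, 1857, 23766059714000064578, 2099265, 24351246190581551426,
  126604509308985394, 1857, 2099265, 2881, 2099265, 2369, 2881, 1601, 1857, 28377745732426403906,
  2099265, 28962932209007890754, 126604509308985394, 1857, 2099265, 2625, 2099265, 2369, 2625, 1841,
  2099249, 79007612465651762, 2609, 92554695233638450, 110569093742071858, 2099249, 2353,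
  334973378957346, 2609, 94840579907817778, 112854978416251186, 493449350684706, 1841, 2099249,
  2353, 334973382103074, 2609, 92554696307380274, 110569094815813682, 493449353830434, 2099249,
  2353, 2609, 334973385248802, 334973386297378, 493449354879010, 290623284449314, 290623285497890,
  529, 281960333275170, 2833, 459553, 2081, 299552514158882, 4196641, 394289, 1841, 291173034037282,
  2097, 76826181396246834, 2609, 263489, 1857, 74821771985096754, 2113, 77107656658170162, 2369,
  318596938211362, 2881, 108632854049751346, 353510995800610, 1857, 2113, 74821772790403122, 2369,
  74821773058838578, 2881, 74821773595709490, 353510997897762, 2113, 2369, 318596941357090, 2881,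
  441076251037730, 353510998946338, 2369, 2881, 318596944502818, 353510999994914, 353511002092066,
  2865, 108351378787828018, 317497425469474, 1841, 2097, 291173038231586, 2609, 291173040328738,
  2865, 291173041377314, 326357405012002, 2097, 2609, 76826183006859570, 2865, 440526494109730,
  317497429663778, 2609, 2865, 108351380398440754, 317497431760930, 317497432809506, 2849,
  422697816457506, 290623277109282, 2081, 4196641, 299552520450338, 2849, 394289, 263473, 1841,
  1601, 4196673, 1617, 2385, 289739326780194, 289739326723106, 4196657, 1601, 1857, 1617, 2641,
  289739326714914, 319430431425314, 2625, 1617, 1873, 289739323581474, 2641, 1889, 289739323642658,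
  395296733741858, 319430431425314, 1873, 318326624768802, 1857, 2625, 1345, 1841, 4196657, 263489,
  263489, 1857, 4196673, 1857, 4196673, 290623282352162, 4196641, 2593, 394289, 263473, 1841, 1601,
  2113, 20298006525948010562, 4196673, 21460216704785322050, 28368457058192793666, 2113, 4196673,
  2881, 4196673, 2625, 2881, 2097, 1601, 1857, 20298006525948010562, 4196673, 22045403181366817090,
  113056258312048690, 1857, 4196673, 2881, 4196673, 2625, 2881, 4196657, 1601, 1857,
  21460216704785322050, 2113, 22045403181366817090, 2625, 99581812033134642, 30115853713614733634,
  1857, 2113, 2625, 2881, 2113, 2625, 2881, 2625, 2881, 1601, 1857, 28368457058192793666, 2113,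
  113056258312048690, 4196673, 30115853713614733634, 1857, 2113, 4196673, 2113, 4196673, 4196673,
  2625, 1841, 2097, 79007612467748914, 4196657, 83547495977848882, 110532809856196658, 2097,
  4196657, 85833380652036402, 440526495223842, 4196657, 2609, 387891939450914, 117358578043617586,
  1841, 2097, 4196657, 83547497051590706, 440526498369570, 4196657, 2609, 387891942596642,
  83547497856897074, 2097, 4196657, 2609, 387891943645218, 440526500466722, 387891946790946, 2849,
  422697822748962, 290623283400738, 290623285497890, 290481548369954]

def st10_2 : ℕ × ℕ := (16781318,
  11149011303623843458008799411152201984237446)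

def cert10_2 : List ℕ := [
  7341825, 459537, 6293521, 801, 2081, 1841, 308902657921058, 4196657, 282510090268706,
  282510092365858, 4196641, 282510090207522, 2849, 282510092304674, 290623277109282, 3, 2833, 801,
  6293537, 282510089171234, 2849, 1841, 432047960231970, 6293553, 282510089220130, 290623277109282,
  394273, 6293537, 1073, 1841, 291031300120610, 2097, 301009044840482, 4196657, 72604058086715698,
  422912834342946, 263473, 1841, 291031301169186, 2097, 76826181659439410, 4196657, 1345, 1857,
  291722790965282, 2369, 320529940754722, 2625, 18730754131571683650, 2881, 109110111867375666,
  300459291320354, 1601, 1857, 291722792013858, 2369, 20892481676757872962, 2625, 1617, 1873,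
  76369885693939762, 2129, 78606429783793714, 2641, 359567168061986, 2897, 425111859826722,
  319430431420706, 1873, 2129, 79466109077688370, 2641, 93258383222837298, 2897, 425111860875298,
  319430432469282, 2129, 2641, 95494927312691250, 2897, 425111861923874, 319430433517858, 2641,
  2897, 425111864021026, 319430435615010, 460296230735906, 2881, 108492116828762418,
  300459292368930, 1857, 2369, 291722795159586, 2625, 291722796208162, 2881, 291722797256738,
  309314975830050, 2369, 2625, 20892481951635779906, 2881, 117554360094953522, 300459295514658,
  2625, 2881, 108492117902504242, 300459296563234, 300459297611810, 422912835391522, 1841, 2097,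
  291031304314914, 4196657, 291031305363490, 422912837488674, 2097, 4196657, 76826182733181234,
  422912838537250, 4196657, 2609, 263489, 1857, 291722790965282, 4196673, 20892481609380573506,
  2881, 108492116560326962, 300459291320354, 1857, 4196673, 291722795159586, 2881, 291722797256738,
  309314975830050, 4196673, 2625, 388716841546018, 2881, 117554361437130802, 300459295514658,
  300459297611810, 422912839585826, 2849, 422697817485602, 290623278157858, 6293537, 4196641,
  394289, 1841, 291031300120610, 2099249, 76826181396246834, 2609, 263489, 1857, 74785488101384242,
  2099265, 77107656658170162, 2881, 424012347084834, 353510995800354, 1857, 2099265,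
  79184633837785138, 2881, 424012349181986, 353510997897506, 2099265, 2369, 335660842164258, 2881,
  424012350230562, 353510998946082, 494381090148386, 422912834342946, 1841, 2099249,
  291031304314914, 2609, 291031306412066, 422912837488674, 2099249, 2353, 335111085170722, 2609,
  76826183006859570, 422912838537250, 422912840634402, 2849, 422697821679906, 290623282352162,
  290623285497890, 290481543127074, 6293521, 3, 529, 2833, 281960336420898, 1135784038418,
  290481551515682, 459537, 7341841, 801, 1825, 6293553, 282510089236514, 432047960231970, 6293537,
  282510089154850, 422564672442402, 394273, 1825, 290756422152482, 6293537, 1073, 2097,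
  301009044840482, 4196657, 72604058086699314, 2865, 422972695453730, 290971439009826, 263473, 2097,
  76826181659423026, 4196657, 1345, 1857, 75333114662096946, 2369, 320529940754722, 2625,
  18730754131571667266, 2881, 423664186298402, 300459291320354, 1601, 1857, 74715119623483698, 2369,
  20892481676757856578, 2625, 1617, 1873, 293170464493602, 2129, 78606429783793714, 2641,
  359567168061986, 2897, 110146882899218482, 319430431420706, 1873, 2129, 293170466590754, 2641,
  293170468687906, 2897, 293170469736482, 328354835402786, 2129, 2641, 95494927312691250, 2897,
  113243106282967090, 319430433517858, 2641, 2897, 127035380428116018, 319430435615010,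
  319430436663586, 2881, 423664187346978, 300459292368930, 1857, 2369, 83777362889674802, 2625,
  74715120697225522, 2881, 423664188395554, 300459293417506, 2369, 2625, 20892481951635763522, 2881,
  423664190492706, 300459295514658, 2625, 2881, 423664191541282, 300459296563234, 441256371163170,
  2865, 422972696502306, 290971440058402, 2097, 4196657, 76826182733164850, 2865, 422972699648034,
  290971443204130, 4196657, 2609, 263489, 1857, 74715119355048242, 4196673, 20892481609380557122,
  2881, 423664186298402, 300459291320354, 1857, 4196673, 83777364231852082, 2881, 423664188395554,
  300459293417506, 4196673, 2625, 388716841546018, 2881, 423664190492706, 300459295514658,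
  441256371163170, 2865, 422972700696610, 290971444252706, 290971446349858, 422564673490978, 1825,
  6293537, 290756426346786, 422564676636706, 6293537, 4196641, 394289, 2099249, 76826181396230450,
  2609, 263489, 1857, 292070951751714, 2099265, 77107656658153778, 2881, 108562485306662962,
  353510995800354, 1857, 2099265, 292070954897442, 2881, 292070958043170, 362439694815266, 2099265,
  2369, 335660842164258, 2881, 112961631043063858, 353510998946082, 353511002091810, 2865,
  422972695453730, 290971439009826, 2099249, 2353, 335111085170722, 2609, 76826183006843186, 2865,
  422972699648034, 290971443204130, 2609, 2865, 422972701745186, 290971445301282, 290971446349858,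
  422564677685282, 422422938460194, 7341841, 6293521, 459553, 1050401, 290756421124386, 4196641,
  394289, 1050417, 74574381582549298, 2609, 263489, 1050433, 74855856844472626, 2369,
  318596938211362, 2881, 108598769190375474, 353510995800610, 1050433, 2113, 309130560737314, 2369,
  318596940308514, 2881, 108598769727246386, 353510997897762, 2369, 2881, 108598770264117298,
  353510999994914, 353511002092066, 2865, 423114429370402, 317497425469474, 1050417, 2097,
  308580803809314, 2609, 74574383193162034, 2865, 423114432516130, 317497428615202, 2609, 2865,
  423114435661858, 317497431760930, 458298800345122, 422564672442402, 1050401, 2081, 394289, 263473,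
  4196657, 1601, 2625, 1617, 2641, 2401, 395296733741858, 289739327836962, 2897, 289739327775778,
  319430431425314, 2641, 2881, 1617, 2641, 289739326731298, 319430431425314, 318326624768802, 2625,
  2881, 1345, 2881, 1601, 4196673, 1617, 2385, 289739326796578, 289739326723106, 4196657, 2609,
  263489, 2881, 4196673, 2881, 263489, 4196673, 4196641, 290756427415842, 422564676636706, 4196641,
  2593, 394289, 263473, 1050417, 1601, 2113, 79278161595142194, 4196673, 21468942429063381314,
  28368457058192793666, 2113, 4196673, 2881, 4196673, 2625, 2881, 4196657, 1601, 1050433,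
  21468942429063381314, 2625, 99581812033134642, 30107127989336674370, 1050433, 2113, 2625, 2881,
  2625, 2881, 1601, 1050433, 28368457058192793666, 4196673, 30107127989336674370, 1050433, 2113,
  4196673, 4196673, 2625, 1050417, 2097, 308580804923426, 4196657, 83581580838338866,
  110532809856196658, 4196657, 2609, 387891939450914, 117324493183127602, 1050417, 2097, 4196657,
  308580810166306, 308580812263458, 4196657, 2609, 387891942596642, 117324493988433970,
  387891946790946, 422564678733858, 529, 281960332242978, 422422942654498, 1651180113938]

def st10_3 : ℕ × ℕ := (79247505327378171660372824450,
  11143565456200594104009638747471241478164866)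

def cert10_3 : List ℕ := [
  4196625, 459553, 1050401, 290756421124130, 2593, 394289, 1050417, 74574381583597618, 2353,
  317630301016098, 2865, 263489, 1050433, 74855856845520946, 2369, 81594832332722226, 2625,
  353781310300450, 423879739978274, 1050433, 2113, 309061572825122, 2369, 81594832869593138, 2625,
  353781312397602, 423879742075426, 2369, 2625, 81594833674899506, 423879744172578, 423879745221154,
  352681797558562, 1050417, 2097, 308511815897122, 2353, 317630304161826, 2865, 74574383462645810,
  352681800704290, 2353, 2865, 317630308356130, 387999044079650, 352681804898594, 2849, 394289,
  1050417, 74574381584646194, 2353, 317630301016098, 2609, 263489, 1050433, 74855856846569522, 2369,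
  81594832331673650, 2881, 424150054478114, 353510995800610, 1050433, 2113, 309061572825122, 2369,
  81594832868544562, 2881, 424150056575266, 353510997897762, 2369, 2881, 81594833942286386,
  353510999994914, 353511002092066, 423050541736226, 1050417, 2097, 308511815897122, 2353,
  317630304161826, 2609, 74574383195258930, 423050544881954, 2353, 2609, 317630307307554,
  458367788257314, 423050548027682, 317080544088098, 1050401, 2081, 394289, 263473, 2353, 1601,
  2625, 1617, 2641, 289739327836962, 289739327775778, 1617, 2641, 289739326731298, 289739326788386,
  2609, 1601, 2369, 1617, 2897, 289739327771682, 354614803514146, 2881, 1617, 2385, 289739325682722,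
  2897, 2401, 289739325743906, 500849850008354, 354614803514146, 2385, 353510996857634, 2369, 2881,
  1345, 1601, 2369, 1617, 2641, 289739326723106, 424983547691810, 2625, 1617, 2385, 289739325678626,
  2641, 2401, 289739325748002, 500849850008354, 424983547691810, 2385, 423879741035298, 2369, 2625,
  1345, 2353, 2609, 263489, 263489, 263489, 2369, 2625, 2369, 2625, 2593, 290756428464162, 2849,
  290756429512738, 317080548282402, 2593, 2849, 394289, 263473, 1050417, 1601, 2113,
  79260500689621042, 2369, 21450928030545444930, 2625, 23774785438278123586, 28386471456704462914,
  2113, 2369, 2625, 2881, 2369, 2625, 2881, 2625, 2881, 2353, 1601, 1050433, 21450928030545444930,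
  2625, 25499963162723749954, 30111649181150089282, 1050433, 2113, 2625, 2881, 2625, 2881, 2609,
  1601, 1050433, 23774785438278123586, 2369, 25499963162723749954, 126604509308985650, 1050433,
  2113, 2369, 2881, 2369, 2881, 1601, 1050433, 28386471456704462914, 2369, 30111649181150089282,
  126604509308985650, 1050433, 2113, 2369, 2625, 2369, 2625, 1050417, 2097, 308511817011234, 2353,
  83511212085706802, 2609, 92588780094128178, 110603178602561586, 2353, 2609, 99327755580215346,
  117342154088648754, 493449350684962, 1050417, 2097, 2353, 308511822254114, 2609, 308511823302690,
  308511824351266, 2353, 2609, 104152701723046667489330, 123042167654525247295538, 493449353830690,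
  493449355927842, 317080551428130, 317080552476706, 2833, 459553, 1050401, 290756421124130,
  4196641, 394289, 1050417, 74574381582549042, 2609, 263489, 1050433, 74855856844472370, 2369,
  318596938211618, 2881, 108616430095896626, 353510995800610, 1050433, 2113, 309061572825122, 2369,
  318596940308770, 2881, 108616430632767538, 353510997897762, 2369, 2881, 108616431169638450,
  353510999994914, 353511002092066, 2865, 423183417282594, 317497425469730, 1050417, 2097,
  308511815897122, 2609, 74574383193161778, 2865, 423183420428322, 317497428615458, 2609, 2865,
  423183423574050, 317497431761186, 458367788257314, 422633660354594, 1050401, 2081, 394289, 263473,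
  4196657, 1601, 2625, 1617, 2641, 2401, 395296733741858, 289739327836962, 2897, 289739327775778,
  319430431425314, 2641, 2881, 1617, 2641, 289739326731298, 319430431425314, 318326624768802, 2625,
  2881, 1345, 2881, 1601, 4196673, 1617, 2385, 289739326796578, 289739326723106, 4196657, 2609,
  263489, 2881, 4196673, 2881, 263489, 4196673, 4196641, 290756427415586, 422633664548898, 4196641,
  2593, 394289, 263473, 1050417, 1601, 2113, 79260500689621042, 4196673, 21468942429063381058,
  28368457058186526786, 2113, 4196673, 2881, 4196673, 2625, 2881, 4196657, 1601, 1050433,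
  21468942429063381058, 2625, 99581812033134898, 30111649181150089282, 1050433, 2113, 2625, 2881,
  2625, 2881, 1601, 1050433, 28368457058186526786, 4196673, 30111649181150089282, 1050433, 2113,
  4196673, 4196673, 2625, 1050417, 2097, 308511817011234, 4196657, 83581580838338610,
  110532809849929778, 4196657, 2609, 387891939451170, 117342154088648754, 1050417, 2097, 4196657,
  308511822254114, 308511824351266, 4196657, 2609, 387891942596898, 123042167654525247295538,
  387891946791202, 422633666646050, 1050385, 290481542103074]

def st10_4 : ℕ × ℕ := (649116354822180831737972382503298,
  11143565456200594104009638747471241444594050)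

def cert10_4 : List ℕ := [
  2577, 459553, 394273, 1050401, 263473, 2097, 79049394170761266, 4196657, 21396884761725730882,
  1345, 2113, 4196673, 1601, 2113, 79190131943280690, 4196673, 21432913631490703426,
  424150055539490, 2113, 4196673, 4196673, 2625, 2097, 4196657, 79049395244503090, 2865,
  79049395781374002, 309886205431842, 4196657, 2609, 387754230943778, 2865, 21396885174042591298,
  283412570272290, 283412572369442, 4196641, 263473, 1050417, 21396884761725730882, 2609,
  99335452422705202, 1345, 1050433, 2625, 1601, 1050433, 21432913631490703426, 2625,
  99476190195224626, 424150055539490, 1050433, 2113, 2625, 1050417, 2097, 308511815897122, 2609,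
  104160772173578908078130, 2865, 21396885174042591298, 283412568183330, 2609, 2865,
  99335454033317938, 389128620478498, 283412572377634, 263473, 1050417, 1345, 2113, 4196673, 1601,
  2113, 79330869433798706, 4196673, 21468942429063315522, 423604594684450, 2113, 4196673, 4196673,
  2625, 4196657, 1345, 1050433, 2625, 1601, 1050433, 21468942429063315522, 2625, 99616927685742642,
  423604594684450, 1050433, 2113, 2625, 423050542793250, 1050417, 2097, 308511815897122, 4196657,
  83511211808882738, 1073, 283412568191522, 423050544890402, 4196657, 2609, 387754230943778, 1073,
  283412570288674, 423050546987554, 1656852918802, 1050401, 2081, 308236937990178, 4196641,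
  83440843064705074, 394289, 2097, 79049393909665842, 4196657, 21396884694885302338,
  423050541756962, 2097, 4196657, 79049395251843122, 449524182159394, 4196657, 2609,
  387754230943778, 423050546999842, 4196641, 2593, 387479353036834, 394289, 1050417,
  21396884694885302338, 2609, 99335452161609778, 423050541765154, 1050417, 2097, 308511815897122,
  2609, 104160772173578915418162, 423050544910882, 528766597206050, 1050401, 2081, 4196641,
  308236944281634, 308236946378786, 4196641, 2593, 406301555550739107874, 83440845212188722,
  387479361425442, 2833, 459553, 394273, 1050401, 263473, 2097, 79049394170761266, 2353,
  21396884761726779458, 2609, 1345, 2113, 2369, 2625, 1601, 2113, 79190131943280690, 2369,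
  21432913631491752002, 2625, 353781311361826, 28350442659130736706, 2113, 2369, 2625, 2369, 2625,
  28314413789365764162, 2097, 2353, 79049395244503090, 2609, 79049395512938546, 2865,
  79049395781374002, 309886205431842, 2353, 2609, 21396885105324163138, 2865, 458122975121442,
  283412570272290, 2609, 2865, 28314414132963147842, 283412571320866, 283412572369442, 2337, 263473,
  1050417, 21396884761726779458, 2609, 1345, 1050433, 2625, 1601, 1050433, 21432913631491752002,
  2625, 353781311361826, 117490588704706610, 1050433, 2113, 2625, 117349850932187186, 1050417, 2097,
  308511815897122, 2609, 21396885105324163138, 2865, 123050238105057488932914, 283412568183330,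
  2609, 2865, 117349852274364466, 283412571329058, 459497364656162, 2593, 263473, 1050417, 1345,
  2113, 2369, 2881, 1601, 2113, 79330869433798706, 2369, 21468942429064364098, 2881,
  28386471456703348802, 353235850506786, 2113, 2369, 2881, 2369, 2881, 2353, 1345, 1050433, 2881,
  1601, 1050433, 21468942429064364098, 2881, 117631326195224626, 353235850506786, 1050433, 2113,
  2881, 2865, 1345, 1050433, 2369, 1601, 1050433, 28386471456703348802, 2369, 117631326195224626,
  353235850506786, 1050433, 2113, 2369, 352681798615586, 1050417, 2097, 308511815897122, 2353,
  83511211809931314, 2865, 110532809572057138, 1073, 283412568187426, 352681800712738, 2353, 2865,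
  458122975121442, 1073, 283412570284578, 352681802809890, 2865, 1073, 283412572381730,
  352681804907042, 1381975011858, 263473, 1050417, 28314413789365764162, 2353, 117349850932187186,
  1345, 1050433, 2369, 1601, 1050433, 28350442659130736706, 2369, 117490588704706610,
  353781311361826, 1050433, 2113, 2369, 1050417, 2097, 308511815897122, 2353,
  123050238105057488932914, 2609, 28314414132963147842, 283412568191522, 2353, 2609,
  117349852274364466, 459497364656162, 283412571337250, 1050401, 2081, 308236937990178, 2337,
  83440843065753650, 2593, 394289, 2097, 79049393908617266, 2353, 21396884694617915458, 2865,
  28314413722256900162, 352681797579298, 2097, 2353, 79049395250794546, 2865, 79049395787665458,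
  379155437981730, 2353, 2865, 458122975121442, 352681802822178, 352681804919330,
  110462440827879474, 2337, 2593, 394289, 1050417, 21396884694617915458, 2865, 117349850670043186,
  352681797587490, 1050417, 2097, 308511815897122, 2865, 123050238105057495224370, 352681800733218,
  528766597206050, 457848097214498, 394289, 1050417, 28314413722256900162, 2353, 117349850670043186,
  352681797595682, 1050417, 2097, 308511815897122, 2353, 123050238105057495224370, 352681800741410,
  528766597206050, 1050401, 2081, 2337, 308236944281634, 2593, 308236945330210, 308236946378786,
  2337, 2593, 83440844944801842, 480088531845577314338, 110462442706927666, 457848104554530,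
  1050385, 290481549443106]

def st10_5 : ℕ × ℕ := (5444517870735034758227107552975086688386,
  11149009974071249891271985516224392122587266)

def cert10_5 : List ℕ := [
  492049, 6293521, 459553, 1825, 290756421136418, 4196641, 394289, 1841, 74574381582561330, 2097,
  300038114971682, 2609, 263489, 1857, 74855856844484658, 2113, 77091232704303154, 2369,
  318596938211618, 2881, 108632854049746994, 353510995800610, 1857, 2113, 77091233241174066, 2369,
  318596940308770, 2881, 432206875136034, 353510997897762, 2113, 2369, 77091233778044978, 2881,
  77091234314915890, 353510998946338, 2369, 2881, 318596944503074, 353510999994914, 353511002092066,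
  2865, 108351378787823666, 317497425469730, 1841, 2097, 300038118117410, 2609, 74574383193174066,
  2865, 431657118208034, 317497428615458, 2097, 2609, 300038121263138, 2865, 300038122311714,
  335222485946402, 2609, 2865, 108351380398436402, 317497431761186, 317497432809762, 2849,
  422697816453154, 299488358043682, 1825, 4196641, 290756427427874, 2849, 394289, 263473, 2097,
  1601, 4196673, 1617, 2385, 289739326784290, 289739326723106, 4196657, 1601, 2113, 1617, 2641,
  289739326719010, 319430431425314, 2625, 1617, 2129, 289739324630050, 2641, 2145, 289739324691234,
  395296733741858, 319430431425314, 2129, 318326624768802, 2113, 2625, 1345, 2097, 4196657, 263489,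
  263489, 2113, 4196673, 2113, 4196673, 299488362237986, 4196641, 2593, 394289, 263473, 1841, 1601,
  2113, 20298006525938610242, 4196673, 21468942429063393346, 110785698081214514, 2113, 4196673,
  2881, 4196673, 2625, 2881, 2097, 1601, 1857, 20298006525938610242, 4196673, 22041198648902160450,
  28944917810489946178, 1857, 4196673, 2881, 4196673, 2625, 2881, 4196657, 1601, 1857,
  21468942429063393346, 2113, 22041198648902160450, 2625, 99581812033134898, 30115853713614729282,
  1857, 2113, 2625, 2881, 2113, 2625, 2881, 2625, 2881, 1601, 1857, 110785698081214514, 2113,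
  28944917810489946178, 4196673, 30115853713614729282, 1857, 2113, 4196673, 2113, 4196673, 4196673,
  2625, 1841, 2097, 79007612458348594, 4196657, 83581580838350898, 431657119322146, 2097, 4196657,
  85816956697055282, 112784609663610930, 4196657, 2609, 387891939451170, 117358578043613234, 1841,
  2097, 4196657, 89985633802933657276466, 431657123516450, 4196657, 2609, 387891942596898,
  431657124565026, 2097, 4196657, 2609, 387891943645474, 89985633802934731018290, 387891946791202,
  2849, 422697822744610, 299488364335138, 299488366432290, 1809, 290481542115362, 422422937432098,
  6293521, 4196625, 459553, 394273, 1825, 263473, 2099249, 20243963257117847618, 2609, 1345,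
  2099265, 2625, 1601, 2099265, 20279992126882820162, 2625, 353781311361826, 110715329334874162,
  2099265, 2369, 2625, 110574591562354738, 2099249, 2353, 334973377843234, 2609,
  20243963600715231298, 2865, 110574592367661106, 283412569223714, 2609, 2865, 110574592904532018,
  283412571320866, 433031507742754, 2099233, 263473, 1841, 20243963257117847618, 2353,
  85823554028965938, 2609, 1345, 1857, 2369, 2625, 1601, 1857, 20279992126882820162, 2369,
  85964291801485362, 2625, 353781311361826, 28926903411434156098, 1857, 2369, 2625, 2369, 2625,
  28890874541669183554, 1841, 2353, 89992551331961292066866, 2609, 20243963600715231298, 2865,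
  431657118208034, 283412568179234, 2353, 2609, 85823555371143218, 2865, 89992551331962365808690,
  336347767377954, 2609, 2865, 28890874885266567234, 283412571324962, 283412572373538, 2593, 263473,
  1841, 1345, 2099265, 2881, 1601, 2099265, 20316020924455432258, 2881, 110856066825392178,
  353235850506786, 2099265, 2369, 2881, 2099249, 1345, 1857, 2369, 2881, 1601, 1857,
  20316020924455432258, 2369, 86105029292003378, 2881, 28962932209006768194, 353235850506786, 1857,
  2369, 2881, 2369, 2881, 2865, 1345, 1857, 2099265, 1601, 1857, 110856066825392178, 2099265,
  28962932209006768194, 353235850506786, 1857, 2099265, 2099265, 2369, 352681798615586, 1841,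
  2099249, 79007612180475954, 2865, 431657118208034, 1073, 283412568187426, 352681800712738,
  2099249, 2353, 334973377843234, 2865, 112784609385738290, 1073, 283412569236002, 352681801761314,
  2865, 1073, 283412572381730, 352681804907042, 1381975011858, 263473, 1841, 110574591562354738,
  2099249, 28890874541669183554, 1345, 1857, 2099265, 1601, 1857, 110715329334874162, 2099265,
  28926903411434156098, 353781311361826, 1857, 2099265, 2099265, 2369, 1841, 2099249,
  110574592367661106, 2609, 110574592904532018, 433031507742754, 2099249, 2353, 334973377843234,
  2609, 28890874885266567234, 283412569240098, 283412571337250, 1825, 2099233, 78937243436298290,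
  2593, 394289, 2099249, 20243963190008983618, 2865, 110574591300210738, 352681797579298, 2099249,
  2353, 334973377843234, 2865, 110574592373952562, 352681801773602, 502300740292642,
  431382240301090, 2099233, 2337, 334698499936290, 2593, 394289, 1841, 20243963190008983618, 2353,
  85823553766821938, 2865, 28890874474560319554, 352681797583394, 1841, 2353,
  89992551331961298358322, 2865, 431657118208034, 352681800729122, 2353, 2865,
  89992551331962372100146, 405616999927842, 352681804923426, 112714240641560626, 394289, 1841,
  110574591300210738, 2099249, 28890874474560319554, 352681797595682, 1841, 2099249,
  110574592373952562, 502300740292642, 2099249, 2353, 334973377843234, 352681801789986, 1825,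
  2099233, 2337, 350956942888170295330, 2593, 78937245315346482, 431382245543970, 431382247641122,
  2099233, 2337, 2593, 334698507276322, 350956942888174489634, 112714242520608818, 1809,
  290481548406818, 422422943723554, 1684549996562]

def st10_6 : ℕ × ℕ := (324597801163754104954816393397120,
  11143565456525112657677512513626233395725184)

def cert10_6 : List ℕ := [
  459537, 3147537, 394273, 2099233, 78943840768200754, 2593, 1073, 2099249, 283545444786722, 2609,
  2099265, 283545447985442, 283545447932450, 263473, 2099249, 79014209796542514, 2609,
  352814674166306, 1345, 2099265, 2881, 1601, 2099265, 79225316315336754, 2881, 108616430359126578,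
  353235850502434, 2099265, 2369, 2881, 2099249, 2353, 334904389890082, 2609, 352814677312034,
  79014211407155250, 352814680457762, 1073, 2099249, 283545444790818, 2609, 283545446887970,
  2099265, 283545446936866, 263473, 2099249, 79014209796542514, 2609, 1345, 2099265, 2625, 1601,
  2099265, 79225316315336754, 2625, 90602031849648690, 423604594680098, 2099265, 2369, 2625,
  423183418343970, 2099249, 2353, 334904389890082, 2609, 79014211138719794, 423183421489698,
  423183423586850, 2099233, 2337, 334629510934562, 2593, 78943842378813490, 2849, 78943842647248946,
  308924131676194, 2593, 801, 282445935178018, 394289, 2099249, 79014209528107058, 2609,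
  352814673146402, 423183417319970, 2099249, 2353, 334904389890082, 2609, 352814677340706,
  423183421514274, 2099265, 282445936226594, 2577, 394273, 3147553, 1073, 2099249, 283545444774434,
  2865, 283545447920162, 352544090169634, 263473, 2099249, 79084578542882866, 2865, 1345, 2099265,
  2625, 1601, 2099265, 79190131942199346, 2625, 353364431089954, 108616430359126322, 2099265, 2369,
  2625, 352544091218210, 2099249, 2353, 334904389890082, 2865, 79084580153495602, 352544094363938,
  352544097509666, 2849, 1073, 3147569, 283545443742242, 2865, 3147585, 283545443803426,
  494655968059682, 352544090169634, 263473, 3147569, 1345, 2099265, 2625, 1601, 2099265,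
  20317709774317850690, 2625, 353364431089954, 423604594680098, 2099265, 2369, 2625, 2865,
  423183418343970, 352544091218210, 3147569, 2099249, 308511815864354, 2865, 423183420441122,
  352544093315362, 352544097509666, 352264917233954, 3147553, 2099233, 308236936908834, 801,
  282445932044578, 2849, 394289, 2099249, 79084578281787442, 2865, 423183417307682, 352544090169634,
  2099249, 2353, 334904389890082, 2865, 423183421501986, 352544094363938, 352544097509666,
  352264920379682, 801, 2849, 282445936238882, 1378199085330, 352264924573986, 394273, 3147553,
  1073, 2099249, 283545444774434, 2609, 283545446871586, 422912834347298, 263473, 2099249,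
  79084578542882866, 2609, 1345, 2099265, 2625, 1601, 2099265, 79190131942199346, 2625,
  90602031849648434, 423733175267618, 2099265, 2369, 2625, 422912835395874, 2099249, 2353,
  334904389890082, 2609, 79084579885060146, 422912838541602, 422912840638754, 2593, 1073, 3147569,
  283545443738146, 2609, 3147585, 283545443807522, 494655968059682, 422912834347298, 263473,
  3147569, 1345, 2099265, 2881, 1601, 2099265, 20317709774316802114, 2881, 423733175267618,
  353235850502434, 2099265, 2369, 2881, 2609, 352814674166306, 422912835395874, 3147569, 2099249,
  308511815864354, 2609, 352814676263458, 422912837493026, 422912840638754, 422633661411618,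
  3147553, 2099233, 308236936908834, 2593, 394289, 2099249, 79084578280738866, 2609,
  352814673130018, 422912834347298, 2099249, 2353, 334904389890082, 2609, 352814677324322,
  422912838541602, 422912840638754, 801, 282445932048674, 422633664557346, 2593, 801,
  282445935194402, 422633667703074, 1653076992274, 3147537, 2099217, 308099497955362, 2577, 459553,
  2099233, 78943840507105330, 2849, 394289, 2099249, 79084578280673330, 2609, 352814673129762,
  423050541736226, 2099249, 2353, 334904389955618, 2609, 352814677324066, 423050545930530,
  423050548027682, 352264916201762, 2099233, 2337, 334629510934562, 2849, 78943842654588978,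
  378743120039970, 352264924590370, 459553, 2099233, 78943840508153906, 2593, 394289, 2099249,
  79084578281721906, 2865, 423183417307426, 352681797558562, 2099249, 2353, 334904389955618, 2865,
  423183421501730, 352681801752866, 352681804898594, 422633660379426, 2099233, 2337,
  334629510934562, 2593, 78943842387202098, 449111864217634, 422633667719458, 459553, 3147553,
  394289, 2099249, 79049393900195890, 2609, 352814673146146, 423183417319714, 2099249, 2353,
  334904389955618, 2609, 352814677340450, 423183421514018, 2099265, 2593, 352264916218146,
  422633660391714, 3147553, 2099233, 308236936908834, 2593, 352264920412450, 422633664586018,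
  1925924856082]

def st10_7 : ℕ × ℕ := (5444517870814262920741371890568664205696,
  11149009974071329119434499780561985666533760)

def cert10_7 : List ℕ := [
  459537, 1050385, 394273, 2081, 78943840768208946, 4196641, 1073, 2097, 283545444782626, 2353,
  2113, 2625, 283545446936866, 2609, 283545446879778, 283545447928354, 263473, 2097,
  79014209796550706, 2353, 317630302077474, 2609, 1345, 2113, 2625, 2881, 1601, 2113,
  79225316315344946, 2625, 90602031849640498, 2881, 110750513706926130, 318051478413602, 2113, 2625,
  2881, 2625, 2881, 110539407188131890, 2097, 2353, 317630305223202, 2609, 79014211138727986,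
  440457506156578, 2353, 2609, 317630307320354, 317630308368930, 110539408530309170,
  110469038159790130, 2081, 4196641, 78943842110386226, 2849, 440182627201058, 308924131684386,
  4196641, 2593, 394289, 2097, 79014209528115250, 4196657, 317630301053474, 110539406919696434,
  2097, 4196657, 317630305247778, 440457506156578, 4196657, 2609, 2113, 317630308393506, 2849,
  110469039501967410, 282445934129442, 432069433983010, 4196625, 394273, 1050401, 1073, 2097,
  283545444774434, 2609, 283545446871586, 2865, 283545447920162, 317359718080802, 263473, 2097,
  79084578542891058, 2609, 1345, 2113, 2369, 2625, 1601, 2113, 79190131942207538, 2369,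
  318180059001122, 2625, 90602031849640242, 110715329333788722, 2113, 2369, 2625, 2369, 2625, 2865,
  110609775934472242, 317359719129378, 2097, 2609, 79084579885068338, 2865, 440457506156578,
  317359722275106, 2609, 2865, 110609777276649522, 317359724372258, 317359725420834, 2593, 1073,
  1050417, 283545443738146, 2609, 1050433, 283545443799330, 2369, 389102851793186, 283545447993634,
  2865, 283545447932450, 317359718080802, 263473, 1050417, 1345, 2113, 2369, 2881, 1601, 2113,
  20317709774316810306, 2369, 318180059001122, 2881, 28388160306564726850, 353235850502434, 2113,
  2369, 2881, 2369, 2881, 2609, 352814674166306, 2865, 1345, 1050433, 2369, 1601, 1050433,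
  28388160306564726850, 2369, 318180059001122, 353235850502434, 1050433, 2113, 2369,
  317359719129378, 1050417, 2097, 308511815872546, 2609, 352814676263458, 2865, 431657118171170,
  317359721226530, 2609, 2865, 352814680457762, 317359724372258, 317359725420834, 2849, 1073,
  1050417, 283545443742242, 2609, 283545446887970, 317359718080802, 263473, 1050417,
  110609775934472242, 2609, 1345, 1050433, 2369, 1601, 1050433, 110715329333788722, 2369,
  318180059001122, 90602031849648690, 1050433, 2113, 2369, 317359719129378, 1050417, 2097,
  308511815872546, 2609, 110609777276649522, 317359721226530, 317359724372258, 317080545145122,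
  1050401, 2081, 308236936917026, 2593, 394289, 2097, 79084578280747058, 2609, 352814673130018,
  2865, 110609775672328242, 317359718080802, 2097, 2609, 352814677324322, 2865, 440457506156578,
  317359722275106, 2609, 2865, 352814680470050, 317359724372258, 317359725420834, 2849,
  431382239215650, 801, 282445932040482, 317080548290850, 2593, 2849, 394289, 1050417,
  110609775672328242, 2609, 352814673146402, 317359718080802, 1050417, 2097, 308511815872546, 2609,
  352814676292130, 317359721226530, 317359724372258, 801, 282445935186210, 317080551436578, 2849,
  801, 282445936234786, 317080552485154, 1240760131858, 394273, 1050401, 110469038159790130,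
  4196641, 1073, 1050417, 110539406919696434, 2353, 1050433, 283545446953250, 283545446879778,
  263473, 1050417, 110539407188131890, 2353, 317630302077474, 1345, 1050433, 2625, 1601, 1050433,
  110750513706926130, 2625, 90602031849640498, 318051478413602, 1050433, 2113, 2625, 1050417, 2097,
  308511815872546, 2353, 110539408261873714, 110539408530309170, 317630307320354, 1050401, 2081,
  308236936917026, 4196641, 110469039501967410, 432069433983010, 4196641, 2593, 394289, 1050417,
  110539406919696434, 4196657, 317630301053474, 1050417, 2097, 308511815872546, 4196657,
  110539408261873714, 1050433, 282445934145826, 1050385, 2065, 308099497963554, 4196625, 459553,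
  2081, 78943840506064946, 2593, 394289, 2097, 79084578279632946, 2353, 317630301040930, 2865,
  110609775671214130, 352681797558562, 2097, 2353, 317630305235234, 2865, 440457506222114,
  352681801752866, 2353, 2865, 317630308380962, 352681802801442, 352681804898594, 2849,
  110469037897646130, 317080544112930, 2081, 2593, 78943842385113138, 2849, 440182627201058,
  343558747959330, 2593, 2849, 110469039776694322, 317080551452962, 466704050257954,
  431244800262178, 4196625, 2577, 459553, 1050401, 394289, 2097, 79049393900204082, 4196657,
  317630301053218, 110574591291785266, 2097, 4196657, 317630305247522, 440457506222114, 4196657,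
  2609, 2113, 317630308393250, 2849, 394289, 1050417, 110574591291785266, 4196657, 317630301053218,
  1050417, 2097, 308511815938082, 4196657, 110574592633962546, 1050433, 4196641, 317080544125218,
  1050401, 2081, 308236936917026, 2849, 431382239215650, 4196641, 317080548319522, 2849, 4196641,
  317080552513826, 1513591218450, 459553, 1050401, 110469037897646130, 2593, 394289, 1050417,
  110609775671214130, 2353, 317630301057314, 352681797558562, 1050417, 2097, 308511815938082, 2353,
  317630304203042, 352681800704290, 352681802801442, 317080544129314, 1050401, 2081,
  308236936917026, 2593, 110469039776694322, 466704050257954, 317080551469346]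

def cert10 : List ℕ := [
  508161, 492033, 3, 7341825, 6293505, 492049, 3, 4196625, 3, 2833, 1050385, 290481551540258,
  1203513659410, 3, 7341825, 6293505, 4196609, 492049, 3, 3147537, 2099217, 2321, 459553, 394273,
  2593, 263473, 2865, 1345, 1601, 525462624860230660642, 2865, 1073, 263473, 2609, 1345, 2625, 2609,
  1073, 394289, 2609, 2577, 308099506343970, 308099507392546, 459553, 394273, 2099233, 263473, 2353,
  85805893123469362, 2609, 24857338125407588418, 29469024143833927746, 2353, 2609, 2865, 2609, 2865,
  2593, 263473, 2099249, 24857338125407588418, 126358149698580786, 2099249, 2353, 2865, 263473,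
  2099249, 29469024143833927746, 126358149698580786, 2099249, 2353, 2609, 2099233, 2337,
  334629512048674, 2593, 96958239017635890, 114972637526069298, 493036764295458, 2099233, 2337,
  2593, 148892928700377065418802, 148892946714775573852210, 493036769538338, 492049, 3, 1050385,
  2065, 4196625, 308099505303586, 459553, 394273, 4196641, 263473, 2609, 1345, 2625, 2609, 1073,
  394289, 4196657, 4196625, 2577, 459553, 394273, 2081, 263473, 4196657, 22551495116192854082,
  112827490887692338, 4196657, 2609, 2865, 4196641, 263473, 2097, 22551495116192854082, 2609,
  99335452422730034, 30621945648440770626, 2097, 2609, 2865, 2609, 2865, 263473, 2097,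
  112827490887692338, 4196657, 30621945648440770626, 2097, 4196657, 4196657, 2609, 2081, 4196641,
  87951039761854514, 440182628315170, 4196641, 2593, 387479353061666, 119476237153435698, 2081,
  4196641, 2593, 387479358304546, 148892946714775573852210, 148891807305169626038322,
  431244807602210, 459553, 394273, 1050401, 263473, 2097, 79049394170802226, 4196657,
  30621945648440770626, 2097, 4196657, 4196657, 2609, 4196641, 263473, 1050417,
  30621945648440770626, 99335452422746418, 1050417, 2097, 2609, 1050401, 2081, 308236938031138,
  4196641, 119476237153435698, 387479353078050, 1050401, 2081, 4196641, 148892946714775573852210,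
  148891807305169091264562]

def dseq11 : List ℕ := [
  3, 3, 3, 3, 3, 3, 4, 4, 4, 4, 4, 4]

def cons11 : List CCon := [
  .mk 0 4095 5445847423328601499764522166702896586751 3 2, .mk 0 63 1153203048319815743 0 1,
  .mk 1 4095 10891694846657202999529044333405809930242 3 2, .mk 1 63 2306406096639881218 0 1,
  .mk 2 4095 21783389693314405999058088666880221921284 3 2, .mk 2 63 4612812194269118468 0 1,
  .mk 3 4095 43566779386628811998116177614479674081288 3 2, .mk 3 63 9225628166129745928 0 1,
  .mk 4 4095 87133558773257623996233502803676348088336 3 2, .mk 4 63 18464478097022451728 0 1,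
  .mk 5 4095 174267117546515247997149029407710309908512 3 2, .mk 5 63 72643064189046358048 0 1,
  .mk 6 4095 348534235093030515020788711116525237698624 4 3, .mk 6 63 297582893415880116666432 0 1,
  .mk 7 4095 697068470186137724909481417080947712983168 4 3,
  .mk 7 63 1218597373781536393040232576 0 1,
  .mk 8 4095 1394136940676278899831978466697556750500096 4 3,
  .mk 8 63 4991374238693873248763141685504 0 1,
  .mk 9 4095 2788275043494221726022397413399904775045632 4 3,
  .mk 9 63 20444668880481474227299569041932800 0 1,
  .mk 10 4095 5580629820663543412404558290185887038833664 4 3,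
  .mk 10 63 83741363734449701173819766277152965632 0 1,
  .mk 11 4095 22298023604371552426870186540012804662888448 4 3,
  .mk 11 63 343004625856305971173443364134181339662336 0 1]

def st11_0 : ℕ × ℕ := (79247519494477620269275152832,
  11143565456200435608729737603015355159527872)

def cert11_0 : List ℕ := [
  229905, 197393, 1050401, 2081, 308236936896546, 132129, 75565041536041010, 801, 295725697171490,
  12585249, 75565042878218290, 132129, 12585249, 1073, 1050417, 283545443734050, 2353, 1050433,
  84994453271576626, 8391233, 283545446932770, 8391217, 283545446879778, 1050417, 2097,
  308511815852066, 2353, 317630304174626, 1329, 75635410564382770, 8391217, 75635411906560050, 2353,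
  1329, 317630302077474, 8391217, 317630307320354, 1329, 8391217, 1345, 1050433, 73150583567258162,
  2625, 355714312843554, 2881, 73150584640999986, 318051477365026, 1050433, 2113, 309061572780066,
  2625, 90602032118075954, 2881, 75846518425354290, 318051479462178, 2625, 2881, 90602033191817778,
  318051482607906, 318051483656482, 1050433, 2113, 495373769847074, 8391233, 22722632324575486018,
  1345, 75846516814741554, 318051479462178, 8391233, 2881, 310161089847330, 1345, 90602031587496498,
  310161091944482, 318051477365026, 12585249, 8391201, 1050417, 2097, 308511815852066, 4196657,
  317630304199202, 132145, 75635410295947314, 75635412174995506, 4196657, 2609, 1050433,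
  451998085570594, 132145, 317630301053474, 317630308393506, 132145, 1050433, 2113, 309061572845602,
  4196673, 27334318341375483970, 1345, 75916885557870642, 389541211218210, 4196673, 2625,
  388441695265058, 1345, 81594832332759602, 310161090895906, 423879739978018, 282445934125346,
  12585233, 1050401, 2081, 308236936896546, 197409, 75565041273897010, 8391201, 75565043152945202,
  330360313446434, 197409, 8391201, 1050417, 2097, 308511815917602, 2353, 317630304182562, 132145,
  75705779047465010, 2865, 75705780926513202, 352681800704290, 2353, 132145, 317630301036834, 2865,
  317630308376866, 352681802801442, 132145, 2865, 1050433, 2113, 126878288525336882, 2369,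
  126878288256901426, 2625, 34287876028596576322, 1345, 19452737103774974018, 34287876028596576322,
  2369, 2625, 310161091944482, 1345, 81594832332742962, 310161090895906, 2625, 1345,
  353781310300450, 494518797541666, 423879739978274, 352681797558562, 352681804898594,
  317080544108834, 8391201, 2849, 1050417, 2097, 2353, 8391217, 132145, 308511817031714, 2353,
  8391217, 132145, 84642609550688306, 8391217, 2865, 132145, 23992365455133212738, 2113, 2369,
  495098619175202, 8391233, 34287876028596576322, 311810351915042, 2369, 8391233, 79541977024258098,
  285341279089442, 8391233, 2881, 493999106498850, 285341280138018, 2353, 8391217, 2865, 132145,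
  99327755580236082, 1050433, 2113, 309061572845602, 8391233, 127167459818217778, 285341277000482,
  8391233, 2881, 493999106498850, 285341280146210, 8391217, 2865, 132145, 493449350684962, 1050433,
  2113, 126885985106731314, 2369, 126885984838295858, 2881, 34287876028596576322, 285341277004578,
  2369, 2881, 126604510114292018, 285341279101730, 496747885568290, 317080551448866, 12585233,
  8391185, 1050401, 2081, 4196641, 308236944302114, 197409, 308236938010658, 308236946399266,
  4196641, 2593, 387479357251874, 197409, 84572240529686578, 84572242677170226, 197409, 132129,
  2097, 4196657, 425533576135202, 1329, 79049394170781746, 1073, 324939218652021153826,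
  79049395781394482, 4196657, 2609, 115781878647250994, 1329, 21686522512760995906, 1073,
  115922617495609394, 21686522925077856322, 1329, 1345, 2113, 79190131674865714, 4196673,
  285611593610018, 2129, 115922616135606322, 4196689, 285611593658914, 2113, 4196673,
  424983551881762, 79190133285478450, 4196673, 2625, 424983549784610, 79612345499934770,
  283412572369442, 2097, 4196657, 132145, 79049393909686322, 4196657, 2609, 132145,
  21686522445920567362, 132145, 423050541756962, 4196641, 2593, 197409, 387479353057570,
  387479361446178, 197409, 132129, 1050417, 2097, 308511815917602, 2609, 425533574038050, 1329,
  21686522512760995906, 1073, 115922617495674930, 21686522925077856322, 2609, 1329,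
  99335452422725938, 1073, 310161091944482, 99335454033338674, 1329, 1345, 1050433, 285611591512866,
  2625, 285611594658594, 1050449, 285611591569954, 285611594715682, 1050433, 2113, 424983551881762,
  2625, 424983549784610, 424150056588066, 310161085521954, 283412572377634, 1050417, 2097, 2609,
  132145, 21686522445920567362, 2609, 132145, 99335452161630514, 132145, 423050541765154, 197409,
  132129, 1050417, 2097, 308511815917602, 4196657, 84642609273864242, 1329, 1345, 2113,
  285611592545058, 4196673, 285611593593634, 423604593635874, 2113, 4196673, 425249571422754,
  423604596781602, 4196673, 2625, 79541977023143986, 79541976754708530, 1073, 283412568191522,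
  423050544890402, 4196657, 2609, 387754230964514, 1329, 1345, 1050433, 285611591504674, 2625,
  285611594650402, 423604593635874, 1050433, 2113, 309061572780066, 2625, 425249569325602,
  423604595733026, 423604598878754, 1073, 283412570288674, 423050546987554, 1329, 423050542793250,
  1656852918802]

def st11_1 : ℕ × ℕ := (649116354826903198220842027712960,
  11143565456200435609003708664016887049601472)

def cert11_1 : List ℕ := [
  8391185, 2833, 1574433, 1050401, 2081, 12585265, 8391217, 8391233, 496610179322146, 12585249,
  295038509809698, 197409, 295038503518242, 12585249, 8391201, 387479356223778, 197409, 1050417,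
  2097, 8391217, 132145, 75670594675441714, 8391217, 2865, 132145, 99335452156408114, 197409,
  132129, 1050417, 2097, 308511815917602, 12585265, 75670596012376114, 1329, 75670594938634290,
  296687770959906, 12585265, 8391217, 387754230984994, 1329, 1345, 1050433, 285611591504674,
  8391233, 285611594650402, 1050433, 2113, 494960911814946, 8391233, 34242839748845592642,
  493861399073058, 283412570268194, 12585249, 8391201, 2849, 1574449, 1050417, 1050433,
  311810353029154, 197409, 387479353078050, 197409, 132129, 1574449, 1050417, 295313381425186,
  8391217, 99335452691181874, 1329, 1345, 1050433, 285611591492386, 8391233, 99476189926830386,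
  1050433, 2113, 494960911814946, 8391233, 34242839748845592642, 493861399073058, 283412567134754,
  8391217, 2865, 493311642210594, 1329, 99335452422746418, 389128620519714, 229905, 1574433,
  1050401, 295038502404130, 197409, 1050417, 2097, 308511815917602, 4196657, 317630304198946,
  132145, 75670594668036146, 75670596547084338, 4196657, 2609, 1050433, 451998085570594, 132145,
  317630301053218, 317630308393250, 132145, 1050433, 2113, 309061572845602, 4196673,
  27325311142120742978, 1345, 75952069929959474, 389403503829282, 4196673, 2625, 388303987876130,
  1345, 81594832332759346, 310161090895906, 423879739978274, 2849, 1050417, 2097, 4196657, 2865,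
  132145, 308511817031714, 4196657, 2609, 2865, 132145, 21686522445920567362, 2865, 132145,
  111699391687000114, 2113, 4196673, 27361339939139706946, 2881, 389403500552482, 311810351915042,
  4196673, 2625, 388303987876130, 2881, 79541976755822642, 285341279089442, 285341281186594,
  4196657, 2609, 2865, 132145, 387754232062242, 2865, 132145, 117342154084491570, 1050433, 2113,
  309061572845602, 2625, 27361339939139706946, 2881, 99828034470879538, 285341277000482, 2625, 2881,
  310161085521954, 391052766945570, 285341281194786, 1050433, 2113, 309061572845602, 4196673,
  100109509450801458, 285341277008674, 4196673, 2625, 388303987876130, 285341279105826, 4196641,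
  317080547270946, 2849, 197409, 1574449, 1050417, 295313381425186, 4196657, 317630303150370,
  132145, 1050433, 2113, 309061572845602, 4196673, 27325311142120742978, 2881, 389403503829282,
  75881701186895922, 4196673, 2625, 388303987876130, 2881, 310161090895906, 81594832332693810,
  424150054478114, 423050543833378, 4196657, 2609, 1574465, 1050433, 295863139467298,
  310161085587490, 132145, 317630301053218, 423050546979106, 132145, 423050541736226, 4196641,
  317080552513826, 197409, 4196641, 317080544125218, 1513591218450, 229905, 197393, 1574433,
  1050401, 295038502404130, 132129, 1073, 1050417, 283545443721762, 8391217, 283545446867490,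
  317359718080802, 1050417, 2097, 308511815852066, 1329, 75705779310723122, 8391217,
  75705780652900402, 317359721226530, 1329, 8391217, 1345, 1050433, 73150583567257906, 2369,
  318180057952546, 2625, 355714312843554, 73150584640999730, 1050433, 2113, 309061572780066, 2369,
  318180060049698, 2625, 90602032118075698, 75811334052216882, 2369, 2625, 318180063195426,
  318180064244002, 90602033191817522, 317359719129378, 8391217, 2865, 1050433, 2113,
  495373769847074, 2369, 495373768798498, 8391233, 117835835916886322, 75811332441604146, 2369,
  8391233, 310161091944482, 318180057952546, 8391233, 2881, 310161089847330, 90602031587496242,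
  317359724372258, 8391201, 1050417, 2097, 308511815852066, 2609, 352814676271650, 132145,
  75705779048579122, 2865, 75705780927627314, 317359721226530, 2609, 132145, 352814673125922, 2865,
  352814680465954, 317359724372258, 132145, 2865, 1050433, 2113, 309061572845602, 2369,
  31973025888847618114, 2625, 117835835910594866, 1345, 19452737103776088130, 31973025888847618114,
  2369, 2625, 310161091944482, 1345, 318459230822690, 459196718063906, 2625, 1345,
  90602031587484210, 310161089847330, 423879739978018, 317359718080802, 317359725420834, 801,
  282445930991906, 317080547242274, 8391201, 2849, 1574449, 1050417, 295313381359650, 8391217,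
  352814675243554, 132145, 1050433, 2113, 495098623500578, 2369, 495098622452002, 8391233,
  34251847231577612354, 75881701186830386, 2369, 8391233, 310161091944482, 318459230822690, 8391233,
  2881, 493999106498850, 90602031587430706, 317359720177954, 8391217, 2865, 1574465, 1050433,
  295863139467298, 310161085587490, 132145, 352814673146402, 317359724372258, 132145,
  317359718080802, 132129, 1574449, 1073, 283545442689570, 1050417, 295313381359650, 2609,
  352814675214882, 1329, 1345, 1050433, 76444650838261810, 2369, 318180057952546, 2881,
  73150584636809778, 353235849453858, 1050433, 2113, 309061572780066, 2369, 318180060049698, 2881,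
  19452737514482335810, 353235851551010, 2369, 2881, 318180064244002, 353235853648162,
  353235855745314, 2865, 1050433, 2113, 309061572780066, 2369, 25028475333520744514, 2881,
  25028475196618661954, 1345, 19452737103776088130, 353235851551010, 2369, 2881, 310161090895906,
  1345, 318180057952546, 353235853648162, 2881, 1345, 108616430091739698, 310161089847330,
  353235849453858, 317359720177954, 2609, 1073, 1574465, 283545442750754, 2369, 389102851793186,
  283545447993634, 1329, 352814674166306, 2865, 352814680457762, 317359724372258, 1073, 2865,
  283545447932450, 317359718080802, 2865, 1329, 1574465, 1345, 73150583299875378, 1050433,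
  295863138287650, 2369, 318180059001122, 2881, 108616430359126578, 353235850502434, 2369, 1345,
  318180057952546, 2881, 318180064244002, 353235853648162, 2881, 1345, 426083057021218,
  353235855745314, 353235849453858, 317359725420834, 317359719129378, 2337, 317080551436578,
  282445935186210, 132129, 317080545145122, 1240760131858]

def st11_2 : ℕ × ℕ := (649195582989417462558435572715714,
  11132673762003053159113504905628697815421122)

def cert11_2 : List ℕ := [
  2099233, 2337, 197409, 334698499936290, 8391201, 334698507276322, 197409, 132129, 525873, 1841,
  295313381396514, 2353, 85823554297401394, 1329, 19955732880966119490, 1073, 283412567130658,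
  8391217, 19955733224563503170, 2353, 1329, 85823554028965938, 1073, 336347767377954, 8391217,
  85823555371143218, 1329, 8391217, 1345, 525889, 285611590460194, 2369, 85964291533049906, 2625,
  525905, 285611590517282, 2385, 111488285740765234, 285611595760162, 285611595703074, 525889, 1857,
  295863138258978, 2369, 85964291801485362, 2625, 353781311361826, 19991762094328475714, 2369, 2625,
  85964292875227186, 85964293143662642, 353781316604706, 8391217, 2865, 525889, 1857,
  495373769847330, 2369, 495373767750178, 8391233, 19317629255356125250, 19991761682011615298, 2369,
  8391233, 296962657423394, 85964291533049906, 8391233, 2881, 296962655326242, 353781310337826,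
  283412571324962, 8391201, 525873, 1841, 295313381396514, 2353, 85823554303692850, 132145,
  19955732813857255490, 2865, 19955733294893592642, 352681799680546, 2353, 132145,
  85823553766821938, 2865, 85823555645870130, 405616999927842, 132145, 2865, 525889, 1857,
  104260166646632498, 2369, 19317629255356125250, 2625, 19317629255356125250, 1345,
  20027790480909627458, 423879741026850, 2369, 2625, 296962657423394, 1345, 86105029028745266,
  423879744172578, 2625, 1345, 353781310325282, 423879745221154, 423879739978274, 352681797583394,
  352681804923426, 525873, 1841, 2353, 8391217, 132145, 295313382510626, 2353, 8391217, 132145,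
  82385312185151538, 8391217, 2865, 132145, 24567418832553078850, 1857, 2369, 495098619200034,
  8391233, 33422903425171066946, 298611917393954, 2369, 8391233, 76163177792081970, 285341279085346,
  8391233, 2881, 493999106523682, 285341280133922, 2353, 8391217, 2865, 132145, 103837952277352498,
  525889, 1857, 295863138324514, 8391233, 127167459548758578, 285341275951906, 8391233, 2881,
  493999106523682, 285341280146210, 8391217, 2865, 132145, 493449350709794, 525889, 1857,
  126885985106756146, 2369, 126885984569885234, 2881, 33422903425171066946, 285341275956002, 2369,
  2881, 126604510114316850, 285341279101730, 496747885593122, 8391201, 2849, 197409, 525873, 1841,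
  295313381396514, 2099249, 77881712273616946, 132145, 1857, 2099265, 495098623504930, 8391233,
  336622653870114, 75881701186867250, 2099265, 2369, 495098621407778, 8391233, 33422903426256343106,
  20009776080521097282, 8391233, 2881, 336622649675810, 353781310337570, 8391217, 352681799692834,
  2099249, 2353, 334973377843234, 132145, 525889, 1857, 495098623504930, 2369, 495098621407778,
  8391233, 19317629255356125250, 20009776080521097282, 2369, 8391233, 296962657423394,
  86034660277227570, 8391233, 2881, 296962655326242, 353781310337570, 8391217, 352681801789986,
  132145, 8391217, 352681797595682, 1927536521746, 197409, 132129, 525873, 1841, 295313381396514,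
  2099249, 77881712273616946, 1329, 1345, 1857, 285611591492386, 2099265, 285611592540962, 2881,
  285611595686690, 353235849458210, 1857, 2099265, 75952070738513970, 2881, 75952071543820338,
  353235851555362, 2099265, 2369, 335523134705698, 2881, 20027790891901087810, 353235852603938,
  353235855749666, 2865, 1857, 2099265, 28577030364376207426, 2881, 336622652821538, 1345,
  75952069939499058, 353235851555362, 2099265, 2369, 112191974541496370, 2881, 33422903426256343106,
  1345, 20027790481194840130, 353235852603938, 2881, 1345, 424150054495010, 336622649675810,
  353235849458210, 1073, 283412567138850, 352681799664162, 2099249, 2353, 334973377843234, 1329,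
  1345, 525889, 285611590452002, 2369, 285611593597730, 2881, 285611595694882, 353235849458210,
  525889, 1857, 295863138258978, 2369, 86105029292003378, 2881, 20027790891901087810,
  353235850506786, 2369, 2881, 86105030634180658, 353235853652514, 353235855749666, 2865, 525889,
  1857, 122344933631856690, 2369, 19317629255356125250, 2881, 19317629255356125250, 1345,
  20027790481194840130, 353235850506786, 2369, 2881, 296962656374818, 1345, 86105029029859378,
  353235853652514, 2881, 1345, 424150054503202, 296962655326242, 353235849458210, 1073,
  283412569236002, 352681801761314, 2865, 1329, 525889, 1345, 285611590464290, 1857,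
  295863138258978, 2099265, 78022450030407730, 2881, 424150055539490, 353235850506786, 2099265,
  1345, 285611592561442, 2369, 335523134705698, 2881, 424150057636642, 353235852603938, 2881, 1345,
  525905, 285611590525474, 2099281, 285611592622626, 496722116882978, 353235855749666,
  353235849458210, 2609, 352681804907042, 283412572381730, 1329, 352681798615586, 1381975011858]

def st11_3 : ℕ × ℕ := (158475672564008992123563036866,
  11132673761354016129186793373330134789017794)

def cert11_3 : List ℕ := [
  525857, 1825, 2097, 132145, 1329, 1345, 12585281, 285341279093538, 12585281, 8391233, 4196689,
  2641, 526001, 1969, 2225, 4196785, 71492112434, 525953, 2161, 557456515747667088418,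
  19055013386376151362, 104573664363774258, 140602461941744434, 320525653353506, 12585265, 1345,
  8391233, 2385, 2897, 320525653345058, 355164830909218, 355164833006370, 318326623732514,
  495923794101026, 12585265, 8391217, 4196673, 531653354357538, 132145, 1329, 12585265, 2113, 1345,
  285341278049058, 8391233, 2641, 2897, 355710025434146, 319430435619618, 319430436668194,
  318326626865954, 1345, 8391233, 285341280146210, 1252070081298, 8391233, 2881, 2129, 8391249,
  355710022300706, 319430433522466, 8391249, 2897, 525953, 1921, 8391297, 20497572436396696130,
  80068642609434674, 8391297, 2945, 1681, 8391313, 27925503767917847106, 136098861795328818,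
  20497572509411140162, 140602461651173682, 319430435619618, 318326628963106, 12585265, 8391217,
  2113, 1345, 4196689, 2641, 526001, 1969, 2225, 4196785, 71492112434, 525953, 2161,
  584535523456618274239120418, 19055013386376151362, 104578062410285362, 140606859988255538,
  320525653353250, 389816360715042, 1345, 2881, 2129, 4196689, 320525650207522, 425533574038306,
  4196689, 2641, 525953, 1921, 4196737, 20497572436128260674, 80068643146305586, 4196737, 2689,
  1713, 4196785, 23313536206062707266, 136103260377662258, 20497572646581658178, 140606859429249330,
  425533575086882, 4196673, 318326623740706, 2881, 4196673, 531653357552418, 2113, 12585281,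
  495373765612322, 12585281, 8391233, 388716842758946, 197409, 286358374608930, 12585249,
  286358380900386, 299488361189410, 12585249, 8391201, 525873, 1841, 2097, 295313386704930, 4196657,
  295313387753506, 132145, 295313382510626, 295313389850658, 2097, 4196657, 85816957233926194,
  132145, 77881712551489586, 77881714430537778, 4196657, 2609, 387891941548322, 132145,
  82455680931491890, 82455682810540082, 132145, 1329, 1857, 2113, 75881701994336306, 4196673,
  75881702262771762, 1345, 298611917393954, 75881702799642674, 2113, 4196673, 85957694185410610,
  1345, 285341278036770, 20009776493384265794, 4196673, 2625, 388441695265058, 1345,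
  285341279085346, 21180712396509048898, 285341281182498, 1857, 2113, 75881702000627762, 4196673,
  95246370328416306, 1345, 75881701195321394, 437150382493730, 2113, 4196673, 112191974542610482,
  1345, 20009776082678018114, 423879743136546, 4196673, 2625, 112191974005739570, 1345,
  21180711985802801218, 95246369254674482, 423879739990818, 2097, 4196657, 2609, 387891943645474,
  132145, 85816956697055282, 85816958576103474, 132145, 1329, 525889, 1857, 295863138324514,
  4196673, 22041198648902160450, 1345, 285341275947810, 20009776493384265794, 4196673, 2625,
  388441695265058, 1345, 86661381627187250, 22041198992499544130, 285341281190690, 525889, 1857,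
  295863138324514, 4196673, 21695529858060390466, 1345, 20009776082678018114, 423879741047586,
  4196673, 2625, 296962657423394, 1345, 22041198581793296450, 296962656374818, 423879739999010,
  4196657, 2609, 132145, 387891939451170, 387891946791202, 132145, 1329, 525889, 1857,
  295863138324514, 2113, 22041198648902160450, 2625, 99581812033134898, 1345, 285341275951906,
  21180712396509048898, 2113, 2625, 94964893439103026, 1345, 86661381627187250,
  22041198992499544130, 2625, 1345, 285341280146210, 99581813375312178, 285341281194786, 525889,
  1857, 295863138324514, 2113, 25325431432598917186, 2625, 25325431432598917186, 1345,
  21180711985802801218, 95246369254674482, 2113, 2625, 94964893439103026, 1345,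
  22041198581793296450, 296962656374818, 2625, 1345, 99581811770990898, 296962654277666,
  423879740003106, 525889, 1857, 295863138324514, 2113, 78022450039844914, 4196673,
  82596418419847218, 1345, 285341275960098, 423879741035298, 2113, 4196673, 85957694185410610, 1345,
  285341278057250, 423879743132450, 4196673, 2625, 388441695265058, 1345, 285341279105826,
  423879744181026, 1664386941714, 197409, 525873, 1841, 295313381396514, 2097, 300038117068834,
  132145, 73448481675702322, 8391217, 73448483286315058, 317497427566882, 2097, 132145,
  300038114971682, 8391217, 300038121263138, 335222485946402, 8391217, 2865, 525889, 1857, 2113,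
  495373769847330, 2369, 495373768798754, 8391233, 86239171067383858, 295863139438626, 2113, 2369,
  495373767750178, 8391233, 19317629255356125250, 78022450325057586, 2369, 8391233,
  19317629255356125250, 82596418697719858, 8391233, 2881, 494274255008290, 23486554995015446594,
  2113, 2369, 8391233, 296962657423394, 85957694463283250, 8391233, 2881, 494274257105442,
  95105631214833714, 2369, 8391233, 2881, 494274258154018, 99575214701224242, 494274253959714,
  132145, 525889, 1857, 295863138324514, 2113, 77091232972738610, 2369, 318596939260194, 1345,
  73729956937625650, 2881, 73729958548238386, 353510996849186, 2113, 2369, 77091233778044978, 1345,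
  77091232704303154, 2881, 77091234314915890, 353510998946338, 2369, 1345, 318596938211618, 2881,
  318596944503074, 353510999994914, 2881, 1345, 525905, 1873, 296962651066402, 2129,
  77654182942937138, 2385, 82123766430441778, 2641, 355710020170274, 425533571941154, 2129, 2385,
  86239169439993906, 2641, 355710022267426, 425533574038306, 2385, 2641, 355710023316002,
  425533575086882, 496447507411490, 353511002092066, 353510995800610, 317497431761186, 132145,
  317497425469730, 299488364335138, 197409, 299488358043682]

def st11_4 : ℕ × ℕ := (158495015377122826190342066246,
  11132673761354016148529606487164201568047174)

def cert11_4 : List ℕ := [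
  1050401, 2081, 1585, 132145, 1329, 1345, 12585281, 285341279085346, 12585281, 8391233, 4196689,
  2641, 1713, 1050545, 2225, 4196785, 29431306923811238466, 20496446737820553282, 1050465, 2145,
  557456515747667088418, 19631474142974533698, 470900907543082725666, 320525653353506, 12585265,
  1345, 8391233, 2385, 2897, 320525653336866, 355164830909218, 355164833006370, 318326623724322,
  495923794101026, 12585265, 8391217, 4196673, 531653354349346, 132145, 1329, 12585265, 1601, 1345,
  285341275951906, 8391233, 2641, 2897, 355710025425954, 319430435619618, 319430436668194,
  318326624768802, 1345, 8391233, 285341280146210, 1252070081298, 8391233, 2881, 1617, 8391249,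
  355710020203554, 319430431425314, 8391249, 2897, 1050465, 2145, 8391265, 20496446532194890306,
  80064244530417714, 8391265, 2913, 1937, 8391313, 27925503759327916610, 136098861812106034,
  20496446600914367042, 20207934812301979970, 319430435619618, 318326628963106, 12585265, 8391217,
  1601, 1345, 4196689, 2641, 1713, 1050545, 2225, 4196785, 29431306923811238466,
  20496446737820553282, 1050465, 2145, 584535523456618274239112226, 19631474142974533698,
  470900907543082725666, 320525653353250, 389816360715042, 1345, 2881, 1617, 4196689,
  320525648110370, 425533571941154, 4196689, 2641, 1050465, 2145, 4196705, 20496446531926454850,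
  80064245067288626, 4196705, 2657, 1969, 4196785, 23313536197472776770, 136103260394439474,
  20496446738084885058, 20207934743582503234, 425533575086882, 4196673, 318326623740706, 2881,
  4196673, 531653355455266, 1601, 12585281, 495373765612322, 12585281, 8391233, 388716842758946,
  197409, 290756421124386, 12585249, 290756427415842, 286225234792482, 12585249, 8391201, 1585,
  1050417, 2097, 308580807020578, 4196657, 82421596876312626, 132145, 75629912744075314,
  75629914623123506, 4196657, 2609, 387891941548066, 132145, 82421596071006258, 82421597950054450,
  132145, 1329, 1050433, 2113, 309130560737314, 4196673, 21171986397353087042, 1345,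
  285341276988194, 19433315741087113282, 4196673, 2625, 388441695264802, 1345, 83266021001138226,
  21171986672230993986, 285341281182498, 1050433, 2113, 309130560737314, 4196673,
  32773259110204444738, 1345, 19433315330380865602, 423879742087970, 4196673, 2625, 310230079836194,
  1345, 21171986261524746306, 310230078787618, 423879739990818, 1050417, 2097, 4196657,
  308580810166306, 132145, 308580804923426, 308580812263458, 4196657, 2609, 387891942596642, 132145,
  83581580838338866, 83581582717387058, 132145, 1329, 1601, 2113, 79278161595142194, 4196673,
  82562333559361586, 1345, 285341275943714, 19433315741087113282, 2113, 4196673, 79278162400448562,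
  1345, 311879339806754, 79278162937319474, 4196673, 2625, 388441695264802, 1345, 285341279089442,
  21468942772660764994, 285341281186594, 1601, 2113, 79278161601433650, 4196673, 100576733706784818,
  1345, 19433315330380865602, 423879741043490, 2113, 4196673, 91851009702367282, 1345,
  79278161332998194, 450417804906530, 4196673, 2625, 115588433606545458, 1345, 21468942361954517314,
  91851008897060914, 423879739994914, 4196657, 2609, 132145, 387891939450914, 387891946790946,
  132145, 1329, 1601, 1050433, 21171986397353087042, 2625, 91569532813054002, 1345,
  83266021001138226, 21171986672230993986, 1050433, 2113, 309130560737314, 2625, 99581812301570098,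
  1345, 285341277000482, 21468942772660764994, 2625, 1345, 285341280146210, 99581813375311922,
  285341281194786, 1601, 1050433, 25324305532692074562, 2625, 91569532813054002, 1345,
  21171986261524746306, 310230078787618, 1050433, 2113, 309130560737314, 2625, 25324305532692074562,
  1345, 21468942361954517314, 91851008897060914, 2625, 1345, 99581811770990642, 310230074593314,
  423879740003106, 1601, 1050433, 75770650232430642, 4196673, 82562333559361586, 1345,
  285341275960098, 423879741035298, 1050433, 2113, 309130560737314, 4196673, 83722318326694194,
  1345, 285341277008674, 423879742083874, 4196673, 2625, 388441695264802, 1345, 285341279105826,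
  423879744181026, 1664386941714, 197409, 1585, 1050417, 286774990671906, 132145, 286774987526178,
  8391217, 286774993817634, 321959358500898, 1050417, 2097, 308580803809314, 132145,
  74574381582549298, 8391217, 74574383193162034, 317497428615202, 8391217, 2865, 1601, 1050433,
  2113, 495373769847330, 2369, 495373768798754, 8391233, 21063900148307988546, 75770650517643314,
  2369, 8391233, 310230079836194, 82562333837234226, 8391233, 2881, 494274255008290,
  91710270588784690, 1050433, 2113, 2369, 495373766701602, 8391233, 82843810441334834,
  309130561851426, 2369, 8391233, 35151159714271858754, 83722318604566834, 8391233, 2881,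
  494274256056866, 23774785371167162690, 2369, 8391233, 2881, 494274258154018, 99575214701223986,
  494274253959714, 132145, 1601, 1050433, 73695872615125042, 2369, 73695873151995954, 1345,
  73695872078254130, 2881, 73695873688866866, 353510996849186, 1050433, 2113, 309130560737314, 2369,
  318596940308514, 1345, 74855856844472626, 2881, 74855858455085362, 353510997897762, 2369, 1345,
  318596938211362, 2881, 318596944502818, 353510999994914, 2881, 1345, 1617, 1050449,
  74258822585323570, 2385, 82843808813944882, 2641, 355710020170274, 425533571941154, 1050449, 2129,
  310230073479202, 2385, 82123766698876978, 2641, 355710021218850, 425533572989730, 2385, 2641,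
  355710023316002, 425533575086882, 496447507411490, 353511002092066, 353510995800610,
  317497431760930, 132145, 317497425469474, 286225236889634, 197409, 286225230598178]

def st11_5 : ℕ × ℕ := (4722366482869645213760,
  11149011303623843458013522930838119932485630)

def cert11_5 : List ℕ := [
  15730433, 14682113, 1574417, 1050385, 2065, 197409, 132129, 12585249, 1329, 8391217, 1345, 2625,
  2385, 391169000616482, 285611595764258, 2881, 285611595703074, 318051477369378, 2625,
  531902193943074, 371840584257310634530, 317497426526754, 1073, 8391217, 391169006973474, 8391217,
  2865, 8391233, 531906488971810, 318051477369378, 531906488971810, 12585249, 8391201, 132145, 2865,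
  4196673, 531927963808290, 389541208011298, 4196657, 531927963808290, 2865, 4196657, 12585265,
  8391217, 8391233, 496747886711330, 229905, 294901063450658, 12585233, 294901070790690, 3,
  12585233, 3, 229905, 197393, 246017, 14682129, 12585233, 525857, 1825, 2099233, 295038508732450,
  197409, 295038503489570, 8391201, 295038510829602, 2099233, 2337, 334698503082018, 197409,
  77811343529439282, 8391201, 77811345408487474, 197409, 132129, 1841, 2099249, 75670595743911986,
  1329, 75670594938605618, 1073, 296687770931234, 8391217, 75670596280782898, 2099249, 2353,
  334973377843234, 1329, 19955732880966119490, 1073, 283412569219618, 8391217, 19955733224563503170,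
  1329, 8391217, 1345, 1857, 75811332442689586, 2099265, 285611592557346, 2625, 1873,
  94529418393948210, 2099281, 285611592606242, 285611595751970, 285611595703074, 1857, 2099265,
  75811333247995954, 2625, 75811333784866866, 75811334053302322, 2099265, 2369, 335523134705698,
  2625, 353781313458978, 19991762094328475714, 353781316604706, 8391217, 2865, 1857, 2099265,
  495373769847330, 8391233, 336622653870114, 75811332442689586, 2099265, 2369, 495373767750178,
  8391233, 33422903426256343106, 19991761682011615298, 8391233, 2881, 336622649675810,
  353781310337826, 283412571316770, 8391201, 1841, 2099249, 75670595750203442, 132145,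
  75670594676461618, 2865, 75670596555509810, 365957003481122, 2099249, 2353, 334973377843234,
  132145, 19955732813857255490, 2865, 19955733294893592642, 352681801769506, 132145, 2865, 1857,
  2099265, 23947329878719860802, 2625, 336622653870114, 1345, 75952069938384946, 423879742075426,
  2099265, 2369, 94107207556272178, 2625, 33422903426256343106, 1345, 20027790480909627458,
  423879743124002, 2625, 1345, 353781310317090, 423879745221154, 423879739978274, 352681797575202,
  352681804915234, 1841, 2099249, 2353, 8391217, 132145, 79007612465668146, 8391217, 2865, 132145,
  93684993186992178, 2099265, 2369, 335523134771234, 8391233, 127167460087718450, 285341278040866,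
  8391233, 2881, 493999106515490, 285341280138018, 2099249, 2353, 8391217, 132145, 334973378957346,
  8391217, 2865, 132145, 24567418832553078850, 1857, 2369, 495098619191842, 8391233,
  86316136882442290, 285341276996386, 2369, 8391233, 19317629254805622850, 338271913840674, 8391233,
  2881, 493999106515490, 285341280142114, 8391217, 2865, 132145, 493449350701602, 1857, 2099265,
  126885985106747954, 2881, 126604509577437746, 285341277004578, 2099265, 2369, 126885984569877042,
  2881, 19317629254805622850, 285341278053154, 496747885584930, 3, 229905, 3, 525841,
  286083501879330, 229905, 525841, 286083495587874, 1151957274642, 246017, 229889, 15730449,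
  14682129, 3, 197393, 1825, 801, 1585, 295708518387746, 14682161, 282510089216034, 132129,
  290756422152482, 14682145, 290756426346786, 286225234792482, 801, 14682145, 282510089154850,
  286225230598178, 14682145, 12585249, 1585, 2099249, 286633257803810, 132145, 286633253609506,
  8391217, 286633259900962, 290971441106978, 2099249, 2353, 335111085170722, 132145,
  76826181396230450, 8391217, 76826183006843186, 290971443204130, 8391217, 2865, 1601, 1857,
  2099265, 78058734753026098, 8391233, 92784562437034034, 75770650512400434, 2099265, 2369,
  495373767749922, 8391233, 111080436744261682, 78058734216155186, 8391233, 2881, 494274255008034,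
  91673986705072178, 1857, 2099265, 2369, 495373766701346, 8391233, 82843810446577714,
  79218718983467314, 8391233, 2881, 494274256056610, 92784562168598578, 2099265, 2369, 8391233,
  111080435938955314, 335660843278370, 8391233, 2881, 82843809372835890, 24351246123470582082,
  494274253959458, 132145, 1601, 1857, 292070952800290, 2099265, 78058733930942514, 1345,
  73659588194541618, 2881, 73659589805154354, 353510996848930, 1857, 2099265, 292070954897442, 1345,
  292070951751714, 2881, 292070958043170, 362439694815266, 2099265, 2369, 335660842164258, 1345,
  77107656658153778, 2881, 77107658268766514, 353510998946082, 2881, 1345, 1617, 1873,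
  75333113897816114, 2099281, 78340209192865842, 2641, 355710020170018, 425533571941154, 1873,
  2099281, 75333114434687026, 2641, 75333114971557938, 425533572989730, 2099281, 2385,
  336760354906146, 2641, 355710022267170, 425533574038306, 425533576135458, 353511002091810,
  353510995800354, 290971445301282, 132145, 290971439009826, 132129, 1585, 1073, 286633253609506,
  2097, 286633257803810, 1329, 286633254658082, 12585265, 286633258852386, 290971441106978, 2097,
  1073, 301009044840482, 1329, 76826181659423026, 12585265, 76826182733164850, 290971443204130,
  1073, 12585265, 72604058086699314, 290971439009826, 12585265, 8391217, 1601, 1857,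
  287324746551330, 4196673, 287324748648482, 1345, 287324744454178, 2881, 287324750745634,
  304916929318946, 1857, 4196673, 83777364231852082, 1345, 74715119355048242, 2881,
  74715120965660978, 300459293417506, 4196673, 2625, 388716841546018, 1345, 20892481609380557122,
  2881, 20892482021697417538, 300459295514658, 2881, 1345, 1617, 1873, 74118085098082354, 2129,
  74118085366517810, 4196689, 74118085634953266, 425533571940898, 1873, 2129, 302658316738594,
  4196689, 84058837889519666, 425533572989474, 2129, 4196689, 302658318835746, 425533574038050,
  4196689, 2641, 389816354353442, 425533575086626, 300459297611810, 300459291320354, 1329, 1601,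
  1345, 287324744454178, 1857, 287324746551330, 2369, 287324748648482, 8391233, 287324749697058,
  304916929318946, 1857, 1345, 75333114662096946, 2369, 83777362889674802, 8391233,
  74715120697225522, 300459293417506, 2369, 1345, 320529940754722, 8391233, 20892481951635763522,
  300459295514658, 1345, 8391233, 18730754131571667266, 300459291320354, 8391233, 2881, 1617, 1873,
  293170464493602, 2129, 78340209170845746, 8391249, 92132484658171954, 319430431420706, 1873, 2129,
  293170466590754, 8391249, 293170468687906, 328354835402786, 2129, 8391249, 95494928654868530,
  319430433517858, 8391249, 2897, 495923789775394, 319430435615010, 300459296563234,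
  290971444252706, 290971440058402, 286225235841058, 132129, 286225231646754, 1553, 286083500810274,
  281960332222498, 197393, 286083496615970, 1118604169234]

def cert11 : List ℕ := [
  16254465, 3, 246017, 229889]


/-! ### Refuted states -/

def dH : List ℕ := [2, 2, 2, 2, 2, 2, 2, 2, 2, 2, 2, 2]

theorem dH_spec : ∀ i < 12, dH.getD i 0 = 2 := by decide

theorem consH_ok : consOK dH false consH = true := by decide +kernel

/-- A leaf is killed by a matching, or is one of the states that were refuted before. -/
def leafL (sts : List (ℕ × ℕ)) (t E U : ℕ) : Bool :=
  match Nat.beq (nib t 0) 3 with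
  | true => sts.any fun p => Nat.beq p.1 E && Nat.beq p.2 U
  | false => leafKill consH t E U

/-- No arrowing graph with the degrees `D` is in the state `p`. -/
def Ref (o1 : Bool) (D : List ℕ) (p : ℕ × ℕ) : Prop :=
  ∀ (V : Type) [Fintype V] (F : SimpleGraph V), Fintype.card V = 12 →
    Arrows F (pathGraph 3) (cycleGraph 12) →
    (o1 = true → ∀ x, {w | F.Adj x w ∧ dg F w = 3}.ncard ≤ 2) →
    ∀ e : ℕ → V, Lab e → (∀ i < 12, D.getD i 0 ≠ 0 → dg F (e i) = D.getD i 0) →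
    ¬ St (rel F e) p.1 p.2

theorem ref_of_check {o1 : Bool} {D : List ℕ} {cons : List CCon} {cert : List ℕ}
    {sts : List (ℕ × ℕ)} {p : ℕ × ℕ} (hok : consOK D o1 cons = true)
    (hs : ∀ q ∈ sts, Ref o1 D q)
    (h : check D cons (leafL sts) 60 cert p.1 p.2 (fun l => l.isEmpty) = true) : Ref o1 D p := by
  intro V _ F hV hF ho e he hD
  refine run_sound hV hok ho ?_ h he hD
  intro t E U h e he hD
  unfold leafL at h
  split at h
  · rw [List.any_eq_true] at h
    obtain ⟨q, hq, h⟩ := h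
    rw [Bool.and_eq_true, Nat.beq_eq, Nat.beq_eq] at h
    rw [← h.1, ← h.2]
    exact hs q hq V F hV hF ho e he hD
  · exact leafKill_sound hV hF consH_ok dH_spec he h

/-! ### Running the checker -/

theorem ok0 : consOK dseq0 false cons0 = true := by decide +kernel

theorem r0 : Ref false dseq0 (edges3, fullU) :=
  ref_of_check ok0 (cert := cert0)
    (sts := [])
    (List.forall_mem_nil _)
    (by decide +kernel)

theorem ok1 : consOK dseq1 true cons1 = true := by decide +kernel

theorem r1 : Ref true dseq1 (0, fullU) :=
  ref_of_check ok1 (cert := cert1)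
    (sts := [])
    (List.forall_mem_nil _)
    (by decide +kernel)

theorem ok2 : consOK dseq2 true cons2 = true := by decide +kernel

theorem r2 : Ref true dseq2 (0, fullU) :=
  ref_of_check ok2 (cert := cert2)
    (sts := [])
    (List.forall_mem_nil _)
    (by decide +kernel)

theorem ok3 : consOK dseq3 true cons3 = true := by decide +kernel

theorem r3 : Ref true dseq3 (0, fullU) :=
  ref_of_check ok3 (cert := cert3)
    (sts := [])
    (List.forall_mem_nil _)
    (by decide +kernel)

theorem ok4 : consOK dseq4 true cons4 = true := by decide +kernel

theorem r4 : Ref true dseq4 (0, fullU) :=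
  ref_of_check ok4 (cert := cert4)
    (sts := [])
    (List.forall_mem_nil _)
    (by decide +kernel)

theorem ok5 : consOK dseq5 true cons5 = true := by decide +kernel

theorem r5 : Ref true dseq5 (0, fullU) :=
  ref_of_check ok5 (cert := cert5)
    (sts := [])
    (List.forall_mem_nil _)
    (by decide +kernel)

theorem ok6 : consOK dseq6 true cons6 = true := by decide +kernel

theorem r6 : Ref true dseq6 (0, fullU) :=
  ref_of_check ok6 (cert := cert6)
    (sts := [])
    (List.forall_mem_nil _)
    (by decide +kernel)

theorem ok7 : consOK dseq7 true cons7 = true := by decide +kernel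

theorem r7_0 : Ref true dseq7 st7_0 :=
  ref_of_check ok7 (cert := cert7_0)
    (sts := [])
    (List.forall_mem_nil _)
    (by decide +kernel)

theorem r7 : Ref true dseq7 (0, fullU) :=
  ref_of_check ok7 (cert := cert7)
    (sts := [st7_0])
    (List.forall_mem_cons.2 ⟨r7_0, List.forall_mem_nil _⟩)
    (by decide +kernel)

theorem ok8 : consOK dseq8 true cons8 = true := by decide +kernel

theorem r8 : Ref true dseq8 (0, fullU) :=
  ref_of_check ok8 (cert := cert8)
    (sts := [])
    (List.forall_mem_nil _)
    (by decide +kernel)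

theorem ok9 : consOK dseq9 true cons9 = true := by decide +kernel

theorem r9_0 : Ref true dseq9 st9_0 :=
  ref_of_check ok9 (cert := cert9_0)
    (sts := [])
    (List.forall_mem_nil _)
    (by decide +kernel)

theorem r9 : Ref true dseq9 (0, fullU) :=
  ref_of_check ok9 (cert := cert9)
    (sts := [st9_0])
    (List.forall_mem_cons.2 ⟨r9_0, List.forall_mem_nil _⟩)
    (by decide +kernel)

theorem ok10 : consOK dseq10 true cons10 = true := by decide +kernel

theorem r10_0 : Ref true dseq10 st10_0 :=
  ref_of_check ok10 (cert := cert10_0)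
    (sts := [])
    (List.forall_mem_nil _)
    (by decide +kernel)

theorem r10_1 : Ref true dseq10 st10_1 :=
  ref_of_check ok10 (cert := cert10_1)
    (sts := [])
    (List.forall_mem_nil _)
    (by decide +kernel)

theorem r10_2 : Ref true dseq10 st10_2 :=
  ref_of_check ok10 (cert := cert10_2)
    (sts := [st10_0, st10_1])
    (List.forall_mem_cons.2 ⟨r10_0, List.forall_mem_cons.2 ⟨r10_1, List.forall_mem_nil _⟩⟩)
    (by decide +kernel)

theorem r10_3 : Ref true dseq10 st10_3 :=
  ref_of_check ok10 (cert := cert10_3)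
    (sts := [])
    (List.forall_mem_nil _)
    (by decide +kernel)

theorem r10_4 : Ref true dseq10 st10_4 :=
  ref_of_check ok10 (cert := cert10_4)
    (sts := [])
    (List.forall_mem_nil _)
    (by decide +kernel)

theorem r10_5 : Ref true dseq10 st10_5 :=
  ref_of_check ok10 (cert := cert10_5)
    (sts := [])
    (List.forall_mem_nil _)
    (by decide +kernel)

theorem r10_6 : Ref true dseq10 st10_6 :=
  ref_of_check ok10 (cert := cert10_6)
    (sts := [])
    (List.forall_mem_nil _)
    (by decide +kernel)

theorem r10_7 : Ref true dseq10 st10_7 :=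
  ref_of_check ok10 (cert := cert10_7)
    (sts := [])
    (List.forall_mem_nil _)
    (by decide +kernel)

theorem r10 : Ref true dseq10 (0, fullU) :=
  ref_of_check ok10 (cert := cert10)
    (sts := [st10_2, st10_3, st10_4, st10_5, st10_6, st10_7])
    (List.forall_mem_cons.2 ⟨r10_2, List.forall_mem_cons.2 ⟨r10_3, List.forall_mem_cons.2 ⟨r10_4, List.forall_mem_cons.2 ⟨r10_5, List.forall_mem_cons.2 ⟨r10_6, List.forall_mem_cons.2 ⟨r10_7, List.forall_mem_nil _⟩⟩⟩⟩⟩⟩)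
    (by decide +kernel)

theorem ok11 : consOK dseq11 true cons11 = true := by decide +kernel

theorem r11_0 : Ref true dseq11 st11_0 :=
  ref_of_check ok11 (cert := cert11_0)
    (sts := [])
    (List.forall_mem_nil _)
    (by decide +kernel)

theorem r11_1 : Ref true dseq11 st11_1 :=
  ref_of_check ok11 (cert := cert11_1)
    (sts := [])
    (List.forall_mem_nil _)
    (by decide +kernel)

theorem r11_2 : Ref true dseq11 st11_2 :=
  ref_of_check ok11 (cert := cert11_2)
    (sts := [])
    (List.forall_mem_nil _)
    (by decide +kernel)

theorem r11_3 : Ref true dseq11 st11_3 :=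
  ref_of_check ok11 (cert := cert11_3)
    (sts := [])
    (List.forall_mem_nil _)
    (by decide +kernel)

theorem r11_4 : Ref true dseq11 st11_4 :=
  ref_of_check ok11 (cert := cert11_4)
    (sts := [])
    (List.forall_mem_nil _)
    (by decide +kernel)

theorem r11_5 : Ref true dseq11 st11_5 :=
  ref_of_check ok11 (cert := cert11_5)
    (sts := [st11_0, st11_1, st11_2, st11_3, st11_4])
    (List.forall_mem_cons.2 ⟨r11_0, List.forall_mem_cons.2 ⟨r11_1, List.forall_mem_cons.2 ⟨r11_2, List.forall_mem_cons.2 ⟨r11_3, List.forall_mem_cons.2 ⟨r11_4, List.forall_mem_nil _⟩⟩⟩⟩⟩)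
    (by decide +kernel)

theorem r11 : Ref true dseq11 (0, fullU) :=
  ref_of_check ok11 (cert := cert11)
    (sts := [st11_5])
    (List.forall_mem_cons.2 ⟨r11_5, List.forall_mem_nil _⟩)
    (by decide +kernel)

/-! ### The lower bound -/

/-- Sorted lists of length `n` with entries at least `lo` and sum `s`. -/
def sortedLists : ℕ → ℕ → ℕ → List (List ℕ)
  | 0, _, _ => [[]]
  | n + 1, lo, s => (List.range (s / (n + 1) + 1)).flatMap fun d =>
      if lo ≤ d then
        match n with
        | 0 => if d = s then [[d]] else []
        | m + 1 => (sortedLists (m + 1) d (s - d)).map fun l => d :: l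
      else []

theorem sorted_sum_le (l : List ℕ) (d : ℕ) (h : ∀ x ∈ l, d ≤ x) : d * l.length ≤ l.sum := by
  induction l with
  | nil => simp
  | cons a l ih =>
    have h1 := h a (by simp)
    have h2 := ih (fun x hx => h x (by simp [hx]))
    simp only [List.length_cons, List.sum_cons]
    nlinarith

theorem mem_sortedLists (n : ℕ) : ∀ (lo s : ℕ) (l : List ℕ), l.length = n → l.sum = s →
    (∀ x ∈ l, lo ≤ x) → l.Pairwise (· ≤ ·) → l ∈ sortedLists n lo s := by
  induction n with
  | zero =>
    intro lo s l hl _ _ _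
    rw [List.length_eq_zero_iff] at hl
    simp [sortedLists, hl]
  | succ n ih =>
    intro lo s l hl hs hlo hp
    cases l with
    | nil => simp at hl
    | cons d l =>
      have hl' : l.length = n := by simpa using hl
      have hd := sorted_sum_le (d :: l) d (by
        intro x hx
        rcases List.mem_cons.1 hx with rfl | hx
        · exact le_refl _
        · exact List.rel_of_pairwise_cons hp hx)
      rw [hl, hs] at hd
      unfold sortedLists
      rw [List.mem_flatMap]
      refine ⟨d, ?_, ?_⟩
      · rw [List.mem_range]
        exact Nat.lt_succ_of_le ((Nat.le_div_iff_mul_le (Nat.succ_pos n)).2 hd)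
      · rw [if_pos (hlo d (by simp))]
        cases n with
        | zero =>
          rw [List.length_eq_zero_iff] at hl'
          subst hl'
          simp at hs
          simp [hs]
        | succ m =>
          simp only [List.mem_map]
          refine ⟨l, ih d (s - d) l hl' ?_ ?_ hp.of_cons, rfl⟩
          · rw [List.sum_cons] at hs
            omega
          · intro x hx
            exact List.rel_of_pairwise_cons hp hx

theorem sortedLists_eq : (sortedLists 12 3 42).all (fun l =>
    [dseq1, dseq2, dseq3, dseq4, dseq5, dseq6, dseq7, dseq8, dseq9, dseq10, dseq11].contains l)
    = true := by
  decide +kernel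

theorem full_spec : ∀ i < 12, ∀ j < 12, i ≠ j → bit fullU (12 * i + j) = true := by
  decide +kernel

theorem full_diag : ∀ i < 12, bit fullU (12 * i + i) = false := by
  decide +kernel

theorem full_sym : Sym fullU := by
  intro i hi j hj h
  by_cases hij : i = j
  · subst hij
    exact h
  · have := full_spec j hj i hi (Ne.symm hij)
    rwa [bit_eq] at this

theorem full_T {i j : ℕ} (hi : i < 12) (hj : j < 12) (hij : i ≠ j) : T fullU i j := by
  have := full_spec i hi j hj hij
  rwa [bit_eq] at this

theorem edges3_eq : edges3 = Nat.lor (pr 0 3) (Nat.lor (pr 1 3) (pr 2 3)) := by decide +kernel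

theorem dseq0_spec : ∀ i < 12, dseq0.getD i 0 ≠ 0 → i < 3 ∧ dseq0.getD i 0 = 3 := by
  decide

section Lower

variable {V : Type} [Fintype V]

theorem obs1 (hV : Fintype.card V = 12) {F : SimpleGraph V}
    (hF : Arrows F (pathGraph 3) (cycleGraph 12)) (x : V) :
    {w | F.Adj x w ∧ dg F w = 3}.ncard ≤ 2 := by
  classical
  by_contra hcon
  rw [not_le, Set.two_lt_ncard (Set.toFinite _)] at hcon
  obtain ⟨a, ha, b, hb, c, hc, hab, hac, hbc⟩ := hcon
  have hxa := ha.1.ne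
  have hxb := hb.1.ne
  have hxc := hc.1.ne
  let f : Fin 12 → V := fun i => if i = 0 then a else if i = 1 then b else if i = 2 then c else x
  have f0 : f 0 = a := by simp [f]
  have f1 : f 1 = b := by simp [f]
  have f2 : f 2 = c := by simp [f]
  have f3 : f 3 = x := by simp [f]
  obtain ⟨g, hg⟩ := Finset.exists_equiv_extend_of_card_eq (α := Fin 12) (t := (Finset.univ : Finset V))
    (by simp [hV]) (s := {0, 1, 2, 3}) (f := f) (by simp) (by
      intro i hi j hj hij
      simp only [Finset.coe_insert, Finset.coe_singleton, Set.mem_insert_iff,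
        Set.mem_singleton_iff] at hi hj
      rcases hi with rfl | rfl | rfl | rfl <;> rcases hj with rfl | rfl | rfl | rfl <;>
        simp only [f0, f1, f2, f3] at hij <;> first | rfl | (exfalso; tauto))
  let e : ℕ → V := fun i => (g (Fin.ofNat 12 i) : V)
  have he : Lab e := by
    intro i hi j hj h
    have h1 := g.injective (Subtype.ext h)
    have h2 := congrArg Fin.val h1
    simp only [Fin.ofNat] at h2
    omega
  have e0 : e 0 = a := (hg 0 (by simp)).trans f0
  have e1 : e 1 = b := (hg 1 (by simp)).trans f1
  have e2 : e 2 = c := (hg 2 (by simp)).trans f2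
  have e3 : e 3 = x := (hg 3 (by simp)).trans f3
  refine r0 V F hV hF (by simp) e he ?_ ?_
  · intro i hi h
    obtain ⟨h1, h2⟩ := dseq0_spec i hi h
    rw [h2]
    interval_cases i
    · rw [e0]; exact ha.2
    · rw [e1]; exact hb.2
    · rw [e2]; exact hc.2
  · show St (rel F e) edges3 fullU
    rw [edges3_eq]
    have s1 : Sym (pr 0 3) := Sym.pr (by norm_num) (by norm_num)
    have s2 : Sym (pr 1 3) := Sym.pr (by norm_num) (by norm_num)
    have s3 : Sym (pr 2 3) := Sym.pr (by norm_num) (by norm_num)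
    refine ⟨s1.lor (s2.lor s3), full_sym, fun i hi j hj => ⟨fun h => ?_, fun h => ?_⟩⟩
    · rw [T_lor, T_lor, T_pr (by norm_num) (by norm_num) hi hj,
        T_pr (by norm_num) (by norm_num) hi hj, T_pr (by norm_num) (by norm_num) hi hj] at h
      show F.Adj (e i) (e j)
      rcases h with (⟨rfl, rfl⟩ | ⟨rfl, rfl⟩) | (⟨rfl, rfl⟩ | ⟨rfl, rfl⟩) | (⟨rfl, rfl⟩ | ⟨rfl, rfl⟩)
      · rw [e0, e3]; exact ha.1.symm
      · rw [e0, e3]; exact ha.1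
      · rw [e1, e3]; exact hb.1.symm
      · rw [e1, e3]; exact hb.1
      · rw [e2, e3]; exact hc.1.symm
      · rw [e2, e3]; exact hc.1
    · refine full_T hi hj ?_
      rintro rfl
      exact SimpleGraph.irrefl _ h

theorem final_run (hV : Fintype.card V = 12) {F : SimpleGraph V}
    (hF : Arrows F (pathGraph 3) (cycleGraph 12)) {D : List ℕ}
    (h : Ref true D (0, fullU))
    {e : ℕ → V} (he : Lab e) (hD : ∀ i < 12, dg F (e i) = D.getD i 0) : False := by
  refine h V F hV hF (fun _ => obs1 hV hF) e he (fun i hi _ => hD i hi) ?_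
  refine ⟨?_, full_sym, fun i hi j hj => ⟨fun h => ?_, fun h => ?_⟩⟩
  · intro i _ j _ h
    simp [T] at h
  · simp [T] at h
  · refine full_T hi hj ?_
    rintro rfl
    exact SimpleGraph.irrefl _ h

theorem lower_eq (hV : Fintype.card V = 12) {F : SimpleGraph V} (hc : F.edgeSet.ncard = 21)
    (hF : Arrows F (pathGraph 3) (cycleGraph 12)) : False := by
  classical
  have hsum : ∑ v, dg F v = 42 := by
    have h := F.sum_degrees_eq_twice_card_edges
    rw [← SimpleGraph.coe_edgeFinset, Set.ncard_coe_finset] at hc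
    rw [hc] at h
    rw [← show _ = 42 from h]
    refine Finset.sum_congr rfl fun v _ => ?_
    unfold dg
    rw [← SimpleGraph.card_neighborFinset_eq_degree, ← Set.ncard_coe_finset,
      SimpleGraph.coe_neighborFinset]
  let σ : Fin 12 ≃ V := (Fintype.equivFinOfCardEq hV).symm
  let f : Fin 12 → ℕ := fun i => dg F (σ i)
  let τ := Tuple.sort f
  let L := List.ofFn (f ∘ τ)
  let e : ℕ → V := fun i => σ (τ (Fin.ofNat 12 i))
  have he : Lab e := by
    intro i hi j hj h
    have h1 := τ.injective (σ.injective h)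
    have h2 := congrArg Fin.val h1
    simp only [Fin.ofNat] at h2
    omega
  have hL : L ∈ sortedLists 12 3 42 := by
    apply mem_sortedLists
    · simp [L]
    · simp only [L, List.sum_ofFn]
      rw [← hsum, ← Equiv.sum_comp (τ.trans σ)]
      rfl
    · intro x hx
      simp only [L, List.mem_ofFn] at hx
      obtain ⟨i, rfl⟩ := hx
      exact three_le_dg hV hF _
    · rw [List.pairwise_ofFn]
      intro i j hij
      exact Tuple.monotone_sort f hij.le
  have hD : ∀ i < 12, dg F (e i) = L.getD i 0 := by
    intro i hi
    simp only [L, List.getD_eq_getElem?_getD, List.getElem?_ofFn, hi, dif_pos, Option.getD_some]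
    have : Fin.ofNat 12 i = ⟨i, hi⟩ := Fin.ext (Nat.mod_eq_of_lt hi)
    simp only [e, this, f, Function.comp]
  have h := List.all_eq_true.1 sortedLists_eq L hL
  rw [List.contains_iff_mem] at h
  clear_value L
  simp only [List.mem_cons, List.not_mem_nil, or_false] at h
  rcases h with rfl | rfl | rfl | rfl | rfl | rfl | rfl | rfl | rfl | rfl | rfl
  · exact final_run hV hF r1 he hD
  · exact final_run hV hF r2 he hD
  · exact final_run hV hF r3 he hD
  · exact final_run hV hF r4 he hD
  · exact final_run hV hF r5 he hD
  · exact final_run hV hF r6 he hD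
  · exact final_run hV hF r7 he hD
  · exact final_run hV hF r8 he hD
  · exact final_run hV hF r9 he hD
  · exact final_run hV hF r10 he hD
  · exact final_run hV hF r11 he hD

theorem contains_mono {α β : Type} {F F' : SimpleGraph α} {G : SimpleGraph β} (h : F ≤ F')
    (hc : Contains F G) : Contains F' G := by
  obtain ⟨f, hf⟩ := hc
  exact ⟨⟨f, fun hab => h (f.map_adj hab)⟩, hf⟩

theorem arrows_mono {α β γ : Type} {F F' : SimpleGraph α} {G : SimpleGraph β} {H : SimpleGraph γ}
    (h : F ≤ F') (hF : Arrows F G H) : Arrows F' G H := by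
  intro R hR
  rcases hF (R ⊓ F) inf_le_right with h1 | h1
  · exact Or.inl (contains_mono inf_le_left h1)
  · refine Or.inr (contains_mono ?_ h1)
    intro x y hxy
    rw [SimpleGraph.sdiff_adj, SimpleGraph.inf_adj] at hxy
    rw [SimpleGraph.sdiff_adj]
    exact ⟨h hxy.1, fun hR => hxy.2 ⟨hR, hxy.1⟩⟩

theorem lower_lt (hV : Fintype.card V = 12) {F : SimpleGraph V} (hc : F.edgeSet.ncard < 22)
    (hF : Arrows F (pathGraph 3) (cycleGraph 12)) : False := by
  classical
  have hc' : F.edgeFinset.card ≤ 21 := by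
    rw [← SimpleGraph.coe_edgeFinset, Set.ncard_coe_finset] at hc
    omega
  have htop : 21 ≤ (⊤ : SimpleGraph V).edgeFinset.card := by
    rw [SimpleGraph.card_edgeFinset_top_eq_card_choose_two, hV]
    decide
  obtain ⟨t, ht1, ht2, ht3⟩ := Finset.exists_subsuperset_card_eq
    (SimpleGraph.edgeFinset_mono (le_top : F ≤ ⊤)) hc' htop
  have hes : (SimpleGraph.fromEdgeSet (t : Set (Sym2 V))).edgeSet = t := by
    rw [SimpleGraph.edgeSet_fromEdgeSet]
    ext x
    simp only [Set.mem_sdiff, Finset.mem_coe, and_iff_left_iff_imp]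
    intro hx
    have := ht2 hx
    rw [SimpleGraph.mem_edgeFinset] at this
    exact SimpleGraph.not_isDiag_of_mem_edgeSet _ this
  refine lower_eq hV (F := SimpleGraph.fromEdgeSet (t : Set (Sym2 V))) ?_ (arrows_mono ?_ hF)
  · rw [hes, Set.ncard_coe_finset, ht3]
  · rw [← SimpleGraph.edgeSet_subset_edgeSet, hes, ← SimpleGraph.coe_edgeFinset]
    exact_mod_cast ht1

end Lower

end RS

theorem stmt_12 :
    (∃ F : SimpleGraph (Fin 12), F.edgeSet.ncard = 22 ∧
      Arrows F (pathGraph 3) (cycleGraph 12)) ∧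
    (∀ (V : Type) [Fintype V] (F : SimpleGraph V), Fintype.card V = 12 →
      F.edgeSet.ncard < 22 → ¬ Arrows F (pathGraph 3) (cycleGraph 12)) :=
  ⟨⟨RS.FU, RS.FU_card, RS.FU_arrows⟩, fun _ _ _ hV hc hF => RS.lower_lt hV hc hF⟩
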